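/- arXiv:1303.4248 — 3 statements merged into one kernel-verified Lean document; each statement's English description precedes it below -/
import Mathlib

section
/- Let f be a C^∞ map of a compact interval or circle N with all critical points non-flat. Then there exist a neighbourhood F of f in the C^∞ topology and a function ρ(ε, N₀) such that: if g ∈ F, J ⊂ T are intervals such that g^m restricted to T is a diffeomorphism and the intersection multiplicity of the intervals g^k(T), k = 0, …, m−1, is at most N₀, then D(T, J) < ρ(D(g^m(T), g^m(J)), N₀). Moreover ρ(ε, N₀) → 0 as ε → 0 with N₀ fixed. -/
open Set Filter Topology MeasureTheory

noncomputable section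

/-- The length of a set of reals (its Lebesgue measure). -/
def slen (S : Set ℝ) : ℝ := (volume S).toReal

/-- The cross-ratio `D(T,J)` for intervals `T = [t1,t2] ⊇ J = [j1,j2]`. -/
def crossRatio (t1 j1 j2 t2 : ℝ) : ℝ :=
  ((t2 - t1) * (j2 - j1)) / ((j1 - t1) * (t2 - j2))

/-- The cross-ratio distortion `B(f,T,J)` for `T = [t1,t2] ⊇ J = [j1,j2]`. -/
def crDist (f : ℝ → ℝ) (t1 j1 j2 t2 : ℝ) : ℝ :=
  crossRatio (f t1) (f j1) (f j2) (f t2) / crossRatio t1 j1 j2 t2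

/-- The Schwarzian derivative of `f`. -/
def schwarzian (f : ℝ → ℝ) (x : ℝ) : ℝ :=
  iteratedDeriv 3 f x / deriv f x - (3 / 2) * (iteratedDeriv 2 f x / deriv f x) ^ 2

/-- The `l`-scaling `lI` of the interval `I` with endpoints `x ≤ y`
(same centre, half-width multiplied by `l`). -/
def scaledIcc (l x y : ℝ) : Set ℝ :=
  Icc ((x + y) / 2 - l * (y - x) / 2) ((x + y) / 2 + l * (y - x) / 2)

/-- The `l`-scaling of a bounded interval given as a set. -/
def scaledSet (l : ℝ) (S : Set ℝ) : Set ℝ := scaledIcc l (sInf S) (sSup S)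

/-- `p` is a periodic point of `g` of (exact) period `n`. -/
def PeriodicPt (g : ℝ → ℝ) (p : ℝ) (n : ℕ) : Prop :=
  0 < n ∧ g^[n] p = p ∧ ∀ m, 0 < m → m < n → g^[m] p ≠ p

/-- The forward orbit of `p` under `g`. -/
def orbitSet (g : ℝ → ℝ) (p : ℝ) : Set ℝ := Set.range fun k => g^[k] p

/-- The iterates of `x` converge to the set `O`. -/
def ConvergesToOrbit (g : ℝ → ℝ) (x : ℝ) (O : Set ℝ) : Prop :=
  Tendsto (fun k => Metric.infDist (g^[k] x) O) atTop (nhds 0)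

/-- The basin of attraction of the set `O`. -/
def Basin (g : ℝ → ℝ) (O : Set ℝ) : Set ℝ := {x | ConvergesToOrbit g x O}

/-- The immediate basin of attraction of `O` within `N`: the union of the connected
components of the basin which contain points of `O`. -/
def ImmBasinIn (g : ℝ → ℝ) (N : Set ℝ) (O : Set ℝ) : Set ℝ :=
  ⋃ y ∈ O, connectedComponentIn (Basin g O ∩ N) y

/-- `p` is an attracting periodic point of period `n` for the map `g : N → N`. -/
def AttractingIn (g : ℝ → ℝ) (N : Set ℝ) (p : ℝ) (n : ℕ) : Prop :=
  PeriodicPt g p n ∧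
    ∃ U : Set ℝ, IsOpen U ∧ p ∈ U ∧ ∀ x ∈ U ∩ N, ConvergesToOrbit g x (orbitSet g p)

/-- `p` is a neutral periodic point of `g`. -/
def NeutralPeriodicPt (g : ℝ → ℝ) (p : ℝ) (n : ℕ) : Prop :=
  0 < n ∧ g^[n] p = p ∧ |deriv (g^[n]) p| = 1

/-- `g` is `η`-close to `f` in the `C^k` topology on `N`. -/
def CkClose (k : ℕ) (f g : ℝ → ℝ) (N : Set ℝ) (η : ℝ) : Prop :=
  ∀ i ≤ k, ∀ x ∈ N, |iteratedDeriv i g x - iteratedDeriv i f x| ≤ η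

/-- `{T k}_{k=0}^m` is a chain for the map `g : N → N`:
each `T k` is a connected component of `g⁻¹(T (k+1))` (within `N`). -/
def IsChainIn (g : ℝ → ℝ) (N : Set ℝ) (m : ℕ) (T : ℕ → Set ℝ) : Prop :=
  ∀ k < m, (T k).Nonempty ∧ ∀ x ∈ T k, T k = connectedComponentIn (g ⁻¹' T (k + 1) ∩ N) x

/-- `[u,v]` is a periodic interval of period `n` for `g`. -/
def IsPeriodicInterval (g : ℝ → ℝ) (u v : ℝ) (n : ℕ) : Prop :=
  u ≤ v ∧ 0 < n ∧ g^[n] '' Icc u v = Icc u v ∧ InjOn (g^[n]) (Icc u v)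

/-- The periodic points of `g` lying in `S`. -/
def periodicPtsIn (g : ℝ → ℝ) (S : Set ℝ) : Set ℝ :=
  {x ∈ S | ∃ m : ℕ, 0 < m ∧ g^[m] x = x}

/-- A pack of periodic points of `g`: the set of all periodic points in some closed
(possibly degenerate) periodic interval such that no larger periodic interval
contains more periodic points. -/
def IsPack (g : ℝ → ℝ) (P : Set ℝ) : Prop :=
  ∃ u v n, IsPeriodicInterval g u v n ∧ P = periodicPtsIn g (Icc u v) ∧
    ∀ u' v' n', Icc u v ⊆ Icc u' v' → IsPeriodicInterval g u' v' n' →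
      periodicPtsIn g (Icc u' v') = P

/-- `f : N → N` has a wandering interval: a nondegenerate interval whose iterates are
pairwise disjoint and which is not contained in the basin of a periodic attractor. -/
def HasWanderingInterval (f : ℝ → ℝ) (N : Set ℝ) : Prop :=
  ∃ u v : ℝ, u < v ∧ Ioo u v ⊆ N ∧
    (∀ m n : ℕ, m ≠ n → Disjoint (f^[m] '' Ioo u v) (f^[n] '' Ioo u v)) ∧
    ¬ ∃ p ∈ N, ∃ k : ℕ, AttractingIn f N p k ∧
        ∀ x ∈ Ioo u v, ConvergesToOrbit f x (orbitSet f p)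

/-- `n` is the orientation preserving period of the periodic point `p`: it is `2m` if
`Dg^m(p) < 0` and `m` if `Dg^m(p) ≥ 0`, where `m` is the period of `p`. -/
def OrientationPreservingPeriod (g : ℝ → ℝ) (p : ℝ) (n : ℕ) : Prop :=
  ∃ m : ℕ, PeriodicPt g p m ∧
    ((deriv (g^[m]) p < 0 ∧ n = 2 * m) ∨ (0 ≤ deriv (g^[m]) p ∧ n = m))

open scoped ContDiff

lemma crossRatio_swap (t1 j1 j2 t2 : ℝ) : crossRatio t2 j2 j1 t1 = crossRatio t1 j1 j2 t2 := by
  unfold crossRatio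
  congr 1 <;> ring

lemma crossRatio_neg (t1 j1 j2 t2 : ℝ) :
    crossRatio (-t1) (-j1) (-j2) (-t2) = crossRatio t1 j1 j2 t2 := by
  unfold crossRatio
  congr 1 <;> ring

lemma crossRatio_pos {t1 j1 j2 t2 : ℝ} (h1 : t1 < j1) (h2 : j1 < j2) (h3 : j2 < t2) :
    0 < crossRatio t1 j1 j2 t2 := by
  unfold crossRatio
  have := sub_pos.2 h1
  have := sub_pos.2 h2
  have := sub_pos.2 h3
  have : 0 < t2 - t1 := by linarith
  positivity

lemma hasDerivAt_iteratedDeriv {g : ℝ → ℝ} (hg : ContDiff ℝ ∞ g) (i : ℕ) (x : ℝ) :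
    HasDerivAt (iteratedDeriv i g) (iteratedDeriv (i + 1) g x) x := by
  rw [iteratedDeriv_succ]
  exact ((hg.differentiable_iteratedDeriv i (by exact_mod_cast WithTop.coe_lt_top _)) x).hasDerivAt

lemma continuous_iteratedDeriv_of_smooth {g : ℝ → ℝ} (hg : ContDiff ℝ ∞ g) (i : ℕ) :
    Continuous (iteratedDeriv i g) :=
  continuous_iff_continuousAt.2 fun x => (hasDerivAt_iteratedDeriv hg i x).continuousAt

lemma hasDerivAt_of_smooth {g : ℝ → ℝ} (hg : ContDiff ℝ ∞ g) (x : ℝ) :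
    HasDerivAt g (deriv g x) x := by
  simpa using hasDerivAt_iteratedDeriv hg 0 x

/-- Nonpositive Schwarzian derivative makes `(deriv g)^(-1/2)` lie above its tangent lines. -/
lemma tangent_le_of_schwarzian_nonpos {g : ℝ → ℝ} (hg : ContDiff ℝ ∞ g) {s t : ℝ}
    (hpos : ∀ x ∈ Icc s t, 0 < deriv g x)
    (hS : ∀ x ∈ Icc s t, deriv g x * iteratedDeriv 3 g x ≤ 3 / 2 * iteratedDeriv 2 g x ^ 2)
    {x y : ℝ} (hx : x ∈ Icc s t) (hy : y ∈ Icc s t) :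
    deriv g x ^ (-(1 / 2) : ℝ) * (1 - iteratedDeriv 2 g x / (2 * deriv g x) * (y - x))
      ≤ deriv g y ^ (-(1 / 2) : ℝ) := by
  set v : ℝ → ℝ := fun z => deriv g z ^ (-(1 / 2) : ℝ) with hv
  set w : ℝ → ℝ := fun z => -(1 / 2) * iteratedDeriv 2 g z * deriv g z ^ (-(3 / 2) : ℝ) with hw
  have hd1 : ∀ z, HasDerivAt (deriv g) (iteratedDeriv 2 g z) z := fun z => by
    simpa [iteratedDeriv_one] using hasDerivAt_iteratedDeriv hg 1 z
  have hd2 : ∀ z, HasDerivAt (iteratedDeriv 2 g) (iteratedDeriv 3 g z) z := fun z =>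
    hasDerivAt_iteratedDeriv hg 2 z
  have hvd : ∀ z ∈ Icc s t, HasDerivAt v (w z) z := fun z hz => by
    have := (hd1 z).rpow_const (p := (-(1 / 2) : ℝ)) (Or.inl (hpos z hz).ne')
    convert this using 1
    simp only [hw]
    rw [show (-(1 / 2) - 1 : ℝ) = -(3 / 2) by norm_num]
    ring
  have hwd : ∀ z ∈ Icc s t, HasDerivAt w
      (-(1 / 2) * iteratedDeriv 3 g z * deriv g z ^ (-(3 / 2) : ℝ)
        + -(1 / 2) * iteratedDeriv 2 g z *
          (iteratedDeriv 2 g z * (-(3 / 2)) * deriv g z ^ (-(3 / 2) - 1 : ℝ))) z := fun z hz =>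
    ((hd2 z).const_mul (-(1 / 2) : ℝ)).mul ((hd1 z).rpow_const (Or.inl (hpos z hz).ne'))
  have hwmono : MonotoneOn w (Icc s t) := by
    apply monotoneOn_of_deriv_nonneg (convex_Icc s t)
      (fun z hz => (hwd z hz).continuousAt.continuousWithinAt)
    · intro z hz
      exact (hwd z (interior_subset hz)).differentiableAt.differentiableWithinAt
    · intro z hz
      have hz' := interior_subset hz
      rw [(hwd z hz').deriv]
      have e : deriv g z ^ (-(3 / 2) : ℝ) = deriv g z * deriv g z ^ (-(3 / 2) - 1 : ℝ) := by
        rw [← Real.rpow_one_add' (hpos z hz').le (by norm_num)]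
        norm_num
      rw [e]
      have hp : 0 < deriv g z ^ (-(3 / 2) - 1 : ℝ) := Real.rpow_pos_of_pos (hpos z hz') _
      have := mul_le_mul_of_nonneg_right (hS z hz') hp.le
      nlinarith
  have hwx : v x * (1 - iteratedDeriv 2 g x / (2 * deriv g x) * (y - x)) = v x + w x * (y - x) := by
    have hp := hpos x hx
    have e : v x = deriv g x * deriv g x ^ (-(3 / 2) : ℝ) := by
      rw [← Real.rpow_one_add' hp.le (by norm_num)]
      norm_num [hv]
    rw [e]
    simp only [hw]
    field_simp
    ring
  have hsub : ∀ z z', z ∈ Icc s t → z' ∈ Icc s t → Icc z z' ⊆ Icc s t := fun z z' h h' =>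
    Icc_subset_Icc h.1 h'.2
  change v x * _ ≤ v y
  rw [hwx]
  rcases lt_trichotomy x y with h | h | h
  · obtain ⟨c, hc, e⟩ := exists_hasDerivAt_eq_slope v w h
      (fun z hz => (hvd z (hsub x y hx hy hz)).continuousAt.continuousWithinAt)
      (fun z hz => hvd z (hsub x y hx hy (Ioo_subset_Icc_self hz)))
    have hm := hwmono hx (hsub x y hx hy (Ioo_subset_Icc_self hc)) hc.1.le
    rw [e, le_div_iff₀ (by linarith)] at hm
    linarith
  · subst h; simp
  · obtain ⟨c, hc, e⟩ := exists_hasDerivAt_eq_slope v w h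
      (fun z hz => (hvd z (hsub y x hy hx hz)).continuousAt.continuousWithinAt)
      (fun z hz => hvd z (hsub y x hy hx (Ioo_subset_Icc_self hz)))
    have hm := hwmono (hsub y x hy hx (Ioo_subset_Icc_self hc)) hx hc.2.le
    rw [e, div_le_iff₀ (by linarith)] at hm
    nlinarith

lemma image_sub_pos {g : ℝ → ℝ} (hg : ContDiff ℝ ∞ g) {s t : ℝ}
    (hpos : ∀ x ∈ Icc s t, 0 < deriv g x) {x y : ℝ} (hx : x ∈ Icc s t) (hy : y ∈ Icc s t)
    (hxy : x < y) : 0 < g y - g x := by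
  have : StrictMonoOn g (Icc s t) :=
    strictMonoOn_of_deriv_pos (convex_Icc s t) hg.continuous.continuousOn
      fun z hz => hpos z (interior_subset hz)
  exact sub_pos.2 (this hx hy hxy)

/-- The image of a right neighbourhood is no longer than under the tangent Möbius map. -/
lemma image_right_le {g : ℝ → ℝ} (hg : ContDiff ℝ ∞ g) {s t : ℝ}
    (hpos : ∀ x ∈ Icc s t, 0 < deriv g x)
    (hS : ∀ x ∈ Icc s t, deriv g x * iteratedDeriv 3 g x ≤ 3 / 2 * iteratedDeriv 2 g x ^ 2)
    {x y : ℝ} (hx : x ∈ Icc s t) (hy : y ∈ Icc s t) (hxy : x < y) :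
    1 / (y - x) - iteratedDeriv 2 g x / (2 * deriv g x) ≤ deriv g x / (g y - g x) := by
  set k := iteratedDeriv 2 g x / (2 * deriv g x) with hk
  have hG := image_sub_pos hg hpos hx hy hxy
  have hhx := hpos x hx
  have hyx : 0 < y - x := sub_pos.2 hxy
  by_cases hneg : 1 - k * (y - x) ≤ 0
  · have h1 : 1 / (y - x) - k ≤ 0 := by
      have : 1 / (y - x) - k = (1 - k * (y - x)) / (y - x) := by field_simp
      rw [this]
      exact div_nonpos_of_nonpos_of_nonneg hneg hyx.le
    exact h1.trans (by positivity)
  · push Not at hneg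
    have hden : ∀ z ∈ Icc x y, 0 < 1 - k * (z - x) := by
      intro z hz
      rcases le_total k 0 with h | h
      · nlinarith [hz.1]
      · nlinarith [hz.2]
    have hψ : ∀ z ∈ Icc x y, HasDerivAt
        (fun z => deriv g x * (z - x) / (1 - k * (z - x)) - g z)
        (deriv g x / (1 - k * (z - x)) ^ 2 - deriv g z) z := fun z hz => by
      have h1 : HasDerivAt (fun z => deriv g x * (z - x)) (deriv g x) z := by
        simpa using ((hasDerivAt_id z).sub_const x).const_mul (deriv g x)
      have h2 : HasDerivAt (fun z => 1 - k * (z - x)) (-k) z := by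
        simpa using (((hasDerivAt_id z).sub_const x).const_mul k).const_sub 1
      have := (h1.div h2 (hden z hz).ne').sub (hasDerivAt_of_smooth hg z)
      refine this.congr_deriv ?_
      congr 2
      ring
    have hm : MonotoneOn (fun z => deriv g x * (z - x) / (1 - k * (z - x)) - g z) (Icc x y) := by
      apply monotoneOn_of_deriv_nonneg (convex_Icc x y)
        (fun z hz => (hψ z hz).continuousAt.continuousWithinAt)
      · intro z hz
        exact (hψ z (interior_subset hz)).differentiableAt.differentiableWithinAt
      · intro z hz
        have hz' := interior_subset hz
        have hzs : z ∈ Icc s t := ⟨hx.1.trans hz'.1, hz'.2.trans hy.2⟩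
        rw [(hψ z hz').deriv, sub_nonneg, le_div_iff₀ (by have := hden z hz'; positivity)]
        have ht := tangent_le_of_schwarzian_nonpos hg hpos hS hx hzs
        rw [← hk] at ht
        have hd := hden z hz'
        have hp1 : 0 < deriv g x ^ (-(1 / 2) : ℝ) := Real.rpow_pos_of_pos hhx _
        have h2 := mul_self_le_mul_self (by positivity) ht
        have e1 : ∀ r : ℝ, 0 < r → r ^ (-(1 / 2) : ℝ) * r ^ (-(1 / 2) : ℝ) = 1 / r := fun r hr => by
          rw [← Real.rpow_add hr]
          norm_num [Real.rpow_neg_one]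
        have hz0 := hpos z hzs
        have h3 : 1 / deriv g x * (1 - k * (z - x)) ^ 2 ≤ 1 / deriv g z := by
          rw [← e1 _ hhx, ← e1 _ hz0]
          linarith
        rw [div_mul_eq_mul_div, div_le_div_iff₀ hhx hz0] at h3
        linarith
    have h0 := hm (left_mem_Icc.2 hxy.le) (right_mem_Icc.2 hxy.le) hxy.le
    simp only [sub_self, mul_zero, sub_zero, zero_div, zero_sub] at h0
    have h1 : g y - g x ≤ deriv g x * (y - x) / (1 - k * (y - x)) := by linarith
    rw [le_div_iff₀ hneg] at h1
    rw [le_div_iff₀ hG]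
    have : (1 / (y - x) - k) * (g y - g x) = ((g y - g x) * (1 - k * (y - x))) / (y - x) := by
      field_simp
    rw [this, div_le_iff₀ hyx]
    exact h1

lemma iteratedDeriv_reflect (g : ℝ → ℝ) (n : ℕ) (x : ℝ) :
    iteratedDeriv n (fun z => -g (-z)) x = -((-1) ^ n * iteratedDeriv n g (-x)) := by
  have := iteratedDeriv_comp_neg n g x
  rw [iteratedDeriv_fun_neg, this]
  simp

lemma smooth_reflect {g : ℝ → ℝ} (hg : ContDiff ℝ ∞ g) : ContDiff ℝ ∞ (fun z => -g (-z)) :=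
  (hg.comp contDiff_neg).neg

lemma deriv_reflect (g : ℝ → ℝ) (x : ℝ) : deriv (fun z => -g (-z)) x = deriv g (-x) := by
  have := iteratedDeriv_reflect g 1 x
  simpa [iteratedDeriv_one] using this

lemma image_left_le {g : ℝ → ℝ} (hg : ContDiff ℝ ∞ g) {s t : ℝ}
    (hpos : ∀ x ∈ Icc s t, 0 < deriv g x)
    (hS : ∀ x ∈ Icc s t, deriv g x * iteratedDeriv 3 g x ≤ 3 / 2 * iteratedDeriv 2 g x ^ 2)
    {x y : ℝ} (hx : x ∈ Icc s t) (hy : y ∈ Icc s t) (hxy : y < x) :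
    1 / (x - y) + iteratedDeriv 2 g x / (2 * deriv g x) ≤ deriv g x / (g x - g y) := by
  have hmem : ∀ z, z ∈ Icc (-t) (-s) → -z ∈ Icc s t := fun z hz =>
    ⟨by linarith [hz.2], by linarith [hz.1]⟩
  have := image_right_le (smooth_reflect hg) (s := -t) (t := -s) (x := -x) (y := -y)
    (fun z hz => by rw [deriv_reflect]; exact hpos _ (hmem z hz))
    (fun z hz => by
      rw [deriv_reflect, iteratedDeriv_reflect, iteratedDeriv_reflect]
      have := hS _ (hmem z hz)
      norm_num
      linarith)
    ⟨by linarith [hx.2], by linarith [hx.1]⟩ ⟨by linarith [hy.2], by linarith [hy.1]⟩ (by linarith)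
  rw [deriv_reflect, iteratedDeriv_reflect] at this
  norm_num at this
  rw [show -y + x = x - y by ring, show -g y + g x = g x - g y by ring, neg_div] at this
  rw [one_div]
  linarith

/-- Maps with nonpositive Schwarzian derivative expand cross-ratios. -/
lemma crossRatio_le_of_schwarzian_nonpos {g : ℝ → ℝ} (hg : ContDiff ℝ ∞ g) {t1 j1 j2 t2 : ℝ}
    (h1 : t1 < j1) (h2 : j1 < j2) (h3 : j2 < t2)
    (hpos : ∀ x ∈ Icc t1 t2, 0 < deriv g x)
    (hS : ∀ x ∈ Icc t1 t2, deriv g x * iteratedDeriv 3 g x ≤ 3 / 2 * iteratedDeriv 2 g x ^ 2) :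
    crossRatio t1 j1 j2 t2 ≤ crossRatio (g t1) (g j1) (g j2) (g t2) := by
  have ht : t1 ≤ t2 := by linarith
  have m1 := left_mem_Icc.2 ht
  have m2 := right_mem_Icc.2 ht
  have hL : ∀ x ∈ Ioo t1 t2, 0 < g x - g t1 := fun x hx =>
    image_sub_pos hg hpos m1 (Ioo_subset_Icc_self hx) hx.1
  have hR : ∀ x ∈ Ioo t1 t2, 0 < g t2 - g x := fun x hx =>
    image_sub_pos hg hpos (Ioo_subset_Icc_self hx) m2 hx.2
  have hd : ∀ x ∈ Ioo t1 t2, HasDerivAt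
      (fun x => Real.log (g x - g t1) - Real.log (g t2 - g x)
        - Real.log (x - t1) + Real.log (t2 - x))
      (deriv g x / (g x - g t1) - -deriv g x / (g t2 - g x) - 1 / (x - t1) + -1 / (t2 - x)) x := by
    intro x hx
    have e1 := ((hasDerivAt_of_smooth hg x).sub_const (g t1)).log (hL x hx).ne'
    have e2 := ((hasDerivAt_of_smooth hg x).const_sub (g t2)).log (hR x hx).ne'
    have e3 := ((hasDerivAt_id x).sub_const t1).log (sub_pos.2 hx.1).ne'
    have e4 := ((hasDerivAt_id x).const_sub t2).log (sub_pos.2 hx.2).ne'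
    exact ((e1.sub e2).sub e3).add e4
  have hm : MonotoneOn (fun x => Real.log (g x - g t1) - Real.log (g t2 - g x)
        - Real.log (x - t1) + Real.log (t2 - x)) (Ioo t1 t2) := by
    apply monotoneOn_of_deriv_nonneg (convex_Ioo t1 t2)
      (fun z hz => (hd z hz).continuousAt.continuousWithinAt)
    · intro z hz
      exact (hd z (interior_subset hz)).differentiableAt.differentiableWithinAt
    · intro z hz
      have hz' := interior_subset hz
      rw [(hd z hz').deriv]
      have a1 := image_right_le hg hpos hS (Ioo_subset_Icc_self hz') m2 hz'.2
      have a2 := image_left_le hg hpos hS (Ioo_subset_Icc_self hz') m1 hz'.1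
      rw [neg_div, neg_div]
      linarith
  have i1 : j1 ∈ Ioo t1 t2 := ⟨h1, by linarith⟩
  have i2 : j2 ∈ Ioo t1 t2 := ⟨by linarith, h3⟩
  have key := hm i1 i2 h2.le
  have p1 := hL _ i1
  have p2 := hL _ i2
  have p3 := hR _ i1
  have p4 := hR _ i2
  have q1 : 0 < j1 - t1 := by linarith
  have q2 : 0 < j2 - t1 := by linarith
  have q3 : 0 < t2 - j1 := by linarith
  have q4 : 0 < t2 - j2 := by linarith
  have key2 : (g j1 - g t1) * (g t2 - g j2) * ((j2 - t1) * (t2 - j1))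
      ≤ (g j2 - g t1) * (g t2 - g j1) * ((j1 - t1) * (t2 - j2)) := by
    rw [← Real.log_le_log_iff (by positivity) (by positivity)]
    rw [Real.log_mul, Real.log_mul, Real.log_mul, Real.log_mul, Real.log_mul, Real.log_mul]
    · simp only at key
      linarith
    all_goals positivity
  unfold crossRatio
  rw [div_le_div_iff₀ (by positivity) (by positivity)]
  nlinarith [key2]

/-- Bounded distortion of the derivative bounds the distortion of cross-ratios. -/
lemma crossRatio_le_of_distortion {g : ℝ → ℝ} (hg : ContDiff ℝ ∞ g) {t1 j1 j2 t2 E : ℝ}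
    (h1 : t1 < j1) (h2 : j1 < j2) (h3 : j2 < t2)
    (hpos : ∀ x ∈ Icc t1 t2, 0 < deriv g x)
    (hE : ∀ x ∈ Icc t1 t2, ∀ y ∈ Icc t1 t2, deriv g x ≤ E * deriv g y) :
    crossRatio t1 j1 j2 t2 ≤ E ^ 2 * crossRatio (g t1) (g j1) (g j2) (g t2) := by
  have hmv : ∀ x y, t1 ≤ x → x < y → y ≤ t2 →
      ∃ c ∈ Icc t1 t2, g y - g x = deriv g c * (y - x) := by
    intro x y hx hxy hy
    obtain ⟨c, hc, e⟩ := exists_hasDerivAt_eq_slope g (deriv g) hxy hg.continuous.continuousOn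
      (fun z _ => hasDerivAt_of_smooth hg z)
    refine ⟨c, ⟨by linarith [hc.1], by linarith [hc.2]⟩, ?_⟩
    rw [e, div_mul_cancel₀ _ (by linarith)]
  obtain ⟨a, ha, ea⟩ := hmv t1 t2 le_rfl (by linarith) le_rfl
  obtain ⟨b, hb, eb⟩ := hmv j1 j2 (by linarith) (by linarith) (by linarith)
  obtain ⟨c, hc, ec⟩ := hmv t1 j1 le_rfl (by linarith) (by linarith)
  obtain ⟨d, hd, ed⟩ := hmv j2 t2 (by linarith) (by linarith) le_rfl
  unfold crossRatio
  rw [ea, eb, ec, ed]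
  have pa := hpos a ha
  have pb := hpos b hb
  have pc := hpos c hc
  have pd := hpos d hd
  have q1 : 0 < j1 - t1 := by linarith
  have q2 : 0 < j2 - j1 := by linarith
  have q3 : 0 < t2 - t1 := by linarith
  have q4 : 0 < t2 - j2 := by linarith
  have k := mul_le_mul (hE c hc a ha) (hE d hd b hb) pd.le (pc.le.trans (hE c hc a ha))
  rw [← mul_div_assoc, div_le_div_iff₀ (by positivity) (by positivity)]
  have := mul_le_mul_of_nonneg_left k
    (show 0 ≤ (t2 - t1) * (j2 - j1) * ((j1 - t1) * (t2 - j2)) by positivity)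
  linarith

/-- Away from a set of at most `K` points, `g` contracts cross-ratios of intervals inside `(u,v)`
by at most a factor `exp` of the increment of a monotone function with values in `[0,M]`. -/
def CrossGood (g : ℝ → ℝ) (K : ℕ) (M u v : ℝ) : Prop :=
  ∃ (P : Finset ℝ) (F : ℝ → ℝ), P.card ≤ K ∧ Monotone F ∧ (∀ x, 0 ≤ F x ∧ F x ≤ M) ∧
    ∀ t1 j1 j2 t2, u < t1 → t1 < j1 → j1 < j2 → j2 < t2 → t2 < v →
      (∀ x ∈ P, x ∉ Icc t1 t2) →
      crossRatio t1 j1 j2 t2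
        ≤ Real.exp (F t2 - F t1) * crossRatio (g t1) (g j1) (g j2) (g t2)

lemma CrossGood.mono {g : ℝ → ℝ} {K K' : ℕ} {M M' u v : ℝ} (h : CrossGood g K M u v)
    (hK : K ≤ K') (hM : M ≤ M') : CrossGood g K' M' u v := by
  obtain ⟨P, F, h1, h2, h3, h4⟩ := h
  exact ⟨P, F, h1.trans hK, h2, fun x => ⟨(h3 x).1, (h3 x).2.trans hM⟩, h4⟩

lemma CrossGood.nonneg {g : ℝ → ℝ} {K : ℕ} {M u v : ℝ} (h : CrossGood g K M u v) : 0 ≤ M := by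
  obtain ⟨P, F, -, -, h3, -⟩ := h
  exact (h3 0).1.trans (h3 0).2

lemma CrossGood.of_le (g : ℝ → ℝ) {u v : ℝ} (h : v ≤ u) : CrossGood g 0 0 u v :=
  ⟨∅, fun _ => 0, by simp, monotone_const, fun _ => ⟨le_rfl, le_rfl⟩,
    fun t1 j1 j2 t2 a b c d e => by linarith⟩

lemma CrossGood.union {g : ℝ → ℝ} {K1 K2 : ℕ} {M1 M2 u p v : ℝ} (h1 : CrossGood g K1 M1 u p)
    (h2 : CrossGood g K2 M2 p v) : CrossGood g (K1 + K2 + 1) (M1 + M2) u v := by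
  obtain ⟨P, F, a1, a2, a3, a4⟩ := h1
  obtain ⟨Q, G, b1, b2, b3, b4⟩ := h2
  classical
  refine ⟨insert p (P ∪ Q), fun x => F x + G x, ?_, a2.add b2,
    fun x => ⟨add_nonneg (a3 x).1 (b3 x).1, add_le_add (a3 x).2 (b3 x).2⟩, ?_⟩
  · exact (Finset.card_insert_le _ _).trans
      (Nat.succ_le_succ ((Finset.card_union_le _ _).trans (add_le_add a1 b1)))
  · intro t1 j1 j2 t2 c1 c2 c3 c4 c5 hP
    have ht : t1 ≤ t2 := by linarith
    have hp := hP p (Finset.mem_insert_self _ _)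
    have hF := a2 ht
    have hG := b2 ht
    have hle : ∀ {e e' : ℝ}, e ≤ e' → crossRatio t1 j1 j2 t2
        ≤ Real.exp e * crossRatio (g t1) (g j1) (g j2) (g t2) →
        crossRatio t1 j1 j2 t2 ≤ Real.exp e' * crossRatio (g t1) (g j1) (g j2) (g t2) := by
      intro e e' he h
      have h0 : 0 < Real.exp e * crossRatio (g t1) (g j1) (g j2) (g t2) :=
        (crossRatio_pos c2 c3 c4).trans_le h
      have h1 : 0 < crossRatio (g t1) (g j1) (g j2) (g t2) := by
        rcases pos_and_pos_or_neg_and_neg_of_mul_pos h0 with h | h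
        · exact h.2
        · exact absurd h.1 (not_lt.2 (Real.exp_pos _).le)
      exact h.trans (mul_le_mul_of_nonneg_right (Real.exp_le_exp.2 he) h1.le)
    rcases lt_or_ge t2 p with h | h
    · refine hle ?_ (a4 t1 j1 j2 t2 c1 c2 c3 c4 h fun x hx => hP x ?_)
      · linarith
      · simp [hx]
    · have : p < t1 := by
        by_contra hc
        exact hp ⟨not_lt.1 hc, h⟩
      refine hle ?_ (b4 t1 j1 j2 t2 this c2 c3 c4 c5 fun x hx => hP x ?_)
      · linarith
      · simp [hx]

lemma CrossGood.of_neg {g : ℝ → ℝ} {K : ℕ} {M u v : ℝ}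
    (h : CrossGood (fun x => -g x) K M u v) : CrossGood g K M u v := by
  obtain ⟨P, F, a1, a2, a3, a4⟩ := h
  refine ⟨P, F, a1, a2, a3, fun t1 j1 j2 t2 c1 c2 c3 c4 c5 hP => ?_⟩
  have := a4 t1 j1 j2 t2 c1 c2 c3 c4 c5 hP
  rwa [crossRatio_neg] at this

lemma CrossGood.of_reflect {g : ℝ → ℝ} {K : ℕ} {M u v : ℝ}
    (h : CrossGood (fun x => -g (-x)) K M (-v) (-u)) : CrossGood g K M u v := by
  obtain ⟨P, F, a1, a2, a3, a4⟩ := h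
  classical
  refine ⟨P.image Neg.neg, fun x => M - F (-x), Finset.card_image_le.trans a1,
    fun x y hxy => ?_, fun x => ⟨?_, ?_⟩, fun t1 j1 j2 t2 c1 c2 c3 c4 c5 hP => ?_⟩
  · have := a2 (neg_le_neg hxy)
    simp only
    linarith
  · linarith [(a3 (-x)).2]
  · linarith [(a3 (-x)).1]
  · have := a4 (-t2) (-j2) (-j1) (-t1) (by linarith) (by linarith) (by linarith) (by linarith)
      (by linarith) (fun x hx hm => hP (-x) (Finset.mem_image_of_mem _ hx)
        ⟨by linarith [hm.2], by linarith [hm.1]⟩)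
    simp only [neg_neg] at this
    rw [crossRatio_neg, crossRatio_neg, crossRatio_swap t1, crossRatio_swap (g t1)] at this
    rwa [show M - F (-t2) - (M - F (-t1)) = F (-t1) - F (-t2) by ring]

lemma CrossGood.of_schwarzian_nonpos {g : ℝ → ℝ} (hg : ContDiff ℝ ∞ g) {u v : ℝ}
    (hpos : ∀ x ∈ Ioo u v, 0 < deriv g x)
    (hS : ∀ x ∈ Ioo u v, deriv g x * iteratedDeriv 3 g x ≤ 3 / 2 * iteratedDeriv 2 g x ^ 2) :
    CrossGood g 0 0 u v := by
  refine ⟨∅, fun _ => 0, by simp, monotone_const, fun _ => ⟨le_rfl, le_rfl⟩,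
    fun t1 j1 j2 t2 a b c d e _ => ?_⟩
  have hsub : Icc t1 t2 ⊆ Ioo u v := fun x hx => ⟨a.trans_le hx.1, hx.2.trans_lt e⟩
  simpa using crossRatio_le_of_schwarzian_nonpos hg b c d (fun x hx => hpos x (hsub hx))
    (fun x hx => hS x (hsub hx))

lemma crossRatio_le_of_log_distortion {g : ℝ → ℝ} (hg : ContDiff ℝ ∞ g) {t1 j1 j2 t2 V : ℝ}
    (h1 : t1 < j1) (h2 : j1 < j2) (h3 : j2 < t2)
    (hpos : ∀ x ∈ Icc t1 t2, 0 < deriv g x)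
    (hV : ∀ x ∈ Icc t1 t2, ∀ y ∈ Icc t1 t2, Real.log (deriv g x) - Real.log (deriv g y) ≤ V) :
    crossRatio t1 j1 j2 t2
      ≤ Real.exp (2 * V) * crossRatio (g t1) (g j1) (g j2) (g t2) := by
  have := crossRatio_le_of_distortion (E := Real.exp V) hg h1 h2 h3 hpos (fun x hx y hy => by
    have := hV x hx y hy
    rw [← Real.exp_log (hpos x hx), ← Real.exp_log (hpos y hy), ← Real.exp_add]
    exact Real.exp_le_exp.2 (by simpa using by linarith))
  rwa [← Real.exp_nat_mul] at this

lemma CrossGood.of_lipschitz {g : ℝ → ℝ} (hg : ContDiff ℝ ∞ g) {u v c B : ℝ} (hc : 0 < c)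
    (hB : 0 ≤ B) (huv : u ≤ v)
    (hpos : ∀ x ∈ Ioo u v, c ≤ deriv g x)
    (hS : ∀ x ∈ Ioo u v, |iteratedDeriv 2 g x| ≤ B) :
    CrossGood g 0 (2 * (B / c) * (v - u)) u v := by
  have hmon : Monotone fun x : ℝ => max u (min x v) - u := fun x y hxy => by
    have : max u (min x v) ≤ max u (min y v) := max_le_max le_rfl (min_le_min hxy le_rfl)
    simp only
    linarith
  refine ⟨∅, fun x => 2 * (B / c) * (max u (min x v) - u), by simp,
    hmon.const_mul (by positivity), fun x => ⟨?_, ?_⟩, fun t1 j1 j2 t2 h1 h2 h3 h4 h5 _ => ?_⟩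
  · have : u ≤ max u (min x v) := le_max_left _ _
    have : 0 ≤ max u (min x v) - u := by linarith
    positivity
  · have : max u (min x v) ≤ v := max_le huv (min_le_right _ _)
    exact mul_le_mul_of_nonneg_left (by linarith) (by positivity)
  have hsub : Icc t1 t2 ⊆ Ioo u v := fun x hx => ⟨h1.trans_le hx.1, hx.2.trans_lt h5⟩
  have e1 : max u (min t1 v) = t1 := by
    rw [min_eq_left (by linarith), max_eq_right h1.le]
  have e2 : max u (min t2 v) = t2 := by
    rw [min_eq_left (by linarith), max_eq_right (by linarith)]
  simp only [e1, e2]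
  have := crossRatio_le_of_log_distortion (V := B / c * (t2 - t1)) hg h2 h3 h4
    (fun x hx => hc.trans_le (hpos x (hsub hx))) (fun x hx y hy => by
      have hd1 : ∀ z, HasDerivAt (deriv g) (iteratedDeriv 2 g z) z := fun z => by
        simpa [iteratedDeriv_one] using hasDerivAt_iteratedDeriv hg 1 z
      have := (convex_Icc t1 t2).norm_image_sub_le_of_norm_hasDerivWithin_le
        (f := fun z => Real.log (deriv g z)) (f' := fun z => iteratedDeriv 2 g z / deriv g z)
        (C := B / c) (x := y) (y := x)
        (fun z hz => ((hd1 z).log (hc.trans_le (hpos z (hsub hz))).ne').hasDerivWithinAt)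
        (fun z hz => by
          rw [norm_div, Real.norm_eq_abs, Real.norm_eq_abs]
          exact div_le_div₀ hB (hS z (hsub hz)) hc ((hpos z (hsub hz)).trans (le_abs_self _)))
        hy hx
      rw [Real.norm_eq_abs, Real.norm_eq_abs] at this
      refine (le_abs_self _).trans (this.trans (mul_le_mul_of_nonneg_left ?_ (by positivity)))
      rw [abs_le]
      exact ⟨by linarith [hx.1, hy.2], by linarith [hx.2, hy.1]⟩)
  convert this using 3
  ring

lemma CrossGood.of_monotoneOn {g : ℝ → ℝ} {K : ℕ} {M u v : ℝ} (P : Finset ℝ) (F : ℝ → ℝ)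
    (hP : P.card ≤ K) (hF : MonotoneOn F (Ioo u v)) (hM : 0 ≤ M)
    (hFM : ∀ x ∈ Ioo u v, 0 ≤ F x ∧ F x ≤ M)
    (h : ∀ t1 j1 j2 t2, u < t1 → t1 < j1 → j1 < j2 → j2 < t2 → t2 < v →
      (∀ x ∈ P, x ∉ Icc t1 t2) →
      crossRatio t1 j1 j2 t2
        ≤ Real.exp (F t2 - F t1) * crossRatio (g t1) (g j1) (g j2) (g t2)) :
    CrossGood g K M u v := by
  obtain ⟨G, hG, hGF⟩ := hF.exists_monotone_extension
    ⟨0, by rintro _ ⟨x, hx, rfl⟩; exact (hFM x hx).1⟩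
    ⟨M, by rintro _ ⟨x, hx, rfl⟩; exact (hFM x hx).2⟩
  refine ⟨P, fun x => max 0 (min (G x) M), hP,
    fun x y hxy => max_le_max le_rfl (min_le_min (hG hxy) le_rfl),
    fun x => ⟨le_max_left _ _, max_le hM (min_le_right _ _)⟩,
    fun t1 j1 j2 t2 a b c d e hP => ?_⟩
  have key : ∀ x ∈ Ioo u v, max 0 (min (G x) M) = F x := fun x hx => by
    rw [← hGF hx, min_eq_left (hFM x hx).2, max_eq_right (hFM x hx).1]
  simp only [key t1 ⟨a, by linarith⟩, key t2 ⟨by linarith, e⟩]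
  exact h t1 j1 j2 t2 a b c d e hP

lemma pos_of_ne_zero_of_pos_left {φ : ℝ → ℝ} {s t : ℝ} (hc : ContinuousOn φ (Icc s t))
    (h0 : ∀ x ∈ Icc s t, φ x ≠ 0) (hs : 0 ≤ φ s) : ∀ x ∈ Icc s t, 0 < φ x := by
  intro x hx
  by_contra hneg
  have hsub : Icc s x ⊆ Icc s t := Icc_subset_Icc le_rfl hx.2
  obtain ⟨z, hz, e⟩ := intermediate_value_Icc' hx.1 (hc.mono hsub) ⟨not_lt.1 hneg, hs⟩
  exact h0 z (hsub hz) e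

/-- The derivative of `g` is on `(p,q)` a sum of a constant and of terms behaving like monomials
in `x - p`; `m1` and `m2` are the first two derivatives of the terms. -/
structure MonomialLike (g : ℝ → ℝ) (p q C : ℝ) (n : ℕ) (m m1 m2 : ℕ → ℝ → ℝ) : Prop where
  continuousOn : ∀ i < n, ContinuousOn (m i) (Ioo p q)
  zero_or_pos : ∀ i < n, (∀ x ∈ Ioo p q, m i x = 0) ∨ (∀ x ∈ Ioo p q, 0 < m i x)
  const : ∀ x ∈ Ioo p q, ∀ y ∈ Ioo p q, m 0 x = m 0 y
  nonneg1 : ∀ i < n, ∀ x ∈ Ioo p q, 0 ≤ m1 i x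
  le_mul : ∀ i < n, 1 ≤ i → ∀ x ∈ Ioo p q, m i x ≤ (x - p) * m1 i x
  schwarz : ∀ i < n, 1 ≤ i → ∀ x ∈ Ioo p q, m i x * m2 i x ≤ 5 / 4 * m1 i x ^ 2
  mul_le : ∀ i < n, ∀ x ∈ Ioo p q, (x - p) * m1 i x ≤ C * m i x
  mul_le2 : ∀ i < n, ∀ x ∈ Ioo p q, (x - p) ^ 2 * m2 i x ≤ C * m i x
  pair : ∀ j < n, ∀ i < j, ∀ x ∈ Ioo p q, ∀ y ∈ Ioo p q, x ≤ y →
    (y - p) * (m j x * m i y) ≤ (x - p) * (m j y * m i x)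
  deriv_eq : ∀ x ∈ Ioo p q, deriv g x = ∑ i ∈ Finset.range n, m i x
  deriv2_eq : ∀ x ∈ Ioo p q, iteratedDeriv 2 g x = ∑ i ∈ Finset.range n, m1 i x
  deriv3_eq : ∀ x ∈ Ioo p q, iteratedDeriv 3 g x = ∑ i ∈ Finset.range n, m2 i x
  pos : ∀ x ∈ Ioo p q, 0 < deriv g x

namespace MonomialLike

variable {g : ℝ → ℝ} {p q C : ℝ} {n : ℕ} {m m1 m2 : ℕ → ℝ → ℝ}

lemma term_nonneg (H : MonomialLike g p q C n m m1 m2) {i : ℕ} (hi : i < n) {x : ℝ}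
    (hx : x ∈ Ioo p q) : 0 ≤ m i x := by
  rcases H.zero_or_pos i hi with h | h
  · exact (h x hx).ge
  · exact (h x hx).le

lemma log_deriv_monotoneOn (H : MonomialLike g p q C n m m1 m2) (hg : ContDiff ℝ ∞ g) :
    MonotoneOn (fun x => Real.log (deriv g x)) (Ioo p q) := by
  have hmono : MonotoneOn (deriv g) (Ioo p q) := by
    have hd1 : ∀ z, HasDerivAt (deriv g) (iteratedDeriv 2 g z) z := fun z => by
      simpa [iteratedDeriv_one] using hasDerivAt_iteratedDeriv hg 1 z
    apply monotoneOn_of_deriv_nonneg (convex_Ioo p q)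
      (fun z _ => (hd1 z).continuousAt.continuousWithinAt)
      (fun z _ => (hd1 z).differentiableAt.differentiableWithinAt)
    intro z hz
    have hz' := interior_subset hz
    rw [(hd1 z).deriv, H.deriv2_eq z hz']
    exact Finset.sum_nonneg fun i hi => H.nonneg1 i (Finset.mem_range.1 hi) z hz'
  exact fun x hx y hy hxy => Real.log_le_log (H.pos x hx) (hmono hx hy hxy)

lemma log_deriv_growth (H : MonomialLike g p q C n m m1 m2) (hg : ContDiff ℝ ∞ g)
    {x y : ℝ} (hx : x ∈ Ioo p q) (hy : y ∈ Ioo p q) (hxy : x ≤ y) :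
    Real.log (deriv g y) - Real.log (deriv g x)
      ≤ C * (Real.log (y - p) - Real.log (x - p)) := by
  have hd1 : ∀ z, HasDerivAt (deriv g) (iteratedDeriv 2 g z) z := fun z => by
    simpa [iteratedDeriv_one] using hasDerivAt_iteratedDeriv hg 1 z
  have hd : ∀ z ∈ Ioo p q, HasDerivAt (fun z => C * Real.log (z - p) - Real.log (deriv g z))
      (C * (1 / (z - p)) - iteratedDeriv 2 g z / deriv g z) z := fun z hz =>
    ((((hasDerivAt_id z).sub_const p).log (sub_pos.2 hz.1).ne').const_mul C).sub
      ((hd1 z).log (H.pos z hz).ne')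
  have hm : MonotoneOn (fun z => C * Real.log (z - p) - Real.log (deriv g z)) (Ioo p q) := by
    apply monotoneOn_of_deriv_nonneg (convex_Ioo p q)
      (fun z hz => (hd z hz).continuousAt.continuousWithinAt)
      (fun z hz => (hd z (interior_subset hz)).differentiableAt.differentiableWithinAt)
    intro z hz
    have hz' := interior_subset hz
    have hzp : 0 < z - p := sub_pos.2 hz'.1
    rw [(hd z hz').deriv, sub_nonneg, mul_one_div, div_le_div_iff₀ (H.pos z hz') hzp,
      H.deriv_eq z hz', H.deriv2_eq z hz', Finset.mul_sum, Finset.sum_mul]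
    refine Finset.sum_le_sum fun i hi => ?_
    have := H.mul_le i (Finset.mem_range.1 hi) z hz'
    linarith
  have := hm hx hy hxy
  simp only at this
  linarith

lemma ratio_growth (H : MonomialLike g p q C n m m1 m2) {i j : ℕ} (hj : j < n) (hij : i < j)
    {x y : ℝ} (hx : x ∈ Ioo p q) (hy : y ∈ Ioo p q) (hxy : x ≤ y) (hi0 : 0 < m i x)
    (hj0 : 0 < m j x) :
    Real.log (y - p) - Real.log (x - p)
      ≤ Real.log (m j y / m i y) - Real.log (m j x / m i x) := by
  have hpos : ∀ k < n, 0 < m k x → 0 < m k y := fun k hk h => by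
    rcases H.zero_or_pos k hk with h' | h'
    · exact absurd (h' x hx) h.ne'
    · exact h' y hy
  have hiy := hpos i (hij.trans hj) hi0
  have hjy := hpos j hj hj0
  have h := H.pair j hj i hij x hx y hy hxy
  have hxp : 0 < x - p := sub_pos.2 hx.1
  have hyp : 0 < y - p := sub_pos.2 hy.1
  have := Real.log_le_log (by positivity) h
  rw [Real.log_mul, Real.log_mul, Real.log_mul, Real.log_mul] at this
  · rw [Real.log_div hjy.ne' hiy.ne', Real.log_div hj0.ne' hi0.ne']
    linarith
  all_goals positivity

lemma log_ratio_monotoneOn (H : MonomialLike g p q C n m m1 m2) {i j : ℕ} (hj : j < n)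
    (hij : i < j) : MonotoneOn (fun x => Real.log (m j x / m i x)) (Ioo p q) := by
  rcases H.zero_or_pos i (hij.trans hj) with hi | hi
  · intro x hx y hy _
    simp [hi x hx, hi y hy]
  rcases H.zero_or_pos j hj with hj0 | hj0
  · intro x hx y hy _
    simp [hj0 x hx, hj0 y hy]
  · intro x hx y hy hxy
    have := H.ratio_growth hj hij hx hy hxy (hi x hx) (hj0 x hx)
    have h2 : Real.log (x - p) ≤ Real.log (y - p) :=
      Real.log_le_log (sub_pos.2 hx.1) (by linarith)
    simp only
    linarith

/-- The points where one term is `L` times another one. -/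
lemma exists_thresholds (H : MonomialLike g p q C n m m1 m2) {L : ℝ} (hL : 0 < L) :
    ∃ P : Finset ℝ, P.card ≤ n * n ∧ ∀ i < n, ∀ j < n, i ≠ j → ∀ x ∈ Ioo p q, 0 < m i x →
      m j x = L * m i x → x ∈ P := by
  classical
  let S : ℕ × ℕ → Set ℝ := fun k =>
    {x ∈ Ioo p q | k.1 ≠ k.2 ∧ k.1 < n ∧ k.2 < n ∧ 0 < m k.1 x ∧ m k.2 x = L * m k.1 x}
  have hS : ∀ k, (S k).Subsingleton := by
    rintro ⟨i, j⟩
    have key : ∀ x ∈ S (i, j), ∀ y ∈ S (i, j), ¬ x < y := by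
      rintro x ⟨hx, hne, hi, hj, h0, h1⟩ y ⟨hy, -, -, -, k0, k1⟩ hxy
      simp only at *
      have hp : 0 < L * (m i x * m i y) := by positivity
      rcases lt_or_gt_of_ne hne with hlt | hlt
      · have := H.pair j hj i hlt x hx y hy hxy.le
        rw [h1, k1] at this
        nlinarith
      · have := H.pair i hi j hlt x hx y hy hxy.le
        rw [h1, k1] at this
        nlinarith
    intro x hx y hy
    exact le_antisymm (not_lt.1 (key y hy x hx)) (not_lt.1 (key x hx y hy))
  refine ⟨(Finset.range n ×ˢ Finset.range n).biUnion fun k => (hS k).finite.toFinset, ?_, ?_⟩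
  · refine (Finset.card_biUnion_le_card_mul _ _ 1 fun k _ => ?_).trans (by simp)
    rw [Finset.card_le_one]
    intro x hx y hy
    exact hS k ((Set.Finite.mem_toFinset _).1 hx) ((Set.Finite.mem_toFinset _).1 hy)
  · intro i hi j hj hne x hx h0 h1
    simp only [Finset.mem_biUnion, Finset.mem_product, Finset.mem_range]
    exact ⟨(i, j), ⟨hi, hj⟩, (Set.Finite.mem_toFinset _).2 ⟨hx, hne, hi, hj, h0, h1⟩⟩

lemma sum_le_of_dominant (H : MonomialLike g p q C n m m1 m2) {L : ℝ}
    (hL : 0 < L) {i : ℕ} (hi : i < n) {x : ℝ} (hx : x ∈ Ioo p q)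
    (hdom : ∀ j < n, j ≠ i → L * m j x ≤ m i x) :
    ∑ j ∈ (Finset.range n).erase i, m j x ≤ n / L * m i x := by
  have : ∑ j ∈ (Finset.range n).erase i, m j x
      ≤ ∑ j ∈ (Finset.range n).erase i, m i x / L := by
    refine Finset.sum_le_sum fun j hj => ?_
    rw [le_div_iff₀ hL, mul_comm]
    exact hdom j (Finset.mem_range.1 (Finset.mem_of_mem_erase hj)) (Finset.ne_of_mem_erase hj)
  refine this.trans ?_
  rw [Finset.sum_const, nsmul_eq_mul, div_mul_eq_mul_div, mul_div_assoc]
  refine mul_le_mul_of_nonneg_right ?_ (div_nonneg (H.term_nonneg hi hx) hL.le)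
  have : ((Finset.range n).erase i).card ≤ n := by
    simpa using Finset.card_erase_le (s := Finset.range n) (a := i)
  exact_mod_cast this

/-- Where one nonconstant term dominates, the Schwarzian derivative is nonpositive. -/
lemma schwarzian_of_dominant (H : MonomialLike g p q C n m m1 m2) {L : ℝ} (hC : 0 ≤ C)
    (hL : 0 < L) (hLn : n / L ≤ 1 / (10 * (C + 1))) {i : ℕ} (hi : i < n) (hi1 : 1 ≤ i)
    {x : ℝ} (hx : x ∈ Ioo p q) (hdom : ∀ j < n, j ≠ i → L * m j x ≤ m i x) :
    deriv g x * iteratedDeriv 3 g x ≤ 3 / 2 * iteratedDeriv 2 g x ^ 2 := by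
  set ε : ℝ := 1 / (10 * (C + 1)) with hε
  have hε0 : 0 < ε := by positivity
  have hεC : C * ε ≤ 1 / 10 := by
    rw [hε, mul_one_div, div_le_div_iff₀ (by positivity) (by norm_num)]
    nlinarith
  have hε1 : ε ≤ 1 / 10 := by
    rw [hε]
    apply one_div_le_one_div_of_le (by norm_num)
    linarith
  have hs : 0 < x - p := sub_pos.2 hx.1
  have hi' := Finset.mem_range.2 hi
  have hm := H.term_nonneg hi hx
  have hsum : ∑ j ∈ (Finset.range n).erase i, m j x ≤ ε * m i x :=
    (H.sum_le_of_dominant hL hi hx hdom).trans (mul_le_mul_of_nonneg_right hLn hm)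
  have hh : deriv g x ≤ (1 + ε) * m i x := by
    rw [H.deriv_eq x hx, ← Finset.add_sum_erase _ _ hi']
    linarith
  have hh1 : m1 i x ≤ iteratedDeriv 2 g x := by
    rw [H.deriv2_eq x hx]
    exact Finset.single_le_sum (f := fun j => m1 j x)
      (fun j hj => H.nonneg1 j (Finset.mem_range.1 hj) x hx) hi'
  have hh2 : (x - p) ^ 2 * iteratedDeriv 3 g x ≤ (x - p) ^ 2 * m2 i x + C * (ε * m i x) := by
    rw [H.deriv3_eq x hx, ← Finset.add_sum_erase _ _ hi', mul_add, Finset.mul_sum]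
    have : ∑ j ∈ (Finset.range n).erase i, (x - p) ^ 2 * m2 j x
        ≤ C * ∑ j ∈ (Finset.range n).erase i, m j x := by
      rw [Finset.mul_sum]
      exact Finset.sum_le_sum fun j hj =>
        H.mul_le2 j (Finset.mem_range.1 (Finset.mem_of_mem_erase hj)) x hx
    have h2 := mul_le_mul_of_nonneg_left hsum hC
    linarith
  have h0 := H.nonneg1 i hi x hx
  have hmul := H.le_mul i hi hi1 x hx
  have hsch := H.schwarz i hi hi1 x hx
  have hsq : m1 i x ^ 2 ≤ iteratedDeriv 2 g x ^ 2 := pow_le_pow_left₀ h0 hh1 2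
  have hpos := H.pos x hx
  rcases le_or_gt (iteratedDeriv 3 g x) 0 with hneg | h3
  · exact (mul_nonpos_of_nonneg_of_nonpos hpos.le hneg).trans (by positivity)
  have hs2 : 0 < (x - p) ^ 2 := by positivity
  refine le_of_mul_le_mul_left ?_ hs2
  have hmm : m i x ^ 2 ≤ (x - p) ^ 2 * m1 i x ^ 2 := by
    rw [← mul_pow]
    exact pow_le_pow_left₀ hm hmul 2
  have a1 : (x - p) ^ 2 * (deriv g x * iteratedDeriv 3 g x)
      ≤ (1 + ε) * m i x * ((x - p) ^ 2 * m2 i x + C * (ε * m i x)) := by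
    have : (x - p) ^ 2 * (deriv g x * iteratedDeriv 3 g x)
        = deriv g x * ((x - p) ^ 2 * iteratedDeriv 3 g x) := by ring
    rw [this]
    exact mul_le_mul hh hh2 (by positivity) (by positivity)
  have a2 : (1 + ε) * m i x * ((x - p) ^ 2 * m2 i x + C * (ε * m i x))
      = (1 + ε) * ((x - p) ^ 2 * (m i x * m2 i x) + C * ε * m i x ^ 2) := by ring
  have a3 : (x - p) ^ 2 * (m i x * m2 i x) + C * ε * m i x ^ 2
      ≤ (27 / 20) * ((x - p) ^ 2 * m1 i x ^ 2) := by
    have b1 := mul_le_mul_of_nonneg_left hsch hs2.le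
    have b2 := mul_le_mul hεC hmm (by positivity) (by norm_num)
    linarith
  have a4 : 0 ≤ (x - p) ^ 2 * m1 i x ^ 2 := by positivity
  have a5 := mul_le_mul_of_nonneg_left hsq hs2.le
  have a6 := mul_le_mul_of_nonneg_left a3 (show 0 ≤ 1 + ε by positivity)
  nlinarith

end MonomialLike

namespace MonomialLike

variable {g : ℝ → ℝ} {p q C : ℝ} {n : ℕ} {m m1 m2 : ℕ → ℝ → ℝ}

lemma pos_on_of_pos_left (H : MonomialLike g p q C n m m1 m2) {i j : ℕ} (hi : i < n) (hj : j < n)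
    {L t1 t2 : ℝ} (ht1 : p < t1) (ht2 : t2 < q)
    (hne : ∀ x ∈ Icc t1 t2, 0 < m i x → m j x ≠ L * m i x) (hi0 : 0 < m i t1)
    (hpos : m j t1 ≤ L * m i t1) :
    ∀ x ∈ Icc t1 t2, 0 < m i x ∧ m j x ≤ L * m i x := by
  intro x hx
  have hsub : Icc t1 t2 ⊆ Ioo p q := fun z hz => ⟨ht1.trans_le hz.1, hz.2.trans_lt ht2⟩
  have hi' : ∀ z ∈ Ioo p q, 0 < m i z := by
    rcases H.zero_or_pos i hi with h | h
    · exact absurd (h t1 (hsub ⟨le_rfl, hx.1.trans hx.2⟩)) hi0.ne'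
    · exact h
  refine ⟨hi' x (hsub hx), ?_⟩
  have := pos_of_ne_zero_of_pos_left (φ := fun z => L * m i z - m j z) (s := t1) (t := t2)
    (((continuousOn_const.mul (H.continuousOn i hi)).sub (H.continuousOn j hj)).mono hsub)
    (fun z hz h0 => hne z hz (hi' z (hsub hz)) (sub_eq_zero.1 h0).symm) (sub_nonneg.2 hpos) x hx
  exact (sub_pos.1 this).le

lemma one_le_log_distortion (H : MonomialLike g p q C n m m1 m2) {L : ℝ} (hL : 0 < L)
    (hLn : n / L ≤ 1) (hn : 0 < n) {x : ℝ} (hx : x ∈ Ioo p q) (h0 : 0 < m 0 x)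
    (hdom : ∀ j < n, j ≠ 0 → L * m j x ≤ m 0 x) :
    0 ≤ Real.log (deriv g x) - Real.log (m 0 x) ∧
      Real.log (deriv g x) - Real.log (m 0 x) ≤ 1 := by
  have hsum := H.sum_le_of_dominant hL hn hx hdom
  have hdec : deriv g x = m 0 x + ∑ j ∈ (Finset.range n).erase 0, m j x := by
    rw [H.deriv_eq x hx, Finset.add_sum_erase _ (fun j => m j x) (Finset.mem_range.2 hn)]
  have hnn : 0 ≤ ∑ j ∈ (Finset.range n).erase 0, m j x := Finset.sum_nonneg fun j hj =>
    H.term_nonneg (Finset.mem_range.1 (Finset.mem_of_mem_erase hj)) hx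
  have h2 : deriv g x ≤ Real.exp 1 * m 0 x := by
    have := Real.add_one_le_exp (1 : ℝ)
    have h4 := mul_le_mul_of_nonneg_right hLn h0.le
    nlinarith
  constructor
  · rw [sub_nonneg]
    exact Real.log_le_log h0 (by linarith)
  · have := Real.log_le_log (H.pos x hx) h2
    rw [Real.log_mul (Real.exp_pos 1).ne' h0.ne', Real.log_exp] at this
    linarith

/-- The bound for the distortion away from the thresholds of a `MonomialLike` decomposition. -/
lemma crossGood_of_thresholds (H : MonomialLike g p q C n m m1 m2) (hg : ContDiff ℝ ∞ g)
    (hC : 0 ≤ C) {L : ℝ} (hL1 : 1 < L) (hLn : n / L ≤ 1 / (10 * (C + 1))) :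
    CrossGood g (n * n) (2 * (1 + n * n * (C * (2 * Real.log L)))) p q := by
  have hL : 0 < L := by linarith
  have hW : 0 < Real.log L := Real.log_pos hL1
  set W := Real.log L with hWdef
  have hLn1 : n / L ≤ 1 := by
    refine hLn.trans ?_
    rw [div_le_one (by positivity)]
    linarith
  let cl : ℝ → ℝ := fun r => max (-W) (min r W) + W
  have hcl0 : ∀ r, 0 ≤ cl r := fun r => by
    have := le_max_left (-W) (min r W)
    simp only [cl]
    linarith
  have hcl1 : ∀ r, cl r ≤ 2 * W := fun r => by
    have := max_le (show -W ≤ W by linarith) (min_le_right r W)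
    simp only [cl]
    linarith
  have hclm : Monotone cl := fun r s hrs =>
    add_le_add (max_le_max le_rfl (min_le_min hrs le_rfl)) le_rfl
  have hcleq : ∀ r, -W ≤ r → r ≤ W → cl r = r + W := fun r h1 h2 => by
    simp only [cl]
    rw [min_eq_left h2, max_eq_right h1]
  let F0 : ℝ → ℝ := fun x => max 0 (min (Real.log (deriv g x) - Real.log (m 0 x)) 1)
  let I : Finset (ℕ × ℕ) :=
    (Finset.range n ×ˢ Finset.range n).filter fun k => k.1 < k.2
  let G : ℕ × ℕ → ℝ → ℝ := fun k x => C * cl (Real.log (m k.2 x / m k.1 x))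
  have hGm : ∀ k ∈ I, MonotoneOn (G k) (Ioo p q) := by
    intro k hk x hx y hy hxy
    have hk' := Finset.mem_filter.1 hk
    have hk2 := Finset.mem_range.1 (Finset.mem_product.1 hk'.1).2
    exact mul_le_mul_of_nonneg_left (hclm (H.log_ratio_monotoneOn hk2 hk'.2 hx hy hxy)) hC
  have hF0m : MonotoneOn F0 (Ioo p q) := fun x hx y hy hxy => by
    have := H.log_deriv_monotoneOn hg hx hy hxy
    refine max_le_max le_rfl (min_le_min ?_ le_rfl)
    rw [H.const x hx y hy]
    simp only at this
    linarith
  have hIcard : (I.card : ℝ) ≤ n * n := by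
    have : I.card ≤ n * n := (Finset.card_filter_le _ _).trans (by simp)
    exact_mod_cast this
  obtain ⟨P, hPc, hP⟩ := H.exists_thresholds hL
  refine CrossGood.of_monotoneOn P (fun x => 2 * (F0 x + ∑ k ∈ I, G k x)) hPc ?_ (by positivity)
    ?_ ?_
  · intro x hx y hy hxy
    exact mul_le_mul_of_nonneg_left (add_le_add (hF0m hx hy hxy)
      (Finset.sum_le_sum fun k hk => hGm k hk hx hy hxy)) (by norm_num)
  · intro x hx
    have a1 : 0 ≤ F0 x := le_max_left _ _
    have a2 : F0 x ≤ 1 := max_le (by norm_num) (min_le_right _ _)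
    have a3 : 0 ≤ ∑ k ∈ I, G k x := Finset.sum_nonneg fun k _ => mul_nonneg hC (hcl0 _)
    have a4 : ∑ k ∈ I, G k x ≤ I.card • (C * (2 * W)) :=
      Finset.sum_le_card_nsmul _ _ _ fun k _ => mul_le_mul_of_nonneg_left (hcl1 _) hC
    rw [nsmul_eq_mul] at a4
    have a5 := mul_le_mul_of_nonneg_right hIcard (show 0 ≤ C * (2 * W) by positivity)
    exact ⟨by positivity, by linarith⟩
  intro t1 j1 j2 t2 h1 h2 h3 h4 h5 hav
  have ht12 : t1 ≤ t2 := by linarith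
  have hsub : Icc t1 t2 ⊆ Ioo p q := fun z hz => ⟨h1.trans_le hz.1, hz.2.trans_lt h5⟩
  have ht1 := hsub (left_mem_Icc.2 ht12)
  have ht2 := hsub (right_mem_Icc.2 ht12)
  have hpos : ∀ x ∈ Icc t1 t2, 0 < deriv g x := fun x hx => H.pos x (hsub hx)
  have hGsum : ∀ k ∈ I, G k t2 - G k t1 ≤ ∑ k ∈ I, G k t2 - ∑ k ∈ I, G k t1 := by
    intro k hk
    rw [← Finset.sum_sub_distrib]
    exact Finset.single_le_sum (f := fun k => G k t2 - G k t1)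
      (fun k hk => sub_nonneg.2 (hGm k hk ht1 ht2 ht12)) hk
  have hsumle : 0 ≤ ∑ k ∈ I, G k t2 - ∑ k ∈ I, G k t1 :=
    sub_nonneg.2 (Finset.sum_le_sum fun k hk => hGm k hk ht1 ht2 ht12)
  have hF0le : 0 ≤ F0 t2 - F0 t1 := sub_nonneg.2 (hF0m ht1 ht2 ht12)
  have hmon : ∀ x ∈ Icc t1 t2, ∀ y ∈ Icc t1 t2, Real.log (deriv g x) - Real.log (deriv g y)
      ≤ Real.log (deriv g t2) - Real.log (deriv g t1) := fun x hx y hy =>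
    sub_le_sub (H.log_deriv_monotoneOn hg (hsub hx) ht2 hx.2)
      (H.log_deriv_monotoneOn hg ht1 (hsub hy) hy.1)
  have fin : ∀ V : ℝ, (∀ x ∈ Icc t1 t2, ∀ y ∈ Icc t1 t2,
      Real.log (deriv g x) - Real.log (deriv g y) ≤ V) →
      V ≤ F0 t2 + ∑ k ∈ I, G k t2 - (F0 t1 + ∑ k ∈ I, G k t1) →
      crossRatio t1 j1 j2 t2
        ≤ Real.exp (2 * (F0 t2 + ∑ k ∈ I, G k t2) - 2 * (F0 t1 + ∑ k ∈ I, G k t1))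
          * crossRatio (g t1) (g j1) (g j2) (g t2) := by
    intro V hV hV2
    refine (crossRatio_le_of_log_distortion hg h2 h3 h4 hpos fun x hx y hy =>
      (hV x hx y hy).trans hV2).trans_eq ?_
    ring_nf
  have hn : 0 < n := by
    rcases Nat.eq_zero_or_pos n with h0 | h0
    · have a1 := H.pos t1 ht1
      rw [H.deriv_eq t1 ht1, h0] at a1
      simp at a1
    · exact h0
  obtain ⟨i, hi, himax⟩ := Finset.exists_max_image (Finset.range n) (fun i => m i t1)
    ⟨0, Finset.mem_range.2 hn⟩
  have hi' := Finset.mem_range.1 hi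
  have hi0 : 0 < m i t1 := by
    by_contra hcon
    have a1 := H.pos t1 ht1
    rw [H.deriv_eq t1 ht1] at a1
    exact a1.not_ge (Finset.sum_nonpos fun j hj => (himax j hj).trans (not_lt.1 hcon))
  have hthr : ∀ i < n, ∀ j < n, i ≠ j → ∀ x ∈ Icc t1 t2, 0 < m i x → m j x ≠ L * m i x :=
    fun i hi j hj hne x hx h0 h1 => hav x (hP i hi j hj hne x (hsub hx) h0 h1) hx
  by_cases hA : ∀ j < n, j ≠ i → L * m j t1 ≤ m i t1
  · have hdom : ∀ x ∈ Icc t1 t2, ∀ j < n, j ≠ i → L * m j x ≤ m i x := by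
      intro x hx j hj hji
      rcases H.zero_or_pos j hj with hz | hz
      · rw [hz x (hsub hx), mul_zero]
        exact H.term_nonneg hi' (hsub hx)
      · by_contra hcon
        have hsub' : Icc t1 x ⊆ Icc t1 t2 := Icc_subset_Icc le_rfl hx.2
        have := pos_of_ne_zero_of_pos_left (φ := fun z => m i z - L * m j z) (s := t1) (t := t2)
          (((H.continuousOn i hi').sub (continuousOn_const.mul (H.continuousOn j hj))).mono hsub)
          (fun z hw h0 => hthr j hj i hi' hji z hw (hz z (hsub hw)) (sub_eq_zero.1 h0))
          (sub_nonneg.2 (hA j hj hji)) x hx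
        exact hcon (sub_pos.1 this).le
    rcases Nat.eq_zero_or_pos i with h0 | h0
    · subst h0
      have hm0 : ∀ x ∈ Icc t1 t2, 0 < m 0 x := fun x hx => by
        rw [H.const x (hsub hx) t1 ht1]; exact hi0
      have hF0eq : ∀ x ∈ Icc t1 t2, F0 x = Real.log (deriv g x) - Real.log (m 0 x) := by
        intro x hx
        have := H.one_le_log_distortion hL hLn1 hn (hsub hx) (hm0 x hx) (hdom x hx)
        simp only [F0]
        rw [min_eq_left this.2, max_eq_right this.1]
      refine fin _ hmon ?_
      rw [hF0eq t1 (left_mem_Icc.2 ht12), hF0eq t2 (right_mem_Icc.2 ht12), H.const t1 ht1 t2 ht2]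
      linarith
    · have hle := crossRatio_le_of_schwarzian_nonpos hg h2 h3 h4 hpos fun x hx =>
        H.schwarzian_of_dominant hC hL hLn hi' h0 (hsub hx) (hdom x hx)
      have hcr := (crossRatio_pos h2 h3 h4).trans_le hle
      refine hle.trans (le_mul_of_one_le_left hcr.le (Real.one_le_exp ?_))
      linarith
  · push Not at hA
    obtain ⟨j, hj, hji, hlt⟩ := hA
    have hj0 : 0 < m j t1 := by
      by_contra hcon
      nlinarith
    have hij := H.pos_on_of_pos_left hi' hj h1 h5 (hthr i hi' j hj hji.symm) hi0
      ((himax j (Finset.mem_range.2 hj)).trans (le_mul_of_one_le_left hi0.le hL1.le))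
    have hji' := H.pos_on_of_pos_left hj hi' h1 h5 (hthr j hj i hi' hji) hj0 hlt.le
    have hlog : ∀ x ∈ Icc t1 t2, |Real.log (m i x / m j x)| ≤ W ∧
        |Real.log (m j x / m i x)| ≤ W := by
      intro x hx
      obtain ⟨p1, p2⟩ := hij x hx
      obtain ⟨p3, p4⟩ := hji' x hx
      have q2 := Real.log_le_log p3 p2
      have q4 := Real.log_le_log p1 p4
      rw [Real.log_mul hL.ne' (by positivity)] at q2 q4
      rw [Real.log_div p1.ne' p3.ne', Real.log_div p3.ne' p1.ne']
      constructor <;> rw [abs_le] <;> constructor <;> linarith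
    obtain ⟨k, l, hk, hl, hkl, hk0, hl0, hr⟩ : ∃ k l, k < n ∧ l < n ∧ k < l ∧ 0 < m k t1 ∧
        0 < m l t1 ∧ ∀ x ∈ Icc t1 t2, |Real.log (m l x / m k x)| ≤ W := by
      rcases lt_or_gt_of_ne hji with h | h
      · exact ⟨j, i, hj, hi', h, hj0, hi0, fun x hx => (hlog x hx).1⟩
      · exact ⟨i, j, hi', hj, h, hi0, hj0, fun x hx => (hlog x hx).2⟩
    refine fin _ (fun x hx y hy => (hmon x hx y hy).trans ((H.log_deriv_growth hg ht1 ht2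
      ht12).trans (mul_le_mul_of_nonneg_left
        (H.ratio_growth hl hkl ht1 ht2 ht12 hk0 hl0) hC))) ?_
    have := hGsum (k, l) (Finset.mem_filter.2 ⟨Finset.mem_product.2
      ⟨Finset.mem_range.2 hk, Finset.mem_range.2 hl⟩, hkl⟩)
    have r1 := abs_le.1 (hr t1 (left_mem_Icc.2 ht12))
    have r2 := abs_le.1 (hr t2 (right_mem_Icc.2 ht12))
    simp only [G] at this
    rw [hcleq _ r1.1 r1.2, hcleq _ r2.1 r2.2] at this
    linarith

end MonomialLike

lemma exists_crossGood_of_monomialLike (n : ℕ) {C : ℝ} (hC : 0 ≤ C) :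
    ∃ M : ℝ, ∀ (g : ℝ → ℝ) (p q : ℝ) (m m1 m2 : ℕ → ℝ → ℝ), ContDiff ℝ ∞ g →
      MonomialLike g p q C n m m1 m2 → CrossGood g (n * n) M p q := by
  refine ⟨_, fun g p q m m1 m2 hg H => H.crossGood_of_thresholds hg hC
    (L := 10 * (C + 1) * (n + 1)) ?_ ?_⟩
  · have : (0 : ℝ) ≤ n := Nat.cast_nonneg n
    nlinarith [mul_nonneg hC this]
  · rw [div_le_div_iff₀ (by positivity) (by positivity)]
    nlinarith

lemma nonneg_of_hasDerivAt_nonneg {F F' : ℝ → ℝ} {u x : ℝ} (hux : u ≤ x)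
    (hd : ∀ z, HasDerivAt F (F' z) z) (hu : 0 ≤ F u) (hF' : ∀ z ∈ Ioo u x, 0 ≤ F' z) :
    0 ≤ F x := by
  have : MonotoneOn F (Icc u x) := by
    apply monotoneOn_of_deriv_nonneg (convex_Icc u x)
      (fun z _ => (hd z).continuousAt.continuousWithinAt)
      (fun z _ => (hd z).differentiableAt.differentiableWithinAt)
    intro z hz
    rw [interior_Icc] at hz
    rw [(hd z).deriv]
    exact hF' z hz
  exact hu.trans (this ⟨le_rfl, hux⟩ ⟨hux, le_rfl⟩ hux)

lemma pos_of_hasDerivAt_pos {F F' : ℝ → ℝ} {u x : ℝ} (hux : u < x)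
    (hd : ∀ z, HasDerivAt F (F' z) z) (hu : 0 ≤ F u) (hF' : ∀ z ∈ Ioo u x, 0 < F' z) :
    0 < F x := by
  have : StrictMonoOn F (Icc u x) := by
    apply strictMonoOn_of_deriv_pos (convex_Icc u x)
      (fun z _ => (hd z).continuousAt.continuousWithinAt)
    intro z hz
    rw [interior_Icc] at hz
    rw [(hd z).deriv]
    exact hF' z hz
  exact hu.trans_lt (this ⟨le_rfl, hux.le⟩ ⟨hux.le, le_rfl⟩ hux)

/-- Elasticity bounds for iterated primitives of an almost decreasing positive function. -/
lemma elasticity_of_primitives {e : ℕ → ℝ → ℝ} {u v : ℝ} {n : ℕ}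
    (hd : ∀ k < n, ∀ x, HasDerivAt (e (k + 1)) (e k x) x)
    (h0 : ∀ x ∈ Ioo u v, 0 < e 0 x)
    (hr : ∀ x ∈ Ioo u v, ∀ y ∈ Ioo u v, x ≤ y → e 0 y ≤ 5 / 4 * e 0 x)
    (h1 : 0 ≤ e 1 u) (h2 : ∀ k, 2 ≤ k → k ≤ n → e k u = 0) (k : ℕ) (hk : k < n) :
    ∀ x ∈ Ioo u v, 0 < e (k + 1) x ∧ k * e (k + 1) x ≤ (x - u) * e k x ∧
      (x - u) * e k x ≤ (k + 5 / 4) * e (k + 1) x := by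
  induction k with
  | zero =>
    intro x hx
    have hpos := pos_of_hasDerivAt_pos hx.1 (hd 0 hk) h1 fun z hz =>
      h0 z ⟨hz.1, hz.2.trans hx.2⟩
    have := nonneg_of_hasDerivAt_nonneg (F := fun z => e 1 z - 4 / 5 * e 0 x * (z - u))
      (F' := fun z => e 0 z - 4 / 5 * e 0 x * 1) hx.1.le
      (fun z => (hd 0 hk z).sub (((hasDerivAt_id z).sub_const u).const_mul _)) (by simpa using h1)
      (fun z hz => by
        have := hr z ⟨hz.1, hz.2.trans hx.2⟩ x hx hz.2.le
        linarith)
    have h3 := mul_nonneg (sub_nonneg.2 hx.1.le) (h0 x hx).le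
    refine ⟨hpos, by simpa using h3, ?_⟩
    simp only [zero_add, CharP.cast_eq_zero]
    linarith
  | succ k ih =>
    intro x hx
    have ih := ih (by omega)
    have hk2 : e (k + 1 + 1) u = 0 := h2 _ (by omega) (by omega)
    have hpos := pos_of_hasDerivAt_pos hx.1 (hd (k + 1) hk) hk2.ge fun z hz =>
      (ih z ⟨hz.1, hz.2.trans hx.2⟩).1
    have hmul : ∀ z, HasDerivAt (fun z => (z - u) * e (k + 1) z)
        (1 * e (k + 1) z + (z - u) * e k z) z := fun z =>
      ((hasDerivAt_id z).sub_const u).mul (hd k (by omega) z)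
    refine ⟨hpos, ?_, ?_⟩
    · have := nonneg_of_hasDerivAt_nonneg hx.1.le
        (fun z => (hmul z).sub ((hd (k + 1) hk z).const_mul ((k : ℝ) + 1))) (by simp [hk2])
        (fun z hz => by
          have := (ih z ⟨hz.1, hz.2.trans hx.2⟩).2.1
          linarith)
      simp only [Pi.sub_apply] at this
      push_cast
      linarith
    · have := nonneg_of_hasDerivAt_nonneg hx.1.le
        (fun z => ((hd (k + 1) hk z).const_mul ((k : ℝ) + 1 + 5 / 4)).sub (hmul z)) (by simp [hk2])
        (fun z hz => by
          have := (ih z ⟨hz.1, hz.2.trans hx.2⟩).2.2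
          linarith)
      simp only [Pi.sub_apply] at this
      push_cast
      linarith

lemma mul_pow_le_of_elasticity {φ φ' : ℝ → ℝ} {u v : ℝ} {k : ℕ}
    (hd : ∀ x, HasDerivAt φ (φ' x) x) (hφ : ∀ x ∈ Ioo u v, k * φ x ≤ (x - u) * φ' x)
    {x y : ℝ} (hx : x ∈ Ioo u v) (hy : y ∈ Ioo u v) (hxy : x ≤ y) :
    φ x * (y - u) ^ k ≤ φ y * (x - u) ^ k := by
  have hdd : ∀ z ∈ Ioo u v, HasDerivAt (fun z => φ z / (z - u) ^ k)
      ((φ' z * (z - u) ^ k - φ z * (k * (z - u) ^ (k - 1) * 1)) / ((z - u) ^ k) ^ 2) z :=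
    fun z hz => (hd z).div (((hasDerivAt_id z).sub_const u).pow k)
      (pow_pos (sub_pos.2 hz.1) k).ne'
  have hm : MonotoneOn (fun z => φ z / (z - u) ^ k) (Ioo u v) := by
    apply monotoneOn_of_deriv_nonneg (convex_Ioo u v)
      (fun z hz => (hdd z hz).continuousAt.continuousWithinAt)
      (fun z hz => (hdd z (interior_subset hz)).differentiableAt.differentiableWithinAt)
    intro z hz
    have hz' := interior_subset hz
    have hs : 0 < z - u := sub_pos.2 hz'.1
    rw [(hdd z hz').deriv]
    refine div_nonneg ?_ (by positivity)
    rcases Nat.eq_zero_or_pos k with h0 | h0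
    · subst h0
      have := hφ z hz'
      simp only [CharP.cast_eq_zero, zero_mul] at this
      simpa using nonneg_of_mul_nonneg_right this hs
    · have e1 : (z - u) ^ k = (z - u) ^ (k - 1) * (z - u) := by
        rw [← pow_succ, Nat.sub_add_cancel h0]
      have := mul_le_mul_of_nonneg_left (hφ z hz') (pow_pos hs (k - 1)).le
      rw [e1]
      linarith
  have := hm hx hy hxy
  simp only at this
  rwa [div_le_div_iff₀ (pow_pos (sub_pos.2 hx.1) k) (pow_pos (sub_pos.2 hy.1) k)] at this

/-- The `r`-th derivative of `a i * (x - u) ^ i / i !`. -/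
def taylorTerm (a : ℕ → ℝ) (u : ℝ) (r i : ℕ) (x : ℝ) : ℝ :=
  if r ≤ i then a i * ((x - u) ^ (i - r) / (i - r).factorial) else 0

lemma sum_taylorTerm (a : ℕ → ℝ) (u : ℝ) (r n : ℕ) (x : ℝ) :
    ∑ i ∈ Finset.range n, taylorTerm a u r i x
      = ∑ i ∈ Finset.range (n - r), a (r + i) * ((x - u) ^ i / i.factorial) := by
  rcases le_or_gt r n with h | h
  · obtain ⟨k, rfl⟩ := Nat.exists_eq_add_of_le h
    rw [Finset.sum_range_add, Finset.sum_eq_zero, zero_add, Nat.add_sub_cancel_left]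
    · refine Finset.sum_congr rfl fun i _ => ?_
      simp [taylorTerm]
    · intro i hi
      have := Finset.mem_range.1 hi
      simp [taylorTerm, this]
  · rw [Nat.sub_eq_zero_of_le h.le, Finset.sum_range_zero]
    refine Finset.sum_eq_zero fun i hi => ?_
    have := Finset.mem_range.1 hi
    simp [taylorTerm, this.trans h]

lemma sub_mul_taylorTerm (a : ℕ → ℝ) (u : ℝ) (r i : ℕ) (x : ℝ) :
    (x - u) * taylorTerm a u (r + 1) i x = ((i : ℝ) - r) * taylorTerm a u r i x := by
  unfold taylorTerm
  rcases lt_trichotomy i r with h | h | h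
  · rw [if_neg (by omega), if_neg (by omega)]; simp
  · subst h
    rw [if_neg (by omega)]; simp
  · obtain ⟨k, rfl⟩ := Nat.exists_eq_add_of_lt h
    rw [if_pos (by omega), if_pos (by omega), show r + k + 1 - (r + 1) = k by omega,
      show r + k + 1 - r = k + 1 by omega, Nat.factorial_succ]
    push_cast
    field_simp
    ring

lemma taylorTerm_nonneg {a : ℕ → ℝ} {i : ℕ} (ha : 0 ≤ a i) {u x : ℝ} (hx : u ≤ x) (r : ℕ) :
    0 ≤ taylorTerm a u r i x := by
  unfold taylorTerm
  split_ifs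
  · have := sub_nonneg.2 hx
    positivity
  · exact le_rfl

lemma hasDerivAt_taylorSum (a : ℕ → ℝ) (u : ℝ) (n : ℕ) (x : ℝ) :
    HasDerivAt (fun x => ∑ i ∈ Finset.range (n + 1), a i * ((x - u) ^ i / i.factorial))
      (∑ i ∈ Finset.range n, a (i + 1) * ((x - u) ^ i / i.factorial)) x := by
  have h : ∀ i, HasDerivAt (fun x => a i * ((x - u) ^ i / (i.factorial : ℝ)))
      (a i * (i * (x - u) ^ (i - 1) * 1 / i.factorial)) x := fun i =>
    ((((hasDerivAt_id x).sub_const u).pow i).div_const _).const_mul _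
  have := HasDerivAt.fun_sum (u := Finset.range (n + 1)) fun i _ => h i
  refine this.congr_deriv ?_
  rw [Finset.sum_range_succ']
  simp only [CharP.cast_eq_zero, zero_mul, zero_div, mul_zero, add_zero, Nat.factorial_succ,
    Nat.add_sub_cancel]
  refine Finset.sum_congr rfl fun i _ => ?_
  push_cast
  field_simp

lemma exists_monomialLike {g : ℝ → ℝ} (hg : ContDiff ℝ ∞ g) {u v : ℝ} (huv : u < v) (N : ℕ)
    (hpos : ∀ i ≤ N + 2, ∀ x ∈ Ioo u v, 0 < iteratedDeriv (i + 1) g x)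
    (hr : ∀ x ∈ Ioo u v, ∀ y ∈ Ioo u v, x ≤ y →
      iteratedDeriv (N + 3) g y ≤ 5 / 4 * iteratedDeriv (N + 3) g x) :
    ∃ m m1 m2, MonomialLike g u v (((N : ℝ) + 3) ^ 2) (N + 2) m m1 m2 := by
  set d : ℕ → ℝ → ℝ := fun i => iteratedDeriv (i + 1) g with hddef
  have hdd : ∀ i x, HasDerivAt (d i) (d (i + 1) x) x := fun i x =>
    hasDerivAt_iteratedDeriv hg (i + 1) x
  have hdu : ∀ i ≤ N + 2, 0 ≤ d i u := by
    intro i hi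
    have hc : ContinuousWithinAt (d i) (Ioo u v) u := (hdd i u).continuousAt.continuousWithinAt
    have hcl : u ∈ closure (Ioo u v) := by
      rw [closure_Ioo huv.ne]
      exact ⟨le_rfl, huv.le⟩
    have := hc.mem_closure (t := Ici 0) hcl fun x hx => (hpos i hi x hx).le
    rwa [closure_Ici] at this
  set a : ℕ → ℝ := fun i => d i u with ha
  let e : ℕ → ℝ → ℝ := fun j x => d (N + 2 - j) x
    - ∑ i ∈ Finset.range (j - 1), a (N + 2 - j + i) * ((x - u) ^ i / i.factorial)
  have hde : ∀ k < N + 2, ∀ x, HasDerivAt (e (k + 1)) (e k x) x := by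
    intro k hk x
    have h1 := hdd (N + 2 - (k + 1)) x
    rw [show N + 2 - (k + 1) + 1 = N + 2 - k by omega] at h1
    refine h1.sub ?_
    rcases Nat.eq_zero_or_pos k with h0 | h0
    · subst h0
      simpa using hasDerivAt_const x (0 : ℝ)
    · obtain ⟨l, rfl⟩ := Nat.exists_eq_succ_of_ne_zero h0.ne'
      have := hasDerivAt_taylorSum (fun i => a (N + 2 - (l + 1 + 1) + i)) u l x
      refine this.congr_deriv ?_
      refine Finset.sum_congr rfl fun i _ => ?_
      rw [show N + 2 - (l + 1 + 1) + (i + 1) = N + 2 - l.succ + i by omega]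
  have hel := elasticity_of_primitives (u := u) (v := v) hde
    (fun x hx => by simpa [e] using hpos (N + 2) le_rfl x hx)
    (fun x hx y hy hxy => by simpa [e] using hr x hx y hy hxy)
    (by simpa [e] using hdu (N + 1) (by omega)) (by
      intro k h2 hk
      obtain ⟨l, rfl⟩ := Nat.exists_eq_add_of_le h2
      simp only [e, sub_self, ha]
      rw [show 2 + l - 1 = l + 1 by omega, Finset.sum_range_succ', Finset.sum_eq_zero]
      · simp
      · intro i _
        simp)
  have E1 := hel (N + 1) (by omega)
  have E0 := hel N (by omega)
  set R := e (N + 2) with hR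
  set R1 := e (N + 1) with hR1
  set R2 := e N with hR2
  have hR1n : ∀ x ∈ Ioo u v, 0 ≤ R1 x := fun x hx => (E0 x hx).1.le
  have hRn : ∀ x ∈ Ioo u v, 0 ≤ R x := fun x hx => (E1 x hx).1.le
  push_cast at E1
  have hNR : (0 : ℝ) ≤ N := Nat.cast_nonneg N
  have hsumm : ∀ (r : ℕ) (S : ℝ → ℝ) (x : ℝ),
      ∑ i ∈ Finset.range (N + 2), (if i ≤ N then taylorTerm a u r i x else S x)
        = ∑ i ∈ Finset.range (N + 1 - r), a (r + i) * ((x - u) ^ i / i.factorial) + S x := by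
    intro r S x
    rw [Finset.sum_range_succ, if_neg (by omega), ← sum_taylorTerm]
    congr 1
    refine Finset.sum_congr rfl fun i hi => if_pos ?_
    have := Finset.mem_range.1 hi
    omega
  have htn : ∀ i ≤ N, ∀ r, ∀ x ∈ Ioo u v, 0 ≤ taylorTerm a u r i x := fun i hi r x hx =>
    taylorTerm_nonneg (hdu i (by omega)) hx.1.le r
  have hs1 : ∀ i x, (x - u) * taylorTerm a u 1 i x = i * taylorTerm a u 0 i x := fun i x => by
    simpa using sub_mul_taylorTerm a u 0 i x
  have hs2 : ∀ i x, (x - u) ^ 2 * taylorTerm a u 2 i x = i * (i - 1) * taylorTerm a u 0 i x := by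
    intro i x
    have := sub_mul_taylorTerm a u 1 i x
    push_cast at this
    rw [pow_two, mul_assoc, this, mul_left_comm, hs1]
    ring
  refine ⟨fun i x => if i ≤ N then taylorTerm a u 0 i x else R x,
    fun i x => if i ≤ N then taylorTerm a u 1 i x else R1 x,
    fun i x => if i ≤ N then taylorTerm a u 2 i x else R2 x, ?_⟩
  constructor
  · intro i hi
    split_ifs with h
    · simp only [taylorTerm, zero_le, if_true]
      fun_prop
    · exact fun x _ => (hde (N + 1) (by omega) x).continuousAt.continuousWithinAt
  · intro i hi
    split_ifs with h
    · rcases (hdu i (by omega)).eq_or_lt with h0 | h0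
      · left
        intro x _
        simp [taylorTerm, ha, ← h0]
      · right
        intro x hx
        have := sub_pos.2 hx.1
        simp only [taylorTerm, zero_le, if_true]
        have h0' : 0 < a i := h0
        positivity
    · exact Or.inr fun x hx => (E1 x hx).1
  · intro x _ y _
    simp [taylorTerm]
  · intro i hi x hx
    split_ifs with h
    · exact htn i h 1 x hx
    · exact hR1n x hx
  · intro i hi hi1 x hx
    split_ifs with h
    · rw [hs1]
      exact le_mul_of_one_le_left (htn i h 0 x hx) (by exact_mod_cast hi1)
    · have := (E1 x hx).2.1
      nlinarith [mul_nonneg hNR (hRn x hx)]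
  · intro i hi hi1 x hx
    have hs : 0 < x - u := sub_pos.2 hx.1
    split_ifs with h
    · have h1 : (x - u) ^ 2 * (taylorTerm a u 0 i x * taylorTerm a u 2 i x)
          ≤ (x - u) ^ 2 * (5 / 4 * taylorTerm a u 1 i x ^ 2) := by
        have e1 : (x - u) ^ 2 * (taylorTerm a u 0 i x * taylorTerm a u 2 i x)
            = i * (i - 1) * taylorTerm a u 0 i x ^ 2 := by
          rw [mul_left_comm, hs2]; ring
        have e2 : (x - u) ^ 2 * (5 / 4 * taylorTerm a u 1 i x ^ 2)
            = 5 / 4 * (i * taylorTerm a u 0 i x) ^ 2 := by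
          rw [← hs1]; ring
        have hi0 : (0 : ℝ) ≤ i := Nat.cast_nonneg i
        rw [e1, e2]
        nlinarith [sq_nonneg (taylorTerm a u 0 i x),
          mul_nonneg hi0 (sq_nonneg (taylorTerm a u 0 i x)),
          mul_nonneg (sq_nonneg (i : ℝ)) (sq_nonneg (taylorTerm a u 0 i x))]
      exact le_of_mul_le_mul_left h1 (by positivity)
    · have a1 := (E1 x hx).2.1
      have a2 := (E0 x hx).2.2
      have h1 : (x - u) * (((N : ℝ) + 1) * (R x * R2 x))
          ≤ (x - u) * (((N : ℝ) + 5 / 4) * R1 x ^ 2) := by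
        rcases le_or_gt (R2 x) 0 with h2 | h2
        · have : R x * R2 x ≤ 0 := mul_nonpos_of_nonneg_of_nonpos (hRn x hx) h2
          have : ((N : ℝ) + 1) * (R x * R2 x) ≤ 0 :=
            mul_nonpos_of_nonneg_of_nonpos (by positivity) this
          exact mul_le_mul_of_nonneg_left (this.trans (by positivity)) hs.le
        · have b1 := mul_le_mul_of_nonneg_right a1 (mul_pos hs h2).le
          have b2 := mul_le_mul_of_nonneg_left a2 (mul_nonneg hs.le (hR1n x hx))
          nlinarith
      have h2 := le_of_mul_le_mul_left h1 hs
      have h3 : 0 ≤ R1 x ^ 2 := by positivity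
      have h4 : ((N : ℝ) + 1) * (R x * R2 x) ≤ ((N : ℝ) + 1) * (5 / 4 * R1 x ^ 2) := by
        nlinarith [mul_nonneg hNR h3]
      exact le_of_mul_le_mul_left h4 (by positivity)
  · intro i hi x hx
    split_ifs with h
    · rw [hs1]
      refine mul_le_mul_of_nonneg_right ?_ (htn i h 0 x hx)
      have : (i : ℝ) ≤ N := by exact_mod_cast h
      nlinarith
    · have := (E1 x hx).2.2
      refine this.trans (mul_le_mul_of_nonneg_right ?_ (hRn x hx))
      nlinarith
  · intro i hi x hx
    split_ifs with h
    · rw [hs2]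
      refine mul_le_mul_of_nonneg_right ?_ (htn i h 0 x hx)
      have : (i : ℝ) ≤ N := by exact_mod_cast h
      have : (0 : ℝ) ≤ i := Nat.cast_nonneg i
      nlinarith
    · have a1 := (E1 x hx).2.2
      have a2 := mul_le_mul_of_nonneg_left (E0 x hx).2.2 (sub_nonneg.2 hx.1.le)
      have a3 := mul_le_mul_of_nonneg_left a1 (show (0 : ℝ) ≤ N + 5 / 4 by positivity)
      have a4 := hRn x hx
      nlinarith [mul_nonneg hNR a4]
  · intro j hj i hij x hx y hy hxy
    have hiN : i ≤ N := by omega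
    have hX : 0 < x - u := sub_pos.2 hx.1
    have hY : 0 < y - u := sub_pos.2 hy.1
    have key : ∀ φ : ℝ → ℝ, φ x * (y - u) ^ (i + 1) ≤ φ y * (x - u) ^ (i + 1) →
        (y - u) * (φ x * taylorTerm a u 0 i y) ≤ (x - u) * (φ y * taylorTerm a u 0 i x) := by
      intro φ h
      have hai : 0 ≤ a i / i.factorial := div_nonneg (hdu i (by omega)) (by positivity)
      have := mul_le_mul_of_nonneg_left h hai
      simp only [taylorTerm, zero_le, if_true, Nat.sub_zero]
      rw [pow_succ, pow_succ] at this
      refine le_of_eq_of_le ?_ (this.trans_eq ?_) <;> ring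
    simp only [hiN, if_true]
    split_ifs with h
    · apply key
      obtain ⟨k, rfl⟩ := Nat.exists_eq_add_of_lt hij
      simp only [taylorTerm, zero_le, if_true, Nat.sub_zero]
      have h1 : (x - u) ^ k ≤ (y - u) ^ k := pow_le_pow_left₀ hX.le (by linarith) k
      have h2 : 0 ≤ a (i + k + 1) / (i + k + 1).factorial * ((x - u) ^ (i + 1) * (y - u) ^ (i + 1)) :=
        mul_nonneg (div_nonneg (hdu _ (by omega)) (by positivity)) (by positivity)
      have h3 := mul_le_mul_of_nonneg_left h1 h2
      refine le_of_eq_of_le ?_ (h3.trans_eq ?_) <;> ring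
    · apply key
      refine mul_pow_le_of_elasticity (hde (N + 1) (by omega)) (fun z hz => ?_) hx hy hxy
      refine le_trans (mul_le_mul_of_nonneg_right ?_ (hRn z hz)) (E1 z hz).2.1
      exact_mod_cast (by omega : i + 1 ≤ N + 1)
  · intro x hx
    rw [hsumm 0 R x]
    simp [hR, e, hddef]
  · intro x hx
    rw [hsumm 1 R1 x]
    simp [hR1, e, hddef, show N + 2 - (N + 1) = 1 by omega]
  · intro x hx
    rw [hsumm 2 R2 x]
    simp [hR2, e, hddef, show N + 1 - 2 = N - 1 by omega]
  · intro x hx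
    simpa using hpos 0 (by omega) x hx

lemma pos_or_neg_of_ne_zero {φ : ℝ → ℝ} {u v : ℝ} (hc : Continuous φ)
    (h0 : ∀ x ∈ Ioo u v, φ x ≠ 0) :
    (∀ x ∈ Ioo u v, 0 < φ x) ∨ (∀ x ∈ Ioo u v, φ x < 0) := by
  by_contra hcon
  push Not at hcon
  obtain ⟨⟨x, hx, hx0⟩, y, hy, hy0⟩ := hcon
  obtain ⟨z, hz, e⟩ := isPreconnected_Ioo.intermediate_value hx hy hc.continuousOn ⟨hx0, hy0⟩
  exact h0 z hz e

lemma CrossGood.of_split {g φ φ' : ℝ → ℝ} {K : ℕ} {M u v : ℝ} (s : ℝ)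
    (hd : ∀ x, HasDerivAt φ (φ' x) x) (h0 : ∀ x ∈ Ioo u v, φ' x ≠ 0)
    (h : ∀ u' v', u ≤ u' → v' ≤ v → (∀ x ∈ Ioo u' v', φ x ≠ s) → CrossGood g K M u' v') :
    CrossGood g (2 * K + 1) (2 * M) u v := by
  by_cases hz : ∃ z ∈ Ioo u v, φ z = s
  · obtain ⟨z, hz, hzs⟩ := hz
    have hinj : ∀ x ∈ Ioo u v, ∀ y ∈ Ioo u v, x < y → φ x ≠ φ y := by
      intro x hx y hy hxy e
      obtain ⟨w, hw, hw0⟩ := exists_hasDerivAt_eq_zero hxy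
        (fun t _ => (hd t).continuousAt.continuousWithinAt) e (fun t _ => hd t)
      exact h0 w ⟨hx.1.trans hw.1, hw.2.trans hy.2⟩ hw0
    have h1 := h u z le_rfl hz.2.le fun x hx =>
      hzs ▸ hinj x ⟨hx.1, hx.2.trans hz.2⟩ z hz hx.2
    have h2 := h z v hz.1.le le_rfl fun x hx =>
      hzs ▸ (hinj z hz x ⟨hz.1.trans hx.1, hx.2⟩ hx.1).symm
    exact (h1.union h2).mono (by omega) (by linarith)
  · push Not at hz
    have h1 := h u v le_rfl le_rfl hz
    have := h1.nonneg
    exact h1.mono (by omega) (by linarith)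

lemma iteratedDeriv_neg_eq (g : ℝ → ℝ) (i : ℕ) (x : ℝ) :
    iteratedDeriv i (fun z => -g z) x = -iteratedDeriv i g x := by
  simp

lemma exists_crossGood_of_derivs_pos (n : ℕ) (hn : 3 ≤ n) :
    ∃ M : ℝ, ∀ (g : ℝ → ℝ) (u v : ℝ), ContDiff ℝ ∞ g →
      (∀ i, 1 ≤ i → i ≤ n → ∀ x ∈ Ioo u v, iteratedDeriv i g x ≠ 0) →
      (∀ x ∈ Ioo u v, 0 < deriv g x) → (∀ x ∈ Ioo u v, 0 < iteratedDeriv 2 g x) →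
      (∀ x ∈ Ioo u v, ∀ y ∈ Ioo u v, |iteratedDeriv n g x| ≤ 5 / 4 * |iteratedDeriv n g y|) →
      CrossGood g (n * n) M u v := by
  choose M hM using fun N : ℕ => exists_crossGood_of_monomialLike (N + 2)
    (C := ((N : ℝ) + 3) ^ 2) (by positivity)
  refine ⟨∑ N ∈ Finset.range n, |M N|, fun g u v hg h0 hp1 hp2 hr => ?_⟩
  rcases le_or_gt v u with huv | huv
  · exact (CrossGood.of_le g huv).mono (by omega) (Finset.sum_nonneg fun N _ => abs_nonneg _)
  classical
  have hex : ∃ i, 1 ≤ i ∧ ((¬ ∀ x ∈ Ioo u v, 0 < iteratedDeriv i g x) ∨ i = n + 1) :=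
    ⟨n + 1, by omega, Or.inr rfl⟩
  obtain ⟨k, hk, hmin⟩ : ∃ k, (1 ≤ k ∧ ((¬ ∀ x ∈ Ioo u v, 0 < iteratedDeriv k g x) ∨ k = n + 1)) ∧
      ∀ i, 1 ≤ i → i < k → (∀ x ∈ Ioo u v, 0 < iteratedDeriv i g x) ∧ i ≠ n + 1 := by
    refine ⟨Nat.find hex, Nat.find_spec hex, fun i h1 hi => ?_⟩
    have := Nat.find_min hex hi
    push Not at this
    exact this h1
  have hkn : k ≤ n + 1 := not_lt.1 fun hlt => (hmin (n + 1) (by omega) hlt).2 rfl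
  have hk3 : 3 ≤ k := by
    by_contra hlt
    obtain ⟨hk1, hk2 | hk2⟩ := hk
    · have : k = 1 ∨ k = 2 := by omega
      rcases this with rfl | rfl
      · exact hk2 (by simpa [iteratedDeriv_one] using hp1)
      · exact hk2 hp2
    · omega
  have hneg : k ≤ n → ∀ x ∈ Ioo u v, iteratedDeriv k g x < 0 := by
    intro hle
    rcases pos_or_neg_of_ne_zero (continuous_iteratedDeriv_of_smooth hg k) (h0 k hk.1 hle) with h | h
    · rcases hk.2 with h2 | h2
      · exact absurd h h2
      · omega
    · exact h
  rcases eq_or_lt_of_le hk3 with h3 | h3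
  · subst h3
    refine (CrossGood.of_schwarzian_nonpos hg hp1 fun x hx => ?_).mono (by omega)
      (Finset.sum_nonneg fun N _ => abs_nonneg _)
    exact (mul_nonpos_of_nonneg_of_nonpos (hp1 x hx).le (hneg hn x hx).le).trans (by positivity)
  · obtain ⟨N, rfl⟩ := Nat.exists_eq_add_of_le h3
    obtain ⟨m, m1, m2, hm⟩ := exists_monomialLike hg huv N
      (fun i hi => (hmin (i + 1) (by omega) (by omega)).1) (by
        intro x hx y hy hxy
        have hpx := (hmin (N + 3) (by omega) (by omega)).1 x hx
        have hpy := (hmin (N + 3) (by omega) (by omega)).1 y hy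
        rcases eq_or_lt_of_le hkn with h4 | h4
        · have := hr y hy x hx
          rw [show n = N + 3 by omega] at this
          rwa [abs_of_pos hpx, abs_of_pos hpy] at this
        · have hanti : AntitoneOn (iteratedDeriv (N + 3) g) (Ioo u v) := by
            apply antitoneOn_of_deriv_nonpos (convex_Ioo u v)
              (continuous_iteratedDeriv_of_smooth hg _).continuousOn
              (fun z _ => (hasDerivAt_iteratedDeriv hg _ z).differentiableAt.differentiableWithinAt)
            intro z hz
            rw [(hasDerivAt_iteratedDeriv hg _ z).deriv]
            have := hneg (by omega) z (interior_subset hz)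
            rw [show N + 3 + 1 = 3 + 1 + N by omega]
            exact this.le
          have := hanti hx hy hxy
          linarith)
    refine (hM N g u v m m1 m2 hg hm).mono (Nat.mul_le_mul (by omega) (by omega)) ?_
    exact (le_abs_self _).trans (Finset.single_le_sum (f := fun N => |M N|)
      (fun _ _ => abs_nonneg _) (Finset.mem_range.2 (by omega)))

lemma exists_crossGood_of_derivs_ne_zero (n : ℕ) (hn : 3 ≤ n) (i : ℕ) (hi : i < n) :
    ∃ (K : ℕ) (M : ℝ), ∀ (g : ℝ → ℝ) (u v : ℝ), ContDiff ℝ ∞ g →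
      (∀ j, i < j → j ≤ n → ∀ x ∈ Ioo u v, iteratedDeriv j g x ≠ 0) →
      (∀ x ∈ Ioo u v, ∀ y ∈ Ioo u v, |iteratedDeriv n g x| ≤ 5 / 4 * |iteratedDeriv n g y|) →
      CrossGood g K M u v := by
  induction i with
  | zero =>
    obtain ⟨M, hM⟩ := exists_crossGood_of_derivs_pos n hn
    refine ⟨n * n, M, ?_⟩
    have step1 : ∀ (g : ℝ → ℝ) (u v : ℝ), ContDiff ℝ ∞ g →
        (∀ j, 0 < j → j ≤ n → ∀ x ∈ Ioo u v, iteratedDeriv j g x ≠ 0) →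
        (∀ x ∈ Ioo u v, ∀ y ∈ Ioo u v,
          |iteratedDeriv n g x| ≤ 5 / 4 * |iteratedDeriv n g y|) →
        (∀ x ∈ Ioo u v, 0 < deriv g x) → CrossGood g (n * n) M u v := by
      intro g u v hg h0 hr hp
      rcases pos_or_neg_of_ne_zero (continuous_iteratedDeriv_of_smooth hg 2)
        (h0 2 (by omega) (by omega)) with h | h
      · exact hM g u v hg h0 hp h hr
      · apply CrossGood.of_reflect
        have hmem : ∀ x ∈ Ioo (-v) (-u), -x ∈ Ioo u v := fun x hx =>
          ⟨by linarith [hx.2], by linarith [hx.1]⟩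
        have habs : ∀ j x, |iteratedDeriv j (fun z => -g (-z)) x| = |iteratedDeriv j g (-x)| := by
          intro j x
          rw [iteratedDeriv_reflect, abs_neg, abs_mul, abs_pow, abs_neg, abs_one, one_pow, one_mul]
        refine hM _ _ _ (smooth_reflect hg) (fun j hj hjn x hx => ?_) (fun x hx => ?_)
          (fun x hx => ?_) (fun x hx y hy => ?_)
        · rw [← abs_pos, habs, abs_pos]
          exact h0 j hj hjn _ (hmem x hx)
        · rw [deriv_reflect]
          exact hp _ (hmem x hx)
        · rw [iteratedDeriv_reflect]
          have := h _ (hmem x hx)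
          norm_num
          exact this
        · rw [habs, habs]
          exact hr _ (hmem x hx) _ (hmem y hy)
    intro g u v hg h0 hr
    have h1 := h0 1 (by omega) (by omega)
    rw [iteratedDeriv_one] at h1
    rcases pos_or_neg_of_ne_zero
      (by simpa using continuous_iteratedDeriv_of_smooth hg 1) h1 with h | h
    · exact step1 g u v hg h0 hr h
    · apply CrossGood.of_neg
      refine step1 _ u v hg.neg (fun j hj hjn x hx => ?_) (fun x hx y hy => ?_) (fun x hx => ?_)
      · rw [iteratedDeriv_neg_eq]
        exact neg_ne_zero.2 (h0 j hj hjn x hx)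
      · rw [iteratedDeriv_neg_eq, iteratedDeriv_neg_eq, abs_neg, abs_neg]
        exact hr x hx y hy
      · rw [deriv.fun_neg]
        exact neg_pos.2 (h x hx)
  | succ i ih =>
    obtain ⟨K, M, h⟩ := ih (by omega)
    refine ⟨2 * K + 1, 2 * M, fun g u v hg h0 hr => ?_⟩
    refine CrossGood.of_split (φ := iteratedDeriv (i + 1) g) 0
      (hasDerivAt_iteratedDeriv hg (i + 1)) (h0 _ (by omega) (by omega)) ?_
    intro u' v' hu hv hne
    have hsub : Ioo u' v' ⊆ Ioo u v := Ioo_subset_Ioo hu hv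
    refine h g u' v' hg (fun j hj hjn x hx => ?_) fun x hx y hy => hr x (hsub hx) y (hsub hy)
    rcases eq_or_lt_of_le (Nat.succ_le_of_lt hj) with h1 | h1
    · rw [← h1]
      exact hne x hx
    · exact h0 j h1 hjn x (hsub hx)

lemma CrossGood.of_abs_lipschitz {g : ℝ → ℝ} (hg : ContDiff ℝ ∞ g) {u v c B : ℝ} (hc : 0 < c)
    (hB : 0 ≤ B) (huv : u ≤ v) (hpos : ∀ x ∈ Ioo u v, c ≤ |deriv g x|)
    (hS : ∀ x ∈ Ioo u v, |iteratedDeriv 2 g x| ≤ B) :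
    CrossGood g 0 (2 * (B / c) * (v - u)) u v := by
  have hne : ∀ x ∈ Ioo u v, deriv g x ≠ 0 := fun x hx => abs_pos.1 (hc.trans_le (hpos x hx))
  rcases pos_or_neg_of_ne_zero
    (by simpa using continuous_iteratedDeriv_of_smooth hg 1) hne with h | h
  · exact CrossGood.of_lipschitz hg hc hB huv (fun x hx => by
      simpa [abs_of_pos (h x hx)] using hpos x hx) hS
  · apply CrossGood.of_neg
    refine CrossGood.of_lipschitz hg.neg hc hB huv (fun x hx => ?_) (fun x hx => ?_)
    · rw [deriv.fun_neg]
      simpa [abs_of_neg (h x hx)] using hpos x hx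
    · rw [iteratedDeriv_neg_eq, abs_neg]
      exact hS x hx

lemma exists_crossGood_of_second_deriv {A B l : ℝ} (hA : 0 < A) (hB : 0 ≤ B) (hl : 0 ≤ l) :
    ∃ (K : ℕ) (M : ℝ), ∀ (g : ℝ → ℝ) (u v : ℝ), ContDiff ℝ ∞ g → v - u ≤ l →
      (∀ x ∈ Ioo u v, A ≤ |iteratedDeriv 2 g x|) → (∀ x ∈ Ioo u v, |iteratedDeriv 2 g x| ≤ B) →
      (∀ x ∈ Ioo u v, |iteratedDeriv 3 g x| ≤ B) → CrossGood g K M u v := by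
  set c := 3 / 2 * A ^ 2 / (B + 1) with hc
  have hc0 : 0 < c := by positivity
  have hcB : c * B ≤ 3 / 2 * A ^ 2 := by
    rw [hc, div_mul_eq_mul_div, div_le_iff₀ (by positivity)]
    nlinarith [sq_nonneg A]
  refine ⟨2 * (2 * (2 * 0 + 1) + 1) + 1, 2 * (2 * (2 * (2 * (B / c) * l))), ?_⟩
  have key : ∀ (g : ℝ → ℝ) (u v : ℝ), ContDiff ℝ ∞ g → v - u ≤ l →
      (∀ x ∈ Ioo u v, A ≤ |iteratedDeriv 2 g x|) → (∀ x ∈ Ioo u v, |iteratedDeriv 2 g x| ≤ B) →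
      (∀ x ∈ Ioo u v, |iteratedDeriv 3 g x| ≤ B) → (∀ x ∈ Ioo u v, 0 < deriv g x) →
      (∀ x ∈ Ioo u v, deriv g x ≠ c) → CrossGood g 0 (2 * (B / c) * l) u v := by
    intro g u v hg huvl h2 h2B h3 hp hne
    rcases le_or_gt v u with huv | huv
    · exact (CrossGood.of_le g huv).mono le_rfl (by positivity)
    have hcont : Continuous (deriv g) := by simpa using continuous_iteratedDeriv_of_smooth hg 1
    rcases pos_or_neg_of_ne_zero (φ := fun x => deriv g x - c) (hcont.sub continuous_const)
      (fun x hx => sub_ne_zero.2 (hne x hx)) with h | h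
    · refine (CrossGood.of_lipschitz hg hc0 hB huv.le (fun x hx => (sub_pos.1 (h x hx)).le)
        h2B).mono le_rfl (mul_le_mul_of_nonneg_left huvl (by positivity))
    · refine (CrossGood.of_schwarzian_nonpos hg hp fun x hx => ?_).mono le_rfl (by positivity)
      have a1 : deriv g x ≤ c := (sub_neg.1 (h x hx)).le
      have a2 := (le_abs_self _).trans (h3 x hx)
      have a3 : A ^ 2 ≤ iteratedDeriv 2 g x ^ 2 := by
        rw [← sq_abs (iteratedDeriv 2 g x)]
        exact pow_le_pow_left₀ hA.le (h2 x hx) 2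
      have a4 := mul_le_mul_of_nonneg_left a2 (hp x hx).le
      have a5 := mul_le_mul_of_nonneg_right a1 hB
      linarith
  intro g u v hg huvl h2 h2B h3
  have hd1 : ∀ z, HasDerivAt (deriv g) (iteratedDeriv 2 g z) z := fun z => by
    simpa [iteratedDeriv_one] using hasDerivAt_iteratedDeriv hg 1 z
  have hd0 : ∀ z ∈ Ioo u v, iteratedDeriv 2 g z ≠ 0 := fun z hz =>
    abs_pos.1 (hA.trans_le (h2 z hz))
  refine CrossGood.of_split (φ := deriv g) 0 hd1 hd0 fun u1 v1 hu1 hv1 hn1 => ?_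
  refine CrossGood.of_split (φ := deriv g) c hd1
    (fun z hz => hd0 z (Ioo_subset_Ioo hu1 hv1 hz)) fun u2 v2 hu2 hv2 hn2 => ?_
  refine CrossGood.of_split (φ := deriv g) (-c) hd1 (fun z hz => hd0 z (Ioo_subset_Ioo hu1 hv1
    (Ioo_subset_Ioo hu2 hv2 hz))) fun u3 v3 hu3 hv3 hn3 => ?_
  have s2 : Ioo u3 v3 ⊆ Ioo u2 v2 := Ioo_subset_Ioo hu3 hv3
  have s1 : Ioo u3 v3 ⊆ Ioo u1 v1 := s2.trans (Ioo_subset_Ioo hu2 hv2)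
  have s0 : Ioo u3 v3 ⊆ Ioo u v := s1.trans (Ioo_subset_Ioo hu1 hv1)
  rcases pos_or_neg_of_ne_zero (u := u3) (v := v3)
    (by simpa using continuous_iteratedDeriv_of_smooth hg 1) (fun x hx => hn1 x (s1 hx)) with h | h
  · exact key g u3 v3 hg (by linarith) (fun x hx => h2 x (s0 hx)) (fun x hx => h2B x (s0 hx))
      (fun x hx => h3 x (s0 hx)) h fun x hx => hn2 x (s2 hx)
  · apply CrossGood.of_neg
    refine key _ u3 v3 hg.neg (by linarith) (fun x hx => ?_) (fun x hx => ?_) (fun x hx => ?_)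
      (fun x hx => ?_) (fun x hx => ?_)
    · rw [iteratedDeriv_neg_eq, abs_neg]; exact h2 x (s0 hx)
    · rw [iteratedDeriv_neg_eq, abs_neg]; exact h2B x (s0 hx)
    · rw [iteratedDeriv_neg_eq, abs_neg]; exact h3 x (s0 hx)
    · rw [deriv.fun_neg]; exact neg_pos.2 (h x hx)
    · rw [deriv.fun_neg]
      exact fun h4 => hn3 x hx (by linarith)

lemma exists_crossGood_of_deriv {A B l : ℝ} (hA : 0 < A) (hB : 0 ≤ B) (hl : 0 ≤ l) (n : ℕ)
    (hn : 1 ≤ n) :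
    ∃ (K : ℕ) (M : ℝ), ∀ (g : ℝ → ℝ) (u v : ℝ), ContDiff ℝ ∞ g → v - u ≤ l →
      (∀ x ∈ Ioo u v, |iteratedDeriv 2 g x| ≤ B) → (∀ x ∈ Ioo u v, |iteratedDeriv 3 g x| ≤ B) →
      (∀ x ∈ Ioo u v, A ≤ |iteratedDeriv n g x|) →
      (∀ x ∈ Ioo u v, ∀ y ∈ Ioo u v, |iteratedDeriv n g x| ≤ 5 / 4 * |iteratedDeriv n g y|) →
      CrossGood g K M u v := by
  obtain rfl | rfl | h3 : n = 1 ∨ n = 2 ∨ 3 ≤ n := by omega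
  · refine ⟨0, 2 * (B / A) * l, fun g u v hg huvl h2 _ h1 _ => ?_⟩
    rcases le_or_gt v u with huv | huv
    · exact (CrossGood.of_le g huv).mono le_rfl (by positivity)
    · exact (CrossGood.of_abs_lipschitz hg hA hB huv.le (by simpa using h1) h2).mono le_rfl
        (mul_le_mul_of_nonneg_left huvl (by positivity))
  · obtain ⟨K, M, h⟩ := exists_crossGood_of_second_deriv hA hB hl
    exact ⟨K, M, fun g u v hg huvl h2 h3 hA2 _ => h g u v hg huvl hA2 h2 h3⟩
  · obtain ⟨K, M, h⟩ := exists_crossGood_of_derivs_ne_zero n h3 (n - 1) (by omega)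
    refine ⟨K, M, fun g u v hg _ _ _ hAn hr => h g u v hg (fun j hj hjn x hx => ?_) hr⟩
    rw [show j = n by omega]
    exact abs_pos.1 (hA.trans_le (hAn x hx))

/-- Quantitative control of a self-map of `[a,b]` with non-flat critical points: on short
intervals some derivative of order at most `N` is bounded below and almost constant. -/
structure Tame (g : ℝ → ℝ) (a b A B lam : ℝ) (N : ℕ) : Prop where
  smooth : ContDiff ℝ ∞ g
  mapsTo : MapsTo g (Icc a b) (Icc a b)
  bound : ∀ i, 1 ≤ i → i ≤ 3 → ∀ x ∈ Icc a b, |iteratedDeriv i g x| ≤ B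
  nondeg : ∀ u v, a ≤ u → v ≤ b → v - u ≤ lam → ∃ n, 1 ≤ n ∧ n ≤ N ∧
    (∀ x ∈ Icc u v, A ≤ |iteratedDeriv n g x|) ∧
    ∀ x ∈ Icc u v, ∀ y ∈ Icc u v, |iteratedDeriv n g x| ≤ 5 / 4 * |iteratedDeriv n g y|

lemma exists_crossGood_of_tame {a b A B lam : ℝ} (hA : 0 < A) (hB : 0 ≤ B)
    (hlam : 0 < lam) (N : ℕ) :
    ∃ (K : ℕ) (M : ℝ), ∀ g, Tame g a b A B lam N → CrossGood g K M a b := by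
  choose K M hKM using fun n : ℕ =>
    exists_crossGood_of_deriv hA hB hlam.le (n + 1) (Nat.le_add_left 1 n)
  set K0 := ∑ n ∈ Finset.range N, K n with hK0
  set M0 := ∑ n ∈ Finset.range N, |M n| with hM0
  obtain ⟨k, hk⟩ := exists_nat_ge ((b - a) / lam)
  rw [div_le_iff₀ hlam] at hk
  refine ⟨k * (K0 + 1), k * M0, fun g hg => ?_⟩
  have short : ∀ u v, a ≤ u → v ≤ b → v - u ≤ lam → CrossGood g K0 M0 u v := by
    intro u v hu hv huv
    obtain ⟨n, hn1, hnN, hnA, hnr⟩ := hg.nondeg u v hu hv huv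
    obtain ⟨n, rfl⟩ := Nat.exists_eq_add_of_le' hn1
    have hsub : Ioo u v ⊆ Icc a b := fun x hx => ⟨hu.trans hx.1.le, hx.2.le.trans hv⟩
    refine (hKM n g u v hg.smooth huv (fun x hx => hg.bound 2 (by norm_num) (by norm_num) x (hsub hx))
      (fun x hx => hg.bound 3 (by norm_num) (by norm_num) x (hsub hx))
      (fun x hx => hnA x (Ioo_subset_Icc_self hx)) (fun x hx y hy => hnr x (Ioo_subset_Icc_self hx) y
      (Ioo_subset_Icc_self hy))).mono ?_ ?_
    · exact Finset.single_le_sum (fun _ _ => Nat.zero_le _) (Finset.mem_range.2 (by omega))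
    · exact (le_abs_self _).trans (Finset.single_le_sum (f := fun n => |M n|)
        (fun _ _ => abs_nonneg _) (Finset.mem_range.2 (by omega)))
  have long : ∀ j : ℕ, CrossGood g (j * (K0 + 1)) (j * M0) a (min b (a + j * lam)) := by
    intro j
    induction j with
    | zero =>
      simpa using CrossGood.of_le g (u := a) (v := min b a) (min_le_right _ _)
    | succ j ih =>
      have h1 := short (max a (a + j * lam)) (min b (a + (j + 1 : ℕ) * lam)) (le_max_left _ _)
        (min_le_left _ _) (by
          have h1 := min_le_right b (a + (j + 1 : ℕ) * lam)
          have h2 := le_max_right a (a + j * lam)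
          push_cast at h1 h2 ⊢
          linarith)
      have hmax : max a (a + j * lam) = a + j * lam := max_eq_right (by
        have : 0 ≤ (j : ℝ) * lam := by positivity
        linarith)
      rw [hmax] at h1
      rcases le_or_gt b (a + j * lam) with hb | hb
      · rw [min_eq_left hb] at ih
        have : min b (a + (j + 1 : ℕ) * lam) = b := min_eq_left (by push_cast; linarith)
        rw [this]
        refine ih.mono (Nat.mul_le_mul_right _ (by omega)) ?_
        push_cast
        have : 0 ≤ M0 := Finset.sum_nonneg fun _ _ => abs_nonneg _
        linarith
      · rw [min_eq_right hb.le] at ih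
        refine (ih.union h1).mono (le_of_eq (by ring)) ?_
        push_cast
        linarith
  have := long k
  rwa [min_eq_left (by linarith)] at this

lemma exists_tame_nhds {a b : ℝ} (hab : a < b) {f : ℝ → ℝ} (hf : ∀ n : ℕ, ContDiff ℝ n f)
    (hnf : ∀ c ∈ Icc a b, deriv f c = 0 → ∃ d : ℕ, 2 ≤ d ∧ iteratedDeriv d f c ≠ 0) :
    ∃ (k : ℕ) (η A B lam : ℝ) (N : ℕ), 0 < η ∧ 0 < A ∧ 0 < B ∧ 0 < lam ∧ 1 ≤ N ∧ ∀ g : ℝ → ℝ,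
      (∀ n : ℕ, ContDiff ℝ n g) → MapsTo g (Icc a b) (Icc a b) → CkClose k f g (Icc a b) η →
        Tame g a b A B lam N := by
  have hfs : ContDiff ℝ ∞ f := contDiff_infty.2 hf
  have hcont := continuous_iteratedDeriv_of_smooth hfs
  have hex : ∀ x : ℝ, ∃ n, 1 ≤ n ∧ (x ∈ Icc a b → iteratedDeriv n f x ≠ 0) := by
    intro x
    by_cases hx : x ∈ Icc a b
    · by_cases h0 : deriv f x = 0
      · obtain ⟨d, hd, hd0⟩ := hnf x hx h0
        exact ⟨d, by omega, fun _ => hd0⟩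
      · exact ⟨1, le_rfl, fun _ => by simpa using h0⟩
    · exact ⟨1, le_rfl, fun h => absurd h hx⟩
  choose n hn1 hn0 using hex
  let U : ℝ → Set ℝ := fun x =>
    {y | |iteratedDeriv (n x) f y - iteratedDeriv (n x) f x| < |iteratedDeriv (n x) f x| / 20}
  have hUo : ∀ x, IsOpen (U x) := fun x =>
    isOpen_lt (((hcont _).sub continuous_const).abs) continuous_const
  obtain ⟨t, ht, htU⟩ := (isCompact_Icc (a := a) (b := b)).elim_nhds_subcover U fun x hx =>
    (hUo x).mem_nhds (by
      have := abs_pos.2 (hn0 x hx)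
      simp only [U, mem_ofPred_eq, sub_self, abs_zero]
      positivity)
  have htne : t.Nonempty := by
    have := htU (left_mem_Icc.2 hab.le)
    simp only [mem_iUnion] at this
    obtain ⟨x, hx, _⟩ := this
    exact ⟨x, hx⟩
  obtain ⟨δ, hδ, hleb⟩ := lebesgue_number_lemma_of_metric (s := Icc a b) isCompact_Icc
    (c := fun x : t => U x) (fun x => hUo x) (fun x hx => by
      have := htU hx
      simp only [mem_iUnion] at this ⊢
      obtain ⟨y, hy, h⟩ := this
      exact ⟨⟨y, hy⟩, h⟩)
  obtain ⟨z, hz, hzmin⟩ := t.exists_min_image (fun x => |iteratedDeriv (n x) f x|) htne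
  set w := |iteratedDeriv (n z) f z| with hw
  have hw0 : 0 < w := abs_pos.2 (hn0 z (ht z hz))
  have hbd : ∀ i, ∃ C, ∀ x ∈ Icc a b, |iteratedDeriv i f x| ≤ C := fun i => by
    obtain ⟨C, hC⟩ := (isCompact_Icc (a := a) (b := b)).exists_bound_of_continuousOn
      (hcont i).continuousOn
    exact ⟨C, hC⟩
  choose D hD using hbd
  refine ⟨t.sup n + 3, w / 20, 9 / 10 * w, |D 1| + |D 2| + |D 3| + w / 20, δ / 2, t.sup n,
    by positivity, by positivity, by positivity, by positivity,
    (hn1 z).trans (Finset.le_sup (f := n) hz), fun g hg hmaps hclose => ?_⟩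
  refine ⟨contDiff_infty.2 hg, hmaps, fun i h1 h3 x hx => ?_, fun u v hu hv huv => ?_⟩
  · have a1 := hclose i (by omega) x hx
    have a2 := (hD i x hx).trans (le_abs_self _)
    have a3 : |D i| ≤ |D 1| + |D 2| + |D 3| := by
      have b1 := abs_nonneg (D 1)
      have b2 := abs_nonneg (D 2)
      have b3 := abs_nonneg (D 3)
      interval_cases i <;> linarith
    have := abs_sub_abs_le_abs_sub (iteratedDeriv i g x) (iteratedDeriv i f x)
    linarith
  · rcases lt_or_ge v u with hlt | hle
    · refine ⟨n z, hn1 z, Finset.le_sup (f := n) hz, fun x hx => ?_, fun x hx => ?_⟩ <;>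
        exact absurd (hx.1.trans hx.2) (not_le.2 hlt)
    obtain ⟨⟨y, hy⟩, hyU⟩ := hleb u ⟨hu, hle.trans hv⟩
    have hsub : ∀ x ∈ Icc u v, x ∈ U y := fun x hx => hyU (by
      rw [Metric.mem_ball, Real.dist_eq, abs_of_nonneg (sub_nonneg.2 hx.1)]
      linarith [hx.2])
    have hyn : n y ≤ t.sup n := Finset.le_sup hy
    set W := |iteratedDeriv (n y) f y| with hW
    have hwW : w ≤ W := hzmin y hy
    have key : ∀ x ∈ Icc u v, 9 / 10 * W ≤ |iteratedDeriv (n y) g x| ∧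
        |iteratedDeriv (n y) g x| ≤ 11 / 10 * W := by
      intro x hx
      have a1 := hclose (n y) (by omega) x ⟨hu.trans hx.1, hx.2.trans hv⟩
      have a2 : |iteratedDeriv (n y) f x - iteratedDeriv (n y) f y| < W / 20 := hsub x hx
      have a3 := abs_sub_le (iteratedDeriv (n y) g x) (iteratedDeriv (n y) f x)
        (iteratedDeriv (n y) f y)
      have a4 := abs_sub_abs_le_abs_sub (iteratedDeriv (n y) g x) (iteratedDeriv (n y) f y)
      have a5 := abs_sub_abs_le_abs_sub (iteratedDeriv (n y) f y) (iteratedDeriv (n y) g x)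
      rw [abs_sub_comm] at a5
      constructor <;> linarith
    refine ⟨n y, hn1 y, hyn, fun x hx => ?_, fun x hx x' hx' => ?_⟩
    · linarith [(key x hx).1]
    · linarith [(key x hx).2, (key x' hx').1]

/-- The function `φ` varies by a factor at most `5/4` in absolute value on `[u,v]`. -/
def AlmostConst (φ : ℝ → ℝ) (u v : ℝ) : Prop :=
  ∀ x ∈ Icc u v, ∀ y ∈ Icc u v, |φ x| ≤ 5 / 4 * |φ y|

lemma AlmostConst.mono {φ : ℝ → ℝ} {u v u' v' : ℝ} (h : AlmostConst φ u v) (hu : u ≤ u')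
    (hv : v' ≤ v) : AlmostConst φ u' v' := fun x hx y hy =>
  h x (Icc_subset_Icc hu hv hx) y (Icc_subset_Icc hu hv hy)

lemma abs_sub_le_of_deriv_le {F F' : ℝ → ℝ} {u v c : ℝ} (hd : ∀ z, HasDerivAt F (F' z) z)
    (hb : ∀ z ∈ Icc u v, |F' z| ≤ c) {x y : ℝ} (hx : x ∈ Icc u v) (hy : y ∈ Icc u v) :
    |F y - F x| ≤ c * |y - x| :=
  (convex_Icc u v).norm_image_sub_le_of_norm_hasDerivWithin_le
    (fun z _ => (hd z).hasDerivWithinAt) hb hx hy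

/-- A Markov type inequality. -/
lemma exists_markov_const (n : ℕ) : ∃ C : ℝ, 1 ≤ C ∧ ∀ (φ : ℕ → ℝ → ℝ) (u v s : ℝ),
    (∀ k x, HasDerivAt (φ k) (φ (k + 1) x) x) → u < v → AlmostConst (φ (n + 1)) u v →
    (∀ x ∈ Icc u v, |φ 0 x| ≤ s) → ∀ x ∈ Icc u v, |φ 1 x| * (v - u) ≤ C * s := by
  induction n with
  | zero =>
    refine ⟨5 / 2, by norm_num, fun φ u v s hd huv hac hs x hx => ?_⟩
    obtain ⟨ξ, hξ, e⟩ := exists_hasDerivAt_eq_slope (φ 0) (φ 1) huv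
      (fun t _ => (hd 0 t).continuousAt.continuousWithinAt) (fun t _ => hd 0 t)
    have hl : 0 < v - u := sub_pos.2 huv
    rw [eq_div_iff hl.ne'] at e
    have h1 := hac x hx ξ (Ioo_subset_Icc_self hξ)
    have h2 : |φ 1 ξ| * (v - u) ≤ 2 * s := by
      rw [← abs_of_pos hl, ← abs_mul, e]
      have a1 := abs_le.1 (hs v ⟨huv.le, le_rfl⟩)
      have a2 := abs_le.1 (hs u ⟨le_rfl, huv.le⟩)
      exact abs_le.2 ⟨by linarith, by linarith⟩
    have h3 := mul_le_mul_of_nonneg_right h1 hl.le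
    simp only [zero_add] at h3
    linarith
  | succ n ih =>
    obtain ⟨C, hC, h⟩ := ih
    refine ⟨8 * C, by linarith, fun φ u v s hd huv hac hs x hx => ?_⟩
    have hl : 0 < v - u := sub_pos.2 huv
    have hC0 : 0 < C := by linarith
    obtain ⟨x0, hx0, hmax⟩ := isCompact_Icc.exists_isMaxOn (nonempty_Icc.2 huv.le)
      (f := fun x => |φ 1 x|) fun t _ => (hd 1 t).continuousAt.continuousWithinAt.abs
    set P := |φ 1 x0| with hP
    have hPmax : ∀ y ∈ Icc u v, |φ 1 y| ≤ P := fun y hy => hmax hy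
    have hφ2 := h (fun k => φ (k + 1)) u v P (fun k x => hd (k + 1) x) huv hac hPmax
    have hφ2' : ∀ y ∈ Icc u v, |φ 2 y| ≤ C * P / (v - u) := fun y hy => by
      rw [le_div_iff₀ hl]; exact hφ2 y hy
    set l' := (v - u) / (2 * C) with hl'
    have hl'0 : 0 < l' := by positivity
    have hl'2 : 2 * l' ≤ v - u := by
      rw [hl', mul_div_assoc', div_le_iff₀ (by positivity)]
      nlinarith
    have hsmall : ∀ y ∈ Icc u v, |y - x0| ≤ l' → P / 2 ≤ |φ 1 y| := by
      intro y hy hyx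
      have h1 := abs_sub_le_of_deriv_le (hd 1) hφ2' hx0 hy
      have h2 : C * P / (v - u) * |y - x0| ≤ P / 2 := by
        refine (mul_le_mul_of_nonneg_left hyx (by positivity)).trans_eq ?_
        rw [hl']
        field_simp
      have h3 := abs_sub_abs_le_abs_sub (φ 1 x0) (φ 1 y)
      rw [abs_sub_comm] at h3
      linarith
    have fin : ∀ p q, u ≤ p → q ≤ v → q - p = l' → (∀ y ∈ Icc p q, |y - x0| ≤ l') →
        P * l' ≤ 4 * s := by
      intro p q hp hq hpq hy
      obtain ⟨ξ, hξ, e⟩ := exists_hasDerivAt_eq_slope (φ 0) (φ 1) (show p < q by linarith)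
        (fun t _ => (hd 0 t).continuousAt.continuousWithinAt) (fun t _ => hd 0 t)
      rw [hpq, eq_div_iff hl'0.ne'] at e
      have a0 := hsmall ξ ⟨hp.trans hξ.1.le, hξ.2.le.trans hq⟩ (hy ξ (Ioo_subset_Icc_self hξ))
      have a1 := abs_le.1 (hs q ⟨by linarith, hq⟩)
      have a2 := abs_le.1 (hs p ⟨hp, by linarith⟩)
      have a3 : |φ 1 ξ| * l' ≤ 2 * s := by
        rw [show |φ 1 ξ| * l' = |φ 1 ξ * l'| by rw [abs_mul, abs_of_pos hl'0], e]
        exact abs_le.2 ⟨by linarith, by linarith⟩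
      have a4 := mul_le_mul_of_nonneg_right a0 hl'0.le
      linarith
    have key : P * l' ≤ 4 * s := by
      rcases le_or_gt (x0 + l') v with h1 | h1
      · refine fin x0 (x0 + l') hx0.1 h1 (by ring) fun y hy => ?_
        rw [abs_of_nonneg (by linarith [hy.1])]
        linarith [hy.2]
      · refine fin (x0 - l') x0 (by linarith) hx0.2 (by ring) fun y hy => ?_
        rw [abs_of_nonpos (by linarith [hy.2])]
        linarith [hy.1]
    have h5 : P * (v - u) = 2 * C * (P * l') := by
      rw [hl']
      field_simp
    calc |φ 1 x| * (v - u) ≤ P * (v - u) := mul_le_mul_of_nonneg_right (hPmax x hx) hl.le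
      _ = 2 * C * (P * l') := h5
      _ ≤ 2 * C * (4 * s) := mul_le_mul_of_nonneg_left key (by positivity)
      _ = 8 * C * s := by ring

/-- A Remez type inequality. -/
lemma exists_remez_const (n : ℕ) : ∃ C : ℝ, 1 ≤ C ∧ ∀ (φ : ℕ → ℝ → ℝ) (u v u' v' s : ℝ),
    (∀ k x, HasDerivAt (φ k) (φ (k + 1) x) x) → u ≤ u' → u' < v' → v' ≤ v →
    AlmostConst (φ n) u v → (∀ x ∈ Icc u' v', |φ 0 x| ≤ s) →
    ∀ x ∈ Icc u v, |φ 0 x| ≤ C * ((v - u) / (v' - u')) ^ n * s := by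
  induction n with
  | zero =>
    refine ⟨5 / 4, by norm_num, fun φ u v u' v' s hd hu huv hv hac hs x hx => ?_⟩
    have h1 := hac x hx u' ⟨hu, by linarith⟩
    have h2 := hs u' ⟨le_rfl, huv.le⟩
    simp only [pow_zero, mul_one]
    linarith
  | succ n ih =>
    obtain ⟨C, hC, h⟩ := ih
    obtain ⟨D, hD, hM⟩ := exists_markov_const n
    refine ⟨1 + C * D, by nlinarith, fun φ u v u' v' s hd hu huv hv hac hs x hx => ?_⟩
    have hl' : 0 < v' - u' := sub_pos.2 huv
    have hu' : u' ∈ Icc u v := ⟨hu, by linarith⟩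
    have hs0 : 0 ≤ s := (abs_nonneg _).trans (hs u' ⟨le_rfl, huv.le⟩)
    have hr : 1 ≤ (v - u) / (v' - u') := by
      rw [one_le_div hl']
      linarith
    set r := (v - u) / (v' - u') with hrdef
    have h1 := h (fun k => φ (k + 1)) u v u' v' (D * s / (v' - u')) (fun k x => hd (k + 1) x)
      hu huv hv hac fun y hy => by
        rw [le_div_iff₀ hl']
        exact hM φ u' v' s hd huv (hac.mono hu hv) hs y hy
    have h2 := abs_sub_le_of_deriv_le (hd 0) h1 hu' hx
    have h3 : |x - u'| ≤ v - u := abs_le.2 ⟨by linarith [hx.1], by linarith [hx.2]⟩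
    have h4 := hs u' ⟨le_rfl, huv.le⟩
    have h5 : |φ 0 x| ≤ |φ 0 u'| + |φ 0 x - φ 0 u'| := by
      have := abs_sub_abs_le_abs_sub (φ 0 x) (φ 0 u')
      linarith
    have h6 : C * r ^ n * (D * s / (v' - u')) * |x - u'| ≤ C * D * r ^ (n + 1) * s := by
      have hC0 : 0 ≤ C := by linarith
      have hD0 : 0 ≤ D := by linarith
      have hr0 : 0 ≤ r := by linarith
      refine (mul_le_mul_of_nonneg_left h3 (by positivity)).trans_eq ?_
      rw [pow_succ, hrdef]
      field_simp
    have h7 : s ≤ r ^ (n + 1) * s := le_mul_of_one_le_left hs0 (one_le_pow₀ hr)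
    linarith

lemma exists_lower_const (n : ℕ) : ∃ C : ℝ, 1 ≤ C ∧ ∀ (φ : ℕ → ℝ → ℝ) (u v s A : ℝ),
    (∀ k x, HasDerivAt (φ k) (φ (k + 1) x) x) → u < v → AlmostConst (φ n) u v →
    (∀ x ∈ Icc u v, A ≤ |φ n x|) → (∀ x ∈ Icc u v, |φ 0 x| ≤ s) → A * (v - u) ^ n ≤ C * s := by
  induction n with
  | zero =>
    refine ⟨1, le_rfl, fun φ u v s A hd huv hac hA hs => ?_⟩
    have hu : u ∈ Icc u v := ⟨le_rfl, huv.le⟩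
    simpa using (hA u hu).trans (hs u hu)
  | succ n ih =>
    obtain ⟨C, hC, h⟩ := ih
    obtain ⟨D, hD, hM⟩ := exists_markov_const n
    refine ⟨C * D, by nlinarith, fun φ u v s A hd huv hac hA hs => ?_⟩
    have hl : 0 < v - u := sub_pos.2 huv
    have := h (fun k => φ (k + 1)) u v (D * s / (v - u)) A (fun k x => hd (k + 1) x) huv hac hA
      fun y hy => by
        rw [le_div_iff₀ hl]
        exact hM φ u v s hd huv hac hs y hy
    rw [mul_div_assoc', le_div_iff₀ hl] at this
    rw [pow_succ]
    linarith

/-- Common constants for maps with an almost constant derivative of order at most `N`. -/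
lemma exists_polynomial_like_const (N : ℕ) : ∃ C : ℝ, 1 ≤ C ∧
    ∀ (φ : ℕ → ℝ → ℝ) (n : ℕ) (u v s A : ℝ), 1 ≤ n → n ≤ N →
      (∀ k x, HasDerivAt (φ k) (φ (k + 1) x) x) → u < v → AlmostConst (φ n) u v → 0 ≤ s →
      ((∀ x ∈ Icc u v, |φ 0 x| ≤ s) → ∀ x ∈ Icc u v, |φ 1 x| * (v - u) ≤ C * s) ∧
      (∀ u' v', u ≤ u' → u' < v' → v' ≤ v → (∀ x ∈ Icc u' v', |φ 0 x| ≤ s) →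
        ∀ x ∈ Icc u v, |φ 0 x| ≤ C * ((v - u) / (v' - u')) ^ n * s) ∧
      ((∀ x ∈ Icc u v, A ≤ |φ n x|) → (∀ x ∈ Icc u v, |φ 0 x| ≤ s) →
        A * (v - u) ^ n ≤ C * s) := by
  choose C1 h1 H1 using exists_markov_const
  choose C2 h2 H2 using exists_remez_const
  choose C3 h3 H3 using exists_lower_const
  set D : ℕ → ℝ := fun n => C1 n + C2 (n + 1) + C3 (n + 1) with hDdef
  have hD0 : ∀ n, 0 ≤ D n := fun n => by
    have a1 := h1 n
    have a2 := h2 (n + 1)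
    have a3 := h3 (n + 1)
    simp only [hDdef]
    linarith
  refine ⟨1 + ∑ n ∈ Finset.range N, D n, ?_, ?_⟩
  · have := Finset.sum_nonneg (s := Finset.range N) fun n _ => hD0 n
    linarith
  intro φ n u v s A hn1 hnN hd huv hac hs0
  obtain ⟨n, rfl⟩ := Nat.exists_eq_add_of_le' hn1
  have hle : D n ≤ 1 + ∑ n ∈ Finset.range N, D n := by
    have := Finset.single_le_sum (f := D) (fun n _ => hD0 n)
      (Finset.mem_range.2 (show n < N by omega))
    linarith
  have a1 := h1 n
  have a2 := h2 (n + 1)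
  have a3 := h3 (n + 1)
  simp only [hDdef] at hle
  refine ⟨fun hs x hx => ?_, fun u' v' hu huv' hv hs x hx => ?_, fun hA hs => ?_⟩
  · exact (H1 n φ u v s hd huv hac hs x hx).trans
      (mul_le_mul_of_nonneg_right (by linarith) hs0)
  · refine (H2 (n + 1) φ u v u' v' s hd hu huv' hv hac hs x hx).trans
      (mul_le_mul_of_nonneg_right (mul_le_mul_of_nonneg_right (by linarith) ?_) hs0)
    have : 0 ≤ v - u := by linarith
    have : 0 ≤ v' - u' := by linarith
    positivity
  · exact (H3 (n + 1) φ u v s A hd huv hac hA hs).trans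
      (mul_le_mul_of_nonneg_right (by linarith) hs0)

/-- If `I = [u,v]` is the union of two adjacent intervals, one of them `[j₁,j₂]` and the other
one with endpoints `e` and `p`, where `p` is the common endpoint, then the ratio of their lengths
is controlled by the ratio of the lengths of their images. -/
lemma exists_ratio_const {a b A B lam : ℝ} {N : ℕ} (hab : a < b) (hA : 0 < A) (hB : 0 < B)
    (hlam : 0 < lam) : ∃ C : ℝ, 1 ≤ C ∧ ∀ g, Tame g a b A B lam N →
    ∀ u v j₁ j₂ e p l s : ℝ, a ≤ u → v ≤ b → u ≤ j₁ → j₁ < j₂ → j₂ ≤ v → e ∈ Icc u v →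
      p ∈ Icc u v → |e - p| = l → 0 < l → l + (j₂ - j₁) = v - u → 0 ≤ s →
      (∀ x ∈ Icc u v, |g x - g p| ≤ |g e - g p| + s) → (∀ x ∈ Icc j₁ j₂, |g x - g p| ≤ s) →
      (j₂ - j₁) / l * |g e - g p| ≤ C * s ∨ ((j₂ - j₁) / l) ^ N * |g e - g p| ≤ C * s := by
  obtain ⟨C, hC, H⟩ := exists_polynomial_like_const N
  set c := min 1 (lam / 2) ^ N with hc
  have hc0 : 0 < c := pow_pos (lt_min one_pos (by linarith)) _
  have hcn : ∀ n ≤ N, c ≤ (lam / 2) ^ n := fun n hn =>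
    (pow_le_pow_of_le_one (le_min zero_le_one (by linarith)) (min_le_left _ _) hn).trans
      (pow_le_pow_left₀ (le_min zero_le_one (by linarith)) (min_le_right _ _) n)
  set C₁ := B * (b - a) * C / (A * c) with hC₁
  have hba : 0 < b - a := sub_pos.2 hab
  have hC₁0 : 0 ≤ C₁ := by positivity
  have hC20 : 0 ≤ C * (2 * C) ^ N := by positivity
  refine ⟨2 * C + C * (2 * C) ^ N + C₁, by linarith, ?_⟩
  intro g hg u v j₁ j₂ e p l s hu hv hj₁ hj hj₂ he hp hl hl0 hlj hs hI hJ
  set j := j₂ - j₁ with hjdef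
  have hj0 : 0 < j := sub_pos.2 hj
  set G := |g e - g p| with hG
  have hG0 : 0 ≤ G := abs_nonneg _
  have huv : u < v := by linarith
  set φ : ℕ → ℝ → ℝ := fun k => if k = 0 then fun z => g z - g p else iteratedDeriv k g with hφ
  have hd : ∀ k x, HasDerivAt (φ k) (φ (k + 1) x) x := by
    rintro (_ | k) x
    · have := hasDerivAt_iteratedDeriv hg.smooth 0 x
      rw [iteratedDeriv_zero] at this
      simpa [hφ] using this.sub_const (g p)
    · simpa [hφ] using hasDerivAt_iteratedDeriv hg.smooth (k + 1) x
  have hφ1 : ∀ n, 1 ≤ n → φ n = iteratedDeriv n g := fun n hn => by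
    simp [hφ, Nat.one_le_iff_ne_zero.1 hn]
  have hyp : 0 < j / l := div_pos hj0 hl0
  have hmvt : ∀ c', (∀ z ∈ Icc u v, |φ 1 z| ≤ c') → G ≤ c' * l := fun c' h => by
    have := abs_sub_le_of_deriv_le (hd 0) h hp he
    simpa [hφ, hl] using this
  have hGB : G ≤ B * l := hmvt B fun z hz => by
    rw [hφ1 1 le_rfl]
    exact hg.bound 1 le_rfl (by norm_num) z (Icc_subset_Icc hu hv hz)
  have hlower : ∀ u' v' : ℝ, u ≤ u' → v' ≤ v → u' < v' → v' - u' ≤ lam →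
      Icc u' v' ⊆ Icc j₁ j₂ → ∃ n, n ≤ N ∧ A * (v' - u') ^ n ≤ C * s := by
    intro u' v' hu' hv' huv' hlen hsub
    obtain ⟨n, hn1, hnN, hlow, hac⟩ := hg.nondeg u' v' (hu.trans hu') (hv'.trans hv) hlen
    refine ⟨n, hnN, (H φ n u' v' s A hn1 hnN hd huv' ?_ hs).2.2 ?_ fun x hx => ?_⟩
    · rw [hφ1 n hn1]
      exact hac
    · rw [hφ1 n hn1]
      exact hlow
    · simpa [hφ] using hJ x (hsub hx)
  rcases le_or_gt (v - u) lam with hshort | hlong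
  · obtain ⟨n, hn1, hnN, hlow, hac⟩ := hg.nondeg u v hu hv hshort
    have hac' : AlmostConst (φ n) u v := by
      rw [hφ1 n hn1]
      exact hac
    have markov := (H φ n u v (G + s) A hn1 hnN hd huv hac' (by linarith)).1
      fun x hx => by simpa [hφ] using hI x hx
    have hl1 : G * (l + j) ≤ C * l * (G + s) := by
      have := hmvt (C * (G + s) / (v - u)) fun z hz => by
        rw [le_div_iff₀ (by linarith)]
        exact markov z hz
      rw [div_mul_eq_mul_div, le_div_iff₀ (by linarith), ← hlj] at this
      linarith
    rcases le_or_gt (2 * C * l) (l + j) with h | h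
    · left
      have h1 : j / l * G ≤ 2 * C * s := by
        rw [div_mul_eq_mul_div, div_le_iff₀ hl0]
        nlinarith
      nlinarith
    · right
      have remez := (H φ n u v s A hn1 hnN hd huv hac' hs).2.1 j₁ j₂ hj₁ hj hj₂
        (fun x hx => by simpa [hφ] using hJ x hx) e he
      have hy : j / l ≤ 2 * C := by
        rw [div_le_iff₀ hl0]
        linarith
      have h1 : G ≤ C * ((l + j) / j) ^ n * s := by
        rw [hlj]
        simpa [hφ] using remez
      have h2 : (j / l) ^ n * G ≤ C * (2 * C) ^ n * s := by
        calc (j / l) ^ n * G ≤ (j / l) ^ n * (C * ((l + j) / j) ^ n * s) := by gcongr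
          _ = C * ((l + j) / l) ^ n * s := by
            have : (l + j) / l = (j / l) * ((l + j) / j) := by
              field_simp
            rw [this, mul_pow]
            ring
          _ ≤ C * (2 * C) ^ n * s := by
            gcongr
            rw [div_le_iff₀ hl0]
            exact h.le
      calc (j / l) ^ N * G = (j / l) ^ (N - n) * ((j / l) ^ n * G) := by
            rw [← mul_assoc, ← pow_add, Nat.sub_add_cancel hnN]
        _ ≤ (2 * C) ^ (N - n) * (C * (2 * C) ^ n * s) := by gcongr
        _ = C * (2 * C) ^ N * s := by
            nth_rewrite 2 [← Nat.sub_add_cancel hnN]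
            rw [pow_add]
            ring
        _ ≤ _ := by
            gcongr
            linarith
  · have hfin : c * A ≤ C * s → B * (b - a) ≤ C₁ * s := by
      intro h
      rw [hC₁, div_mul_eq_mul_div, le_div_iff₀ (by positivity)]
      nlinarith [mul_pos hB hba]
    rcases le_or_gt (lam / 2) j with h | h
    · left
      obtain ⟨n, hnN, h1⟩ := hlower j₁ (j₁ + lam / 2) hj₁ (by linarith) (by linarith)
        (by linarith) (Icc_subset_Icc le_rfl (by linarith))
      rw [add_sub_cancel_left] at h1
      have h2 : B * (b - a) ≤ C₁ * s := hfin (by nlinarith [hcn n hnN])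
      have h3 : j / l * G ≤ B * (b - a) := by
        rw [div_mul_eq_mul_div, div_le_iff₀ hl0]
        nlinarith [mul_le_mul_of_nonneg_left hGB hj0.le,
          mul_le_mul_of_nonneg_left (show j ≤ b - a by linarith) (mul_pos hB hl0).le]
      nlinarith
    · right
      obtain ⟨n, hnN, h1⟩ := hlower j₁ j₂ hj₁ hj₂ hj (by linarith) le_rfl
      have hy1 : j / l ≤ 1 := by
        rw [div_le_iff₀ hl0]
        linarith
      have h2 : lam / 2 * (j / l) ≤ j := by
        rw [mul_div_assoc', div_le_iff₀ hl0]
        nlinarith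
      have h3 : c * (j / l) ^ N ≤ j ^ n :=
        calc c * (j / l) ^ N ≤ (lam / 2) ^ n * (j / l) ^ n :=
              mul_le_mul (hcn n hnN) (pow_le_pow_of_le_one hyp.le hy1 hnN) (by positivity)
                (by positivity)
          _ = (lam / 2 * (j / l)) ^ n := (mul_pow _ _ _).symm
          _ ≤ j ^ n := by gcongr
      have h4 : G ≤ B * (b - a) := hGB.trans (mul_le_mul_of_nonneg_left (by linarith) hB.le)
      have h5 : (j / l) ^ N * G ≤ C₁ * s := by
        rw [hC₁, div_mul_eq_mul_div, le_div_iff₀ (by positivity)]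
        calc (j / l) ^ N * G * (A * c) = (A * (c * (j / l) ^ N)) * G := by ring
          _ ≤ (A * j ^ n) * (B * (b - a)) := by gcongr
          _ ≤ (C * s) * (B * (b - a)) := by gcongr
          _ = _ := by ring
      nlinarith

/-- Points are not separated by more than the endpoints under a monotone or antitone map. -/
lemma abs_sub_le_of_mem_uIcc {g : ℝ → ℝ} {u v p q x : ℝ}
    (h : StrictMonoOn g (Icc u v) ∨ StrictAntiOn g (Icc u v)) (hp : p ∈ Icc u v)
    (hq : q ∈ Icc u v) (hx : x ∈ uIcc p q) : |g x - g p| ≤ |g q - g p| := by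
  have hsub : uIcc p q ⊆ Icc u v := uIcc_subset_Icc hp hq
  apply abs_sub_left_of_mem_uIcc
  rcases h with h | h
  · exact (h.monotoneOn.mono hsub).mapsTo_uIcc hx
  · exact (h.antitoneOn.mono hsub).mapsTo_uIcc hx

lemma crossRatio_eq {t1 j1 j2 t2 : ℝ} (h1 : j1 - t1 ≠ 0) (h2 : t2 - j2 ≠ 0) :
    crossRatio t1 j1 j2 t2 = (j2 - j1) / (j1 - t1) + (j2 - j1) / (t2 - j2) +
      (j2 - j1) / (j1 - t1) * ((j2 - j1) / (t2 - j2)) := by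
  unfold crossRatio
  field_simp
  ring

/-- A modulus for ratios of lengths of adjacent intervals. -/
def ratioMod (C : ℝ) (N : ℕ) (x : ℝ) : ℝ := C * x + (C * x) ^ (1 / (N : ℝ))

lemma ratioMod_mono {C : ℝ} (hC : 0 ≤ C) (N : ℕ) {x y : ℝ} (hx : 0 ≤ x) (hxy : x ≤ y) :
    ratioMod C N x ≤ ratioMod C N y := by
  unfold ratioMod
  gcongr

lemma le_ratioMod {C : ℝ} (hC : 1 ≤ C) (N : ℕ) {x : ℝ} (hx : 0 ≤ x) : x ≤ ratioMod C N x := by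
  have h1 : 0 ≤ (C * x) ^ (1 / (N : ℝ)) := by positivity
  unfold ratioMod
  nlinarith

lemma le_ratioMod_of_or {C : ℝ} (hC : 0 ≤ C) {N : ℕ} (hN : 1 ≤ N) {x y : ℝ} (hx : 0 ≤ x)
    (hy : 0 ≤ y) (h : y ≤ C * x ∨ y ^ N ≤ C * x) : y ≤ ratioMod C N x := by
  have h1 : 0 ≤ (C * x) ^ (1 / (N : ℝ)) := by positivity
  have h0 : 0 ≤ C * x := mul_nonneg hC hx
  unfold ratioMod
  rcases h with h | h
  · linarith
  · have := Real.rpow_le_rpow (by positivity) h (show 0 ≤ 1 / (N : ℝ) by positivity)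
    rw [one_div, Real.pow_rpow_inv_natCast hy (by omega), ← one_div] at this
    linarith

lemma continuous_ratioMod (C : ℝ) (N : ℕ) : Continuous (ratioMod C N) := by
  unfold ratioMod
  exact (continuous_const.mul continuous_id).add
    ((continuous_const.mul continuous_id).rpow_const fun _ => Or.inr (by positivity))

lemma ratioMod_zero (C : ℝ) {N : ℕ} (hN : 1 ≤ N) : ratioMod C N 0 = 0 := by
  have : (1 / (N : ℝ)) ≠ 0 := by positivity
  rw [ratioMod, mul_zero, Real.zero_rpow this, add_zero]

/-- A modulus for cross-ratios. -/
def crossMod (C : ℝ) (N : ℕ) (x : ℝ) : ℝ :=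
  ratioMod C N x + ratioMod C N x + ratioMod C N x * ratioMod C N x

lemma crossMod_mono {C : ℝ} (hC : 1 ≤ C) (N : ℕ) {x y : ℝ} (hx : 0 ≤ x) (hxy : x ≤ y) :
    crossMod C N x ≤ crossMod C N y := by
  have h1 := ratioMod_mono (by linarith) N hx hxy (C := C)
  have h2 := hx.trans (le_ratioMod hC N hx)
  have h3 := h2.trans h1
  unfold crossMod
  gcongr

lemma le_crossMod {C : ℝ} (hC : 1 ≤ C) (N : ℕ) {x : ℝ} (hx : 0 ≤ x) : x ≤ crossMod C N x := by
  have h1 := le_ratioMod hC N hx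
  unfold crossMod
  nlinarith

lemma continuous_crossMod (C : ℝ) (N : ℕ) : Continuous (crossMod C N) := by
  have := continuous_ratioMod C N
  unfold crossMod
  fun_prop

lemma crossMod_zero (C : ℝ) {N : ℕ} (hN : 1 ≤ N) : crossMod C N 0 = 0 := by
  simp [crossMod, ratioMod_zero C hN]

/-- A crude bound for the cross-ratio in terms of the cross-ratio of the images. -/
lemma exists_crossRatio_le_crossMod {a b A B lam : ℝ} {N : ℕ} (hab : a < b) (hA : 0 < A)
    (hB : 0 < B) (hlam : 0 < lam) (hN : 1 ≤ N) : ∃ C : ℝ, 1 ≤ C ∧ ∀ g, Tame g a b A B lam N →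
    ∀ t1 j1 j2 t2 : ℝ, a ≤ t1 → t1 < j1 → j1 < j2 → j2 < t2 → t2 ≤ b →
      (StrictMonoOn g (Icc t1 t2) ∨ StrictAntiOn g (Icc t1 t2)) →
      crossRatio t1 j1 j2 t2 ≤ crossMod C N (crossRatio (g t1) (g j1) (g j2) (g t2)) := by
  obtain ⟨C, hC, H⟩ := exists_ratio_const (N := N) hab hA hB hlam
  refine ⟨C, hC, fun g hg t1 j1 j2 t2 ha h1 h2 h3 hb hmono => ?_⟩
  have m1 : t1 ∈ Icc t1 t2 := ⟨le_rfl, by linarith⟩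
  have m2 : j1 ∈ Icc t1 t2 := ⟨h1.le, by linarith⟩
  have m3 : j2 ∈ Icc t1 t2 := ⟨by linarith, h3.le⟩
  have m4 : t2 ∈ Icc t1 t2 := ⟨by linarith, le_rfl⟩
  have hne : ∀ p ∈ Icc t1 t2, ∀ q ∈ Icc t1 t2, p < q → g q - g p ≠ 0 := fun p hp q hq hpq =>
    sub_ne_zero.2 fun e => hpq.ne'
      (hmono.elim (fun h => h.injOn hq hp e) (fun h => h.injOn hq hp e))
  have hpos : 0 < (g j2 - g j1) / (g j1 - g t1) ∧ 0 < (g j2 - g j1) / (g t2 - g j2) := by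
    rcases hmono with h | h
    · exact ⟨div_pos (sub_pos.2 (h m2 m3 h2)) (sub_pos.2 (h m1 m2 h1)),
        div_pos (sub_pos.2 (h m2 m3 h2)) (sub_pos.2 (h m3 m4 h3))⟩
    · exact ⟨div_pos_of_neg_of_neg (sub_neg.2 (h m2 m3 h2)) (sub_neg.2 (h m1 m2 h1)),
        div_pos_of_neg_of_neg (sub_neg.2 (h m2 m3 h2)) (sub_neg.2 (h m3 m4 h3))⟩
  have hconv : ∀ y G s : ℝ, 0 < G → (y * G ≤ C * s ∨ y ^ N * G ≤ C * s) →
      (y ≤ C * (s / G) ∨ y ^ N ≤ C * (s / G)) := fun y G s hG h => by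
    rw [mul_div_assoc', le_div_iff₀ hG, le_div_iff₀ hG]
    exact h
  have hleft := hconv _ _ _ (abs_pos.2 (neg_ne_zero.2 (hne t1 m1 j1 m2 h1)))
    (by
      rw [neg_sub]
      refine H g hg t1 j2 j1 j2 t1 j1 (j1 - t1) |g j2 - g j1| ha (by linarith) h1.le h2 le_rfl
        ⟨le_rfl, by linarith⟩ ⟨h1.le, h2.le⟩ ?_ (by linarith) (by ring) (abs_nonneg _)
        (fun x hx => ?_) (fun x hx => ?_)
      · rw [abs_sub_comm, abs_of_pos (by linarith)]
      · rcases le_total x j1 with h | h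
        · refine (abs_sub_le_of_mem_uIcc hmono m2 m1 ?_).trans
            (le_add_of_nonneg_right (abs_nonneg _))
          rw [uIcc_of_ge h1.le]
          exact ⟨hx.1, h⟩
        · refine (abs_sub_le_of_mem_uIcc hmono m2 m3 ?_).trans
            (le_add_of_nonneg_left (abs_nonneg _))
          rw [uIcc_of_le h2.le]
          exact ⟨h, hx.2⟩
      · refine abs_sub_le_of_mem_uIcc hmono m2 m3 ?_
        rwa [uIcc_of_le h2.le])
  have hright := hconv _ _ _ (abs_pos.2 (hne j2 m3 t2 m4 h3))
    (by
      refine H g hg j1 t2 j1 j2 t2 j2 (t2 - j2) |g j1 - g j2| (by linarith) hb le_rfl h2 h3.le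
        ⟨by linarith, le_rfl⟩ ⟨h2.le, h3.le⟩ ?_ (by linarith) (by ring) (abs_nonneg _)
        (fun x hx => ?_) (fun x hx => ?_)
      · rw [abs_of_pos (by linarith)]
      · rcases le_total x j2 with h | h
        · refine (abs_sub_le_of_mem_uIcc hmono m3 m2 ?_).trans
            (le_add_of_nonneg_left (abs_nonneg _))
          rw [uIcc_of_ge h2.le]
          exact ⟨hx.1, h⟩
        · refine (abs_sub_le_of_mem_uIcc hmono m3 m4 ?_).trans
            (le_add_of_nonneg_right (abs_nonneg _))
          rw [uIcc_of_le h3.le]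
          exact ⟨h, hx.2⟩
      · refine abs_sub_le_of_mem_uIcc hmono m3 m2 ?_
        rwa [uIcc_of_ge h2.le])
  rw [abs_neg, ← abs_div, abs_of_pos hpos.1] at hleft
  rw [abs_sub_comm (g j1), ← abs_div, abs_of_pos hpos.2] at hright
  have hy0 : 0 < (j2 - j1) / (j1 - t1) := div_pos (by linarith) (by linarith)
  have hz0 : 0 < (j2 - j1) / (t2 - j2) := div_pos (by linarith) (by linarith)
  have hy := le_ratioMod_of_or (by linarith) hN hpos.1.le hy0.le hleft
  have hz := le_ratioMod_of_or (by linarith) hN hpos.2.le hz0.le hright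
  rw [crossRatio_eq (by linarith) (by linarith),
    crossRatio_eq (hne t1 m1 j1 m2 h1) (hne j2 m3 t2 m4 h3)]
  have hp := mul_pos hpos.1 hpos.2
  have hy' := hy.trans (ratioMod_mono (by linarith) N hpos.1.le
    (show _ ≤ (g j2 - g j1) / (g j1 - g t1) + (g j2 - g j1) / (g t2 - g j2) +
      (g j2 - g j1) / (g j1 - g t1) * ((g j2 - g j1) / (g t2 - g j2)) by linarith [hpos.2]))
  have hz' := hz.trans (ratioMod_mono (by linarith) N hpos.2.le
    (show _ ≤ (g j2 - g j1) / (g j1 - g t1) + (g j2 - g j1) / (g t2 - g j2) +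
      (g j2 - g j1) / (g j1 - g t1) * ((g j2 - g j1) / (g t2 - g j2)) by linarith [hpos.1]))
  unfold crossMod
  gcongr
  exact hy0.le.trans hy'

/-- The total increase of a bounded monotone function over a family of intervals is bounded by
the multiplicity of the family times the bound. -/
lemma sum_sub_le_of_multiplicity {F : ℝ → ℝ} {M : ℝ} (hF : Monotone F)
    (hFM : ∀ x, 0 ≤ F x ∧ F x ≤ M) (S : Finset ℕ) (x y : ℕ → ℝ) (hxy : ∀ k, x k ≤ y k) (n : ℕ)
    (hn : ∀ z, (S.filter fun k => z ∈ Icc (x k) (y k)).card ≤ n) :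
    ∑ k ∈ S, (F (y k) - F (x k)) ≤ n * M := by
  classical
  have hM : 0 ≤ M := (hFM 0).1.trans (hFM 0).2
  have hcount : ∀ z, ∑ k ∈ S, (Ioc (F (x k)) (F (y k))).indicator (fun _ => (1 : ℝ)) z ≤ n := by
    intro z
    simp only [indicator_apply]
    rw [Finset.sum_boole]
    refine Nat.cast_le.2 ?_
    rcases (S.filter fun k => z ∈ Ioc (F (x k)) (F (y k))).eq_empty_or_nonempty with h | h
    · rw [h]
      simp
    · obtain ⟨k₀, hk₀, hmax⟩ := Finset.exists_max_image _ x h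
      refine (Finset.card_le_card fun k hk => ?_).trans (hn (x k₀))
      have h1 := Finset.mem_filter.1 hk
      have h2 := Finset.mem_filter.1 hk₀
      exact Finset.mem_filter.2 ⟨h1.1, hmax k hk, (hF.reflect_lt (h2.2.1.trans_le h1.2.2)).le⟩
  have hint : ∀ k, Integrable ((Ioc (F (x k)) (F (y k))).indicator fun _ => (1 : ℝ))
      (volume.restrict (Ioc 0 M)) := fun k => (integrable_const 1).indicator measurableSet_Ioc
  have heq : ∀ k, F (y k) - F (x k) = ∫ z in Ioc 0 M,
      (Ioc (F (x k)) (F (y k))).indicator (fun _ => (1 : ℝ)) z := by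
    intro k
    rw [integral_indicator measurableSet_Ioc, Measure.restrict_restrict measurableSet_Ioc,
      inter_eq_left.2 (Ioc_subset_Ioc (hFM _).1 (hFM _).2)]
    simp [measureReal_def, hF (hxy k)]
  calc ∑ k ∈ S, (F (y k) - F (x k))
      = ∫ z in Ioc 0 M, ∑ k ∈ S, (Ioc (F (x k)) (F (y k))).indicator (fun _ => (1 : ℝ)) z := by
        rw [integral_finsetSum _ fun k _ => hint k]
        exact Finset.sum_congr rfl fun k _ => heq k
    _ ≤ ∫ _ in Ioc 0 M, (n : ℝ) :=
        integral_mono (integrable_finsetSum _ fun k _ => hint k) (integrable_const _) hcount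
    _ = n * M := by simp [measureReal_def, hM, mul_comm]

/-- Composition of steps which either multiply by a bounded factor or apply a modulus `σ`. -/
lemma le_exp_mul_iterate {σ : ℝ → ℝ} {W : ℝ} (hW : 0 ≤ W)
    (hmono : ∀ x y, 0 ≤ x → x ≤ y → σ x ≤ σ y) (hle : ∀ x, 0 ≤ x → x ≤ σ x)
    {D w : ℕ → ℝ} {c : ℕ → ℕ} {m n : ℕ} (hw : ∀ k, 0 ≤ w k)
    (hstep : ∀ k < m, D k ≤ Real.exp (w k) * D (k + 1) ∨ (1 ≤ c k ∧ D k ≤ σ (D (k + 1))))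
    (hD : ∀ k ≤ m, 0 ≤ D k)
    (hwW : ∑ k ∈ Finset.range m, w k ≤ W) (hcn : ∑ k ∈ Finset.range m, c k ≤ n) :
    D 0 ≤ Real.exp W * (fun x => σ (Real.exp W * x))^[n] (D m) := by
  set τ : ℝ → ℝ := fun x => σ (Real.exp W * x) with hτ
  have hτle : ∀ x, 0 ≤ x → x ≤ τ x := fun x hx => by
    have h1 : x ≤ Real.exp W * x := le_mul_of_one_le_left hx (Real.one_le_exp hW)
    exact h1.trans (hle _ (hx.trans h1))
  have hpos : ∀ n, 0 ≤ τ^[n] (D m) := fun n => by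
    induction n with
    | zero => exact hD m le_rfl
    | succ n ih =>
      rw [Function.iterate_succ_apply']
      exact ih.trans (hτle _ ih)
  have hiter : Monotone fun n => τ^[n] (D m) := monotone_nat_of_le_succ fun n => by
    rw [Function.iterate_succ_apply']
    exact hτle _ (hpos n)
  have key : ∀ i k, k + i = m → D k ≤ Real.exp (∑ i ∈ Finset.Ico k m, w i) *
      τ^[∑ i ∈ Finset.Ico k m, c i] (D m) := by
    intro i
    induction i with
    | zero =>
      rintro k rfl
      simp
    | succ i ih =>
      intro k hk
      have hkm : k < m := by omega
      have h1 := ih (k + 1) (by omega)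
      rw [Finset.sum_eq_sum_Ico_succ_bot hkm, Finset.sum_eq_sum_Ico_succ_bot hkm]
      set s := ∑ i ∈ Finset.Ico (k + 1) m, w i with hs
      set r := ∑ i ∈ Finset.Ico (k + 1) m, c i with hr
      have hs0 : 0 ≤ s := Finset.sum_nonneg fun i _ => hw i
      have hsW : s ≤ W := (Finset.sum_le_sum_of_subset_of_nonneg
        (fun i hi => Finset.mem_range.2 (Finset.mem_Ico.1 hi).2) fun i _ _ => hw i).trans hwW
      rcases hstep k hkm with h | ⟨hc, h⟩
      · calc D k ≤ Real.exp (w k) * D (k + 1) := h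
          _ ≤ Real.exp (w k) * (Real.exp s * τ^[r] (D m)) := by gcongr
          _ = Real.exp (w k + s) * τ^[r] (D m) := by rw [Real.exp_add, mul_assoc]
          _ ≤ _ := by
            gcongr
            exact hiter (Nat.le_add_left _ _)
      · calc D k ≤ σ (D (k + 1)) := h
          _ ≤ σ (Real.exp W * τ^[r] (D m)) := hmono _ _ (hD _ hkm) (h1.trans (by
              have := hpos r
              gcongr))
          _ = τ^[r + 1] (D m) := by rw [Function.iterate_succ_apply']
          _ ≤ τ^[c k + r] (D m) := hiter (by omega)
          _ ≤ _ := le_mul_of_one_le_left (hpos _)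
              (Real.one_le_exp (add_nonneg (hw k) hs0))
  have h0 := key m 0 (by omega)
  rw [← Finset.range_eq_Ico] at h0
  refine h0.trans (mul_le_mul (Real.exp_le_exp.2 hwW) (hiter hcn) (hpos _) (Real.exp_pos _).le)

lemma image_Icc_eq_of_strictMonoOn_or {h : ℝ → ℝ} {s t : ℝ} (hst : s ≤ t)
    (hc : ContinuousOn h (Icc s t)) (hm : StrictMonoOn h (Icc s t) ∨ StrictAntiOn h (Icc s t)) :
    h '' Icc s t = Icc (min (h s) (h t)) (max (h s) (h t)) := by
  have hs : uIcc s t = Icc s t := uIcc_of_le hst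
  refine Subset.antisymm ?_ ?_
  · rintro _ ⟨x, hx, rfl⟩
    rw [← hs] at hx hm
    exact hm.elim (fun h => h.monotoneOn.mapsTo_uIcc hx) fun h => h.antitoneOn.mapsTo_uIcc hx
  · rw [← hs]
    exact intermediate_value_uIcc (hs ▸ hc)

/-- The images of four ordered points under an injective map, listed in increasing order. -/
lemma exists_sorted_image {h : ℝ → ℝ} {t1 j1 j2 t2 : ℝ} (h1 : t1 < j1) (h2 : j1 < j2)
    (h3 : j2 < t2) (hm : StrictMonoOn h (Icc t1 t2) ∨ StrictAntiOn h (Icc t1 t2)) :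
    ∃ i1 i2, min (h t1) (h t2) < i1 ∧ i1 < i2 ∧ i2 < max (h t1) (h t2) ∧
      ∀ g : ℝ → ℝ, crossRatio (g (h t1)) (g (h j1)) (g (h j2)) (g (h t2)) =
        crossRatio (g (min (h t1) (h t2))) (g i1) (g i2) (g (max (h t1) (h t2))) := by
  have m1 : t1 ∈ Icc t1 t2 := ⟨le_rfl, by linarith⟩
  have m2 : j1 ∈ Icc t1 t2 := ⟨h1.le, by linarith⟩
  have m3 : j2 ∈ Icc t1 t2 := ⟨by linarith, h3.le⟩
  have m4 : t2 ∈ Icc t1 t2 := ⟨by linarith, le_rfl⟩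
  rcases hm with hm | hm
  · have h4 := (hm m1 m4 (by linarith)).le
    rw [min_eq_left h4, max_eq_right h4]
    exact ⟨h j1, h j2, hm m1 m2 h1, hm m2 m3 h2, hm m3 m4 h3, fun g => rfl⟩
  · have h4 := (hm m1 m4 (by linarith)).le
    rw [min_eq_right h4, max_eq_left h4]
    exact ⟨h j2, h j1, hm m3 m4 h3, hm m2 m3 h2, hm m1 m2 h1, fun g => (crossRatio_swap ..).symm⟩

/-- The cross-ratio bound for iterates, given a crude bound `σ` for one iterate and a fine
bound away from finitely many points. -/
lemma crossRatio_le_of_crossGood {g : ℝ → ℝ} {a b M : ℝ} {K : ℕ} {σ : ℝ → ℝ} (hg : Continuous g)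
    (hmaps : MapsTo g (Icc a b) (Icc a b)) (hgood : CrossGood g K M a b)
    (hmono : ∀ x y, 0 ≤ x → x ≤ y → σ x ≤ σ y) (hle : ∀ x, 0 ≤ x → x ≤ σ x)
    (hcrude : ∀ t1 j1 j2 t2 : ℝ, a ≤ t1 → t1 < j1 → j1 < j2 → j2 < t2 → t2 ≤ b →
      (StrictMonoOn g (Icc t1 t2) ∨ StrictAntiOn g (Icc t1 t2)) →
      crossRatio t1 j1 j2 t2 ≤ σ (crossRatio (g t1) (g j1) (g j2) (g t2)))
    {m N₀ : ℕ} {t1 j1 j2 t2 : ℝ} (h1 : t1 < j1) (h2 : j1 < j2) (h3 : j2 < t2)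
    (hT : Icc t1 t2 ⊆ Icc a b)
    (hm : StrictMonoOn (g^[m]) (Icc t1 t2) ∨ StrictAntiOn (g^[m]) (Icc t1 t2))
    (hmult : ∀ x : ℝ, {k : ℕ | k < m ∧ x ∈ g^[k] '' Icc t1 t2}.ncard ≤ N₀) :
    0 < crossRatio (g^[m] t1) (g^[m] j1) (g^[m] j2) (g^[m] t2) ∧
    crossRatio t1 j1 j2 t2 ≤ Real.exp (N₀ * M) *
      (fun x => σ (Real.exp (N₀ * M) * x))^[(K + 2) * N₀]
        (crossRatio (g^[m] t1) (g^[m] j1) (g^[m] j2) (g^[m] t2)) := by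
  classical
  have hM := hgood.nonneg
  obtain ⟨P, F, hP, hF, hFM, hcr⟩ := hgood
  have h12 : t1 ≤ t2 := by linarith
  have hcont : ∀ k, ContinuousOn (g^[k]) (Icc t1 t2) := fun k => (hg.iterate k).continuousOn
  have hinj : ∀ k ≤ m, InjOn (g^[k]) (Icc t1 t2) := fun k hk x hx y hy hxy => by
    have hmi : InjOn (g^[m]) (Icc t1 t2) := hm.elim StrictMonoOn.injOn StrictAntiOn.injOn
    refine hmi hx hy ?_
    rw [← Nat.sub_add_cancel hk, Function.iterate_add_apply, Function.iterate_add_apply, hxy]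
  have hmk : ∀ k ≤ m, StrictMonoOn (g^[k]) (Icc t1 t2) ∨ StrictAntiOn (g^[k]) (Icc t1 t2) :=
    fun k hk => (hcont k).strictMonoOn_of_injOn_Icc' h12 (hinj k hk)
  set x : ℕ → ℝ := fun k => min (g^[k] t1) (g^[k] t2) with hx
  set y : ℕ → ℝ := fun k => max (g^[k] t1) (g^[k] t2) with hy
  have hxy : ∀ k, x k ≤ y k := fun k => min_le_max
  have himg : ∀ k ≤ m, g^[k] '' Icc t1 t2 = Icc (x k) (y k) := fun k hk =>
    image_Icc_eq_of_strictMonoOn_or h12 (hcont k) (hmk k hk)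
  have hsub : ∀ k ≤ m, Icc (x k) (y k) ⊆ Icc a b := fun k hk => by
    rw [← himg k hk]
    exact ((hmaps.iterate k).mono_left hT).image_subset
  have hcard : ∀ z, ((Finset.range m).filter fun k => z ∈ Icc (x k) (y k)).card ≤ N₀ := by
    intro z
    refine le_trans (le_of_eq ?_) (hmult z)
    rw [← Set.ncard_coe_finset]
    congr 1
    ext k
    simp only [Finset.coe_filter, Finset.mem_range, mem_ofPred_eq]
    exact and_congr_right fun hk => by rw [himg k hk.le]
  set Q := insert a (insert b P) with hQ
  have hQcard : Q.card ≤ K + 2 :=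
    (Finset.card_insert_le _ _).trans
      (Nat.succ_le_succ ((Finset.card_insert_le _ _).trans (Nat.succ_le_succ hP)))
  set D : ℕ → ℝ := fun k => crossRatio (g^[k] t1) (g^[k] j1) (g^[k] j2) (g^[k] t2) with hDdef
  have hDpos : ∀ k ≤ m, 0 < D k := fun k hk => by
    obtain ⟨i1, i2, s1, s2, s3, e⟩ := exists_sorted_image h1 h2 h3 (hmk k hk)
    exact (crossRatio_pos s1 s2 s3).trans_eq (e id).symm
  refine ⟨hDpos m le_rfl, ?_⟩
  refine le_exp_mul_iterate (D := D) (w := fun k => F (y k) - F (x k))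
    (c := fun k => ∑ p ∈ Q, if p ∈ Icc (x k) (y k) then 1 else 0) (by positivity) hmono hle
    (fun k => sub_nonneg.2 (hF (hxy k))) (fun k hk => ?_) (fun k hk => (hDpos k hk).le)
    (sum_sub_le_of_multiplicity hF hFM _ x y hxy N₀ hcard) ?_
  · obtain ⟨i1, i2, s1, s2, s3, e⟩ := exists_sorted_image h1 h2 h3 (hmk k hk.le)
    have e0 : D k = crossRatio (x k) i1 i2 (y k) := e id
    have e1 : D (k + 1) = crossRatio (g (x k)) (g i1) (g i2) (g (y k)) := by
      rw [← e g]
      simp only [hDdef, Function.iterate_succ_apply']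
    have ha := (hsub k hk.le ⟨le_rfl, hxy k⟩).1
    have hb := (hsub k hk.le ⟨hxy k, le_rfl⟩).2
    rw [e0, e1]
    by_cases hbad : ∃ p ∈ Q, p ∈ Icc (x k) (y k)
    · right
      obtain ⟨p, hp, hpI⟩ := hbad
      refine ⟨?_, hcrude _ _ _ _ ha s1 s2 s3 hb
        (hg.continuousOn.strictMonoOn_of_injOn_Icc' (hxy k) ?_)⟩
      · refine le_trans ?_ (Finset.single_le_sum (fun _ _ => Nat.zero_le _) hp)
        rw [if_pos hpI]
      · rw [← himg k hk.le]
        rintro _ ⟨q, hq, rfl⟩ _ ⟨r, hr, rfl⟩ hqr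
        rw [← Function.iterate_succ_apply' g, ← Function.iterate_succ_apply' g] at hqr
        rw [hinj (k + 1) hk hq hr hqr]
    · left
      push Not at hbad
      refine hcr _ _ _ _ (lt_of_le_of_ne ha fun h => ?_) s1 s2 s3 (lt_of_le_of_ne hb fun h => ?_)
        fun p hp => hbad p (by simp [hQ, hp])
      · exact hbad a (by simp [hQ]) ⟨h.ge, h ▸ hxy k⟩
      · exact hbad b (by simp [hQ]) ⟨h ▸ hxy k, h.ge⟩
  · rw [Finset.sum_comm]
    calc _ ≤ ∑ _p ∈ Q, N₀ := Finset.sum_le_sum fun p _ => by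
          rw [Finset.sum_boole]
          exact hcard p
      _ ≤ _ := by
          rw [Finset.sum_const, smul_eq_mul]
          exact Nat.mul_le_mul_right _ hQcard

/-- Uniform cross-ratio bound: for a C^∞ map `f` with non-flat critical
points there are a C^∞ neighbourhood `F` and a function `ρ(ε, N₀)` such that for `g ∈ F`,
intervals `J ⊂ T` on which `g^m` is a diffeomorphism with intersection multiplicity of the
`g^k(T)`, `k < m`, at most `N₀`, one has `D(T,J) < ρ(D(g^m T, g^m J), N₀)`;
moreover `ρ(ε, N₀) → 0` as `ε → 0` for fixed `N₀`. -/
theorem stmt_4 (a b : ℝ) (hab : a < b) (f : ℝ → ℝ)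
    (hf : ∀ n : ℕ, ContDiff ℝ n f) (hmaps : MapsTo f (Icc a b) (Icc a b))
    (hnf : ∀ c ∈ Icc a b, deriv f c = 0 → ∃ d : ℕ, 2 ≤ d ∧ iteratedDeriv d f c ≠ 0) :
    ∃ (k : ℕ) (η : ℝ) (ρ : ℝ → ℕ → ℝ), 0 < η ∧
      (∀ g : ℝ → ℝ, (∀ n : ℕ, ContDiff ℝ n g) → MapsTo g (Icc a b) (Icc a b) →
        CkClose k f g (Icc a b) η →
        ∀ (m N₀ : ℕ) (t1 j1 j2 t2 : ℝ), t1 < j1 → j1 < j2 → j2 < t2 →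
          Icc t1 t2 ⊆ Icc a b →
          (StrictMonoOn (g^[m]) (Icc t1 t2) ∨ StrictAntiOn (g^[m]) (Icc t1 t2)) →
          (∀ x : ℝ, {kk : ℕ | kk < m ∧ x ∈ g^[kk] '' Icc t1 t2}.ncard ≤ N₀) →
          crossRatio t1 j1 j2 t2 <
            ρ (crossRatio (g^[m] t1) (g^[m] j1) (g^[m] j2) (g^[m] t2)) N₀) ∧
      (∀ N₀ : ℕ, Tendsto (fun e => ρ e N₀) (nhdsWithin 0 (Ioi 0)) (nhds 0)) := by
  obtain ⟨k, η, A, B, lam, N, hη, hA, hB, hlam, hN, htame⟩ := exists_tame_nhds hab hf hnf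
  obtain ⟨K, M, hgood⟩ := exists_crossGood_of_tame (a := a) (b := b) hA hB.le hlam N
  obtain ⟨C, hC, hcrude⟩ := exists_crossRatio_le_crossMod hab hA hB hlam hN
  refine ⟨k, η, fun e N₀ => Real.exp (N₀ * M) *
    (fun x => crossMod C N (Real.exp (N₀ * M) * x))^[(K + 2) * N₀] e + e, hη, ?_, ?_⟩
  · intro g hg hgm hgc m N₀ t1 j1 j2 t2 h1 h2 h3 hT hm hmult
    have ht := htame g hg hgm hgc
    obtain ⟨hpos, h⟩ := crossRatio_le_of_crossGood ht.smooth.continuous hgm (hgood g ht)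
      (fun x y => crossMod_mono hC N) (fun x => le_crossMod hC N) (hcrude g ht) h1 h2 h3 hT hm
      hmult
    exact h.trans_lt (lt_add_of_pos_right _ hpos)
  · intro N₀
    have hc : Continuous fun x => crossMod C N (Real.exp (N₀ * M) * x) :=
      (continuous_crossMod C N).comp (continuous_const.mul continuous_id)
    have h0 : (fun x => crossMod C N (Real.exp (N₀ * M) * x)) 0 = 0 := by
      simp [crossMod_zero C hN]
    have ht : Continuous fun e => Real.exp (N₀ * M) *
        (fun x => crossMod C N (Real.exp (N₀ * M) * x))^[(K + 2) * N₀] e + e :=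
      (continuous_const.mul (hc.iterate _)).add continuous_id
    refine (ht.tendsto' 0 0 ?_).mono_left nhdsWithin_le_nhds
    rw [Function.iterate_fixed h0, mul_zero, add_zero]
end
end

section
/- Let f: T → f(T) be a C³ diffeomorphism of a real interval T, and suppose Sf(x) < C for all x ∈ T and some constant C > 0 with C|T|² < π²/2. Then for any interval J ⊂ T one has B(f, T, J) > cos²(√(C/2) · |T|). -/
open Set Filter Topology MeasureTheory

noncomputable section

/-- Sturm comparison: if `f' = f₁ > 0` and the Schwarzian derivative of `f` is less than `2ω²`, then
`w = (f - f a) / √f'` solves `w'' = -(Sf / 2) w`, and so `w / sin (ω (x - a))` is increasing. Here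
`√f'` is eliminated by squaring. -/
lemma strictAntiOn_ratio_of_schwarzian_lt {f f₁ f₂ f₃ : ℝ → ℝ} {a d ω : ℝ}
    (hf : ∀ x, HasDerivAt f (f₁ x) x) (hf₁ : ∀ x, HasDerivAt f₁ (f₂ x) x)
    (hf₂ : ∀ x, HasDerivAt f₂ (f₃ x) x) (hpos : ∀ x ∈ Icc a d, 0 < f₁ x)
    (hS : ∀ x ∈ Icc a d, f₃ x / f₁ x - 3 / 2 * (f₂ x / f₁ x) ^ 2 < 2 * ω ^ 2)
    (hω : 0 < ω) (hπ : ω * (d - a) < Real.pi) :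
    StrictAntiOn (fun x => Real.sin (ω * (x - a)) ^ 2 * f₁ x / (f x - f a) ^ 2) (Ioc a d) := by
  have hmono : StrictMonoOn f (Icc a d) := by
    refine strictMonoOn_of_hasDerivWithinAt_pos (convex_Icc a d)
      (fun x _ => (hf x).continuousAt.continuousWithinAt)
      (fun x _ => (hf x).hasDerivWithinAt) fun x hx => hpos x (interior_subset hx)
  have hgt : ∀ x ∈ Ioc a d, 0 < f x - f a := fun x hx =>
    sub_pos.2 (hmono ⟨le_rfl, hx.1.le.trans hx.2⟩ (Ioc_subset_Icc_self hx) hx.1)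
  have hsin : ∀ x ∈ Ioc a d, 0 < Real.sin (ω * (x - a)) := fun x hx =>
    Real.sin_pos_of_pos_of_lt_pi (mul_pos hω (sub_pos.2 hx.1))
      ((mul_le_mul_of_nonneg_left (sub_le_sub_right hx.2 a) hω.le).trans_lt hπ)
  have hs : ∀ x, HasDerivAt (fun x => Real.sin (ω * (x - a))) (ω * Real.cos (ω * (x - a))) x := by
    intro x
    refine HasDerivAt.congr_deriv ((((hasDerivAt_id x).sub_const a).const_mul ω).sin) ?_
    simp only [id]
    ring
  have hc : ∀ x, HasDerivAt (fun x => Real.cos (ω * (x - a)))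
      (-(ω * Real.sin (ω * (x - a)))) x := by
    intro x
    refine HasDerivAt.congr_deriv ((((hasDerivAt_id x).sub_const a).const_mul ω).cos) ?_
    simp only [id]
    ring
  let p : ℝ → ℝ := fun x => (√(f₁ x))⁻¹
  have hp0 : ∀ x ∈ Icc a d, 0 < p x := fun x hx => inv_pos.2 (Real.sqrt_pos.2 (hpos x hx))
  have hp2 : ∀ x ∈ Icc a d, p x ^ 2 * f₁ x = 1 := by
    intro x hx
    have := hpos x hx
    simp only [p, inv_pow, Real.sq_sqrt this.le]
    field_simp
  have hp : ∀ x ∈ Icc a d, HasDerivAt p (-(1 / 2) * (f₂ x / f₁ x) * p x) x := by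
    intro x hx
    have h0 := hpos x hx
    have h1 := Real.sqrt_pos.2 h0
    refine HasDerivAt.congr_deriv (((hf₁ x).sqrt h0.ne').inv h1.ne') ?_
    rw [Real.sq_sqrt h0.le]
    simp only [p]
    field_simp
  let w : ℝ → ℝ := fun x => (f x - f a) * p x
  let w₁ : ℝ → ℝ := fun x => f₁ x * p x - 1 / 2 * (f x - f a) * (f₂ x / f₁ x) * p x
  have hw : ∀ x ∈ Icc a d, HasDerivAt w (w₁ x) x := by
    intro x hx
    refine HasDerivAt.congr_deriv (((hf x).sub_const (f a)).mul (hp x hx)) ?_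
    simp only [w₁]
    ring
  have hw₁ : ∀ x ∈ Icc a d, HasDerivAt w₁
      (-(1 / 2) * (f₃ x / f₁ x - 3 / 2 * (f₂ x / f₁ x) ^ 2) * w x) x := by
    intro x hx
    have h0 := (hpos x hx).ne'
    refine HasDerivAt.congr_deriv (((hf₁ x).mul (hp x hx)).sub
      (((((hf x).sub_const (f a)).const_mul (1 / 2)).mul ((hf₂ x).div (hf₁ x) h0)).mul (hp x hx))) ?_
    simp only [w, Pi.div_apply, Pi.mul_apply]
    field_simp
    ring
  have hwpos : ∀ x ∈ Ioc a d, 0 < w x := fun x hx =>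
    mul_pos (hgt x hx) (hp0 x (Ioc_subset_Icc_self hx))
  let W : ℝ → ℝ := fun x =>
    w₁ x * Real.sin (ω * (x - a)) - w x * (ω * Real.cos (ω * (x - a)))
  have hW : ∀ x ∈ Icc a d, HasDerivAt W
      ((ω ^ 2 - 1 / 2 * (f₃ x / f₁ x - 3 / 2 * (f₂ x / f₁ x) ^ 2)) * w x *
        Real.sin (ω * (x - a))) x := by
    intro x hx
    refine HasDerivAt.congr_deriv (((hw₁ x hx).mul (hs x)).sub ((hw x hx).mul ((hc x).const_mul ω))) ?_
    ring
  have hWmono : StrictMonoOn W (Icc a d) := by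
    refine strictMonoOn_of_hasDerivWithinAt_pos (convex_Icc a d)
      (fun x hx => (hW x hx).continuousAt.continuousWithinAt)
      (fun x hx => (hW x (interior_subset hx)).hasDerivWithinAt) fun x hx => ?_
    rw [interior_Icc] at hx
    have hx' := Ioo_subset_Ioc_self hx
    have := hS x (Ioc_subset_Icc_self hx')
    exact mul_pos (mul_pos (by linarith) (hwpos x hx')) (hsin x hx')
  have hWpos : ∀ x ∈ Ioc a d, 0 < W x := by
    intro x hx
    have h := hWmono ⟨le_rfl, hx.1.le.trans hx.2⟩ (Ioc_subset_Icc_self hx) hx.1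
    simpa [W, w] using h
  have hanti : StrictAntiOn (fun x => Real.sin (ω * (x - a)) / w x) (Ioc a d) := by
    have hder : ∀ x ∈ Ioc a d, HasDerivAt (fun x => Real.sin (ω * (x - a)) / w x)
        (-W x / w x ^ 2) x := by
      intro x hx
      refine HasDerivAt.congr_deriv ((hs x).div (hw x (Ioc_subset_Icc_self hx)) (hwpos x hx).ne') ?_
      simp only [W]
      ring
    refine strictAntiOn_of_hasDerivWithinAt_neg (convex_Ioc a d)
      (fun x hx => (hder x hx).continuousAt.continuousWithinAt)
      (fun x hx => (hder x (interior_subset hx)).hasDerivWithinAt) fun x hx => ?_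
    have hx' := interior_subset hx
    exact div_neg_of_neg_of_pos (neg_neg_of_pos (hWpos x hx')) (pow_pos (hwpos x hx') 2)
  have hsq : ∀ x ∈ Ioc a d, Real.sin (ω * (x - a)) ^ 2 * f₁ x / (f x - f a) ^ 2 =
      (Real.sin (ω * (x - a)) / w x) ^ 2 := by
    intro x hx
    have h0 := (hgt x hx).ne'
    have h1 := (hp0 x (Ioc_subset_Icc_self hx)).ne'
    have h2 := hp2 x (Ioc_subset_Icc_self hx)
    simp only [w]
    field_simp
    linear_combination Real.sin (ω * (x - a)) ^ 2 * h2
  intro x hx y hy hxy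
  simp only [hsq x hx, hsq y hy]
  exact pow_lt_pow_left₀ (hanti hx hy hxy) (div_pos (hsin y hy) (hwpos y hy)).le two_ne_zero

/-- Among maps with Schwarzian derivative at most `2ω²`, the map `tan (ω x)` has the least
cross-ratio distortion. -/
lemma sin_crossRatio_lt_of_schwarzian_lt {f f₁ f₂ f₃ : ℝ → ℝ} {a b c d ω : ℝ}
    (hf : ∀ x, HasDerivAt f (f₁ x) x) (hf₁ : ∀ x, HasDerivAt f₁ (f₂ x) x)
    (hf₂ : ∀ x, HasDerivAt f₂ (f₃ x) x) (hpos : ∀ x ∈ Icc a d, 0 < f₁ x)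
    (hS : ∀ x ∈ Icc a d, f₃ x / f₁ x - 3 / 2 * (f₂ x / f₁ x) ^ 2 < 2 * ω ^ 2)
    (hω : 0 < ω) (hπ : ω * (d - a) < Real.pi) (hab : a < b) (hbc : b < c) (hcd : c < d) :
    Real.sin (ω * (d - a)) * Real.sin (ω * (c - b)) /
        (Real.sin (ω * (b - a)) * Real.sin (ω * (d - c))) <
      crossRatio (f a) (f b) (f c) (f d) := by
  have hanti := strictAntiOn_ratio_of_schwarzian_lt hf hf₁ hf₂ hpos hS hω hπ
  have hmono : StrictMonoOn f (Icc a d) := by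
    refine strictMonoOn_of_hasDerivWithinAt_pos (convex_Icc a d)
      (fun x _ => (hf x).continuousAt.continuousWithinAt)
      (fun x _ => (hf x).hasDerivWithinAt) fun x hx => hpos x (interior_subset hx)
  have hlt : ∀ x y, a ≤ x → x < y → y ≤ d → 0 < f y - f x := fun x y h1 h2 h3 =>
    sub_pos.2 (hmono ⟨h1, h2.le.trans h3⟩ ⟨h1.trans h2.le, h3⟩ h2)
  have hsin : ∀ x y, a ≤ x → x < y → y ≤ d → 0 < Real.sin (ω * (y - x)) := fun x y h1 h2 h3 =>
    Real.sin_pos_of_pos_of_lt_pi (mul_pos hω (sub_pos.2 h2))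
      ((mul_le_mul_of_nonneg_left (by linarith) hω.le).trans_lt hπ)
  have hF : ∀ x ∈ Ioc a d,
      HasDerivAt (fun x => -(f x - f a)⁻¹) (f₁ x / (f x - f a) ^ 2) x := by
    intro x hx
    refine HasDerivAt.congr_deriv ((((hf x).sub_const (f a)).inv (hlt a x le_rfl hx.1 hx.2).ne').neg) ?_
    ring
  have hG : ∀ x ∈ Ioc a d,
      HasDerivAt (fun x => -(Real.cos (ω * (x - a)) / Real.sin (ω * (x - a))))
        (ω / Real.sin (ω * (x - a)) ^ 2) x := by
    intro x hx
    have h0 := (hsin a x le_rfl hx.1 hx.2).ne'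
    have h1 := ((hasDerivAt_id x).sub_const a).const_mul ω
    refine HasDerivAt.congr_deriv ((h1.cos.div h1.sin h0).neg) ?_
    simp only [id]
    field_simp
    linear_combination Real.sin_sq_add_cos_sq (ω * (x - a))
  have key : ∀ x y, a < x → x < y → y ≤ d → ∃ ξ ∈ Ioo x y,
      (f y - f x) / ((f x - f a) * (f y - f a)) * ω =
        Real.sin (ω * (ξ - a)) ^ 2 * f₁ ξ / (f ξ - f a) ^ 2 *
          (Real.sin (ω * (y - x)) / (Real.sin (ω * (x - a)) * Real.sin (ω * (y - a)))) := by
    intro x y hx hxy hy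
    have hmem : ∀ z ∈ Icc x y, z ∈ Ioc a d := fun z hz => ⟨hx.trans_le hz.1, hz.2.trans hy⟩
    obtain ⟨ξ, hξ, h⟩ := exists_ratio_hasDerivAt_eq_ratio_slope _ _ hxy
      (fun z hz => (hF z (hmem z hz)).continuousAt.continuousWithinAt)
      (fun z hz => hF z (hmem z (Ioo_subset_Icc_self hz))) _ _
      (fun z hz => (hG z (hmem z hz)).continuousAt.continuousWithinAt)
      (fun z hz => hG z (hmem z (Ioo_subset_Icc_self hz)))
    refine ⟨ξ, hξ, ?_⟩
    have hξ' := hmem ξ (Ioo_subset_Icc_self hξ)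
    have e0 := (hsin a ξ le_rfl hξ'.1 hξ'.2).ne'
    have e1 := (hsin a x le_rfl hx (hxy.le.trans hy)).ne'
    have e2 := (hsin a y le_rfl (hx.trans hxy) hy).ne'
    have e3 := (hlt a x le_rfl hx (hxy.le.trans hy)).ne'
    have e4 := (hlt a y le_rfl (hx.trans hxy) hy).ne'
    have e5 := (hlt a ξ le_rfl hξ'.1 hξ'.2).ne'
    have hsub : Real.sin (ω * (y - x)) = Real.sin (ω * (y - a)) * Real.cos (ω * (x - a)) -
        Real.cos (ω * (y - a)) * Real.sin (ω * (x - a)) := by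
      rw [← Real.sin_sub]
      ring_nf
    have hG' : -(Real.cos (ω * (y - a)) / Real.sin (ω * (y - a))) -
        -(Real.cos (ω * (x - a)) / Real.sin (ω * (x - a))) =
        Real.sin (ω * (y - x)) / (Real.sin (ω * (x - a)) * Real.sin (ω * (y - a))) := by
      rw [hsub]
      field_simp
      ring
    have hF' : -(f y - f a)⁻¹ - -(f x - f a)⁻¹ =
        (f y - f x) / ((f x - f a) * (f y - f a)) := by
      field_simp
      ring
    rw [hG', hF'] at h
    generalize (f y - f x) / ((f x - f a) * (f y - f a)) = A at *
    generalize Real.sin (ω * (y - x)) / (Real.sin (ω * (x - a)) * Real.sin (ω * (y - a))) = B at *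
    field_simp at h ⊢
    linarith
  obtain ⟨ξ, hξ, h1⟩ := key b c hab hbc hcd.le
  obtain ⟨η, hη, h2⟩ := key c d (hab.trans hbc) hcd le_rfl
  have hR : _ < _ := hanti (a := ξ) (b := η) ⟨hab.trans hξ.1, hξ.2.le.trans hcd.le⟩
    ⟨(hab.trans hbc).trans hη.1, hη.2.le⟩ (hξ.2.trans hη.1)
  simp only at hR
  have p1 := hsin a b le_rfl hab (hbc.trans hcd).le
  have p2 := hsin a c le_rfl (hab.trans hbc) hcd.le
  have p3 := hsin a d le_rfl (hab.trans (hbc.trans hcd)) le_rfl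
  have p4 := hsin b c hab.le hbc hcd.le
  have p5 := hsin c d (hab.trans hbc).le hcd le_rfl
  have q1 := hlt a b le_rfl hab (hbc.trans hcd).le
  have q2 := hlt a c le_rfl (hab.trans hbc) hcd.le
  have q3 := hlt a d le_rfl (hab.trans (hbc.trans hcd)) le_rfl
  have q4 := hlt b c hab.le hbc hcd.le
  have q5 := hlt c d (hab.trans hbc).le hcd le_rfl
  generalize Real.sin (ω * (ξ - a)) ^ 2 * f₁ ξ / (f ξ - f a) ^ 2 = R₁ at *
  generalize Real.sin (ω * (η - a)) ^ 2 * f₁ η / (f η - f a) ^ 2 = R₂ at *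
  have hR₂ : 0 < R₂ := by
    refine pos_of_mul_pos_left (b := Real.sin (ω * (d - c)) /
      (Real.sin (ω * (c - a)) * Real.sin (ω * (d - a)))) ?_ (by positivity)
    rw [← h2]
    positivity
  have e1 : crossRatio (f a) (f b) (f c) (f d) =
      ((f c - f b) / ((f b - f a) * (f c - f a)) * ω) /
        ((f d - f c) / ((f c - f a) * (f d - f a)) * ω) := by
    unfold crossRatio
    field_simp
  have e2 : Real.sin (ω * (d - a)) * Real.sin (ω * (c - b)) /
        (Real.sin (ω * (b - a)) * Real.sin (ω * (d - c))) =
      (R₂ * (Real.sin (ω * (c - b)) / (Real.sin (ω * (b - a)) * Real.sin (ω * (c - a))))) /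
        (R₂ * (Real.sin (ω * (d - c)) / (Real.sin (ω * (c - a)) * Real.sin (ω * (d - a))))) := by
    field_simp
  rw [e1, e2, h1, h2]
  gcongr

lemma mul_cos_lt_sin {x : ℝ} (h0 : 0 < x) (h1 : x < Real.pi / 2) : x * Real.cos x < Real.sin x := by
  have hc := Real.cos_pos_of_mem_Ioo ⟨by linarith, h1⟩
  have := Real.lt_tan h0 h1
  rwa [Real.tan_eq_sin_div_cos, lt_div_iff₀ hc] at this

lemma cos_sq_lt_crDist_of_deriv_pos {f f₁ f₂ f₃ : ℝ → ℝ} {a b c d ω : ℝ}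
    (hf : ∀ x, HasDerivAt f (f₁ x) x) (hf₁ : ∀ x, HasDerivAt f₁ (f₂ x) x)
    (hf₂ : ∀ x, HasDerivAt f₂ (f₃ x) x) (hpos : ∀ x ∈ Icc a d, 0 < f₁ x)
    (hS : ∀ x ∈ Icc a d, f₃ x / f₁ x - 3 / 2 * (f₂ x / f₁ x) ^ 2 < 2 * ω ^ 2)
    (hω : 0 < ω) (hπ : ω * (d - a) < Real.pi / 2) (hab : a < b) (hbc : b < c) (hcd : c < d) :
    Real.cos (ω * (d - a)) ^ 2 < crDist f a b c d := by
  have hX := sin_crossRatio_lt_of_schwarzian_lt hf hf₁ hf₂ hpos hS hω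
    (by linarith [Real.pi_pos]) hab hbc hcd
  unfold crDist
  generalize crossRatio (f a) (f b) (f c) (f d) = X at *
  unfold crossRatio
  have L := sub_pos.2 hab
  have J := sub_pos.2 hbc
  have R := sub_pos.2 hcd
  have T := sub_pos.2 (hab.trans (hbc.trans hcd))
  have hle : ∀ {y}, y ≤ d - a → ω * y ≤ ω * (d - a) := fun h => by gcongr
  have hcos : 0 < Real.cos (ω * (d - a)) :=
    Real.cos_pos_of_mem_Ioo ⟨by linarith [mul_pos hω T, Real.pi_pos], hπ⟩
  have sL := Real.sin_pos_of_pos_of_lt_pi (mul_pos hω L)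
    (by linarith [hle (y := b - a) (by linarith), Real.pi_pos])
  have sR := Real.sin_pos_of_pos_of_lt_pi (mul_pos hω R)
    (by linarith [hle (y := d - c) (by linarith), Real.pi_pos])
  have sL' := Real.sin_lt (mul_pos hω L)
  have sR' := Real.sin_lt (mul_pos hω R)
  have sT := mul_cos_lt_sin (mul_pos hω T) hπ
  have sJ := mul_cos_lt_sin (mul_pos hω J) ((hle (by linarith)).trans_lt hπ)
  have hcosJ : Real.cos (ω * (d - a)) ≤ Real.cos (ω * (c - b)) :=
    Real.cos_le_cos_of_nonneg_of_le_pi (mul_pos hω J).le (by linarith [Real.pi_pos])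
      (hle (by linarith))
  have sJ' : ω * (c - b) * Real.cos (ω * (d - a)) < Real.sin (ω * (c - b)) :=
    (mul_le_mul_of_nonneg_left hcosJ (mul_pos hω J).le).trans_lt sJ
  refine lt_of_lt_of_le ?_ (div_le_div_of_nonneg_right hX.le (by positivity))
  calc Real.cos (ω * (d - a)) ^ 2
      = ((ω * (d - a) * Real.cos (ω * (d - a))) * (ω * (c - b) * Real.cos (ω * (d - a))) /
          ((ω * (b - a)) * (ω * (d - c)))) /
            ((d - a) * (c - b) / ((b - a) * (d - c))) := by
        field_simp
    _ < _ := by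
        have := (mul_pos (mul_pos hω T) hcos).trans sT
        have := (mul_pos (mul_pos hω J) hcos).trans sJ'
        gcongr

/-- If `f : T → f(T)` is a C³ diffeomorphism with `Sf < C` on `T`,
`C > 0` and `C |T|² < π²/2`, then for any interval `J ⊂ T` one has
`B(f,T,J) > cos²(√(C/2)·|T|)`. -/
theorem stmt_6 (f : ℝ → ℝ) (t1 t2 : ℝ) (h12 : t1 < t2)
    (hf : ContDiff ℝ 3 f) (hdiff : ∀ x ∈ Icc t1 t2, deriv f x ≠ 0)
    (C : ℝ) (hC : 0 < C) (hS : ∀ x ∈ Icc t1 t2, schwarzian f x < C)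
    (hCT : C * (t2 - t1) ^ 2 < Real.pi ^ 2 / 2)
    (j1 j2 : ℝ) (h1 : t1 < j1) (h2 : j1 < j2) (h3 : j2 < t2) :
    crDist f t1 j1 j2 t2 > Real.cos (Real.sqrt (C / 2) * (t2 - t1)) ^ 2 := by
  have hd : ∀ n : ℕ, n < 3 → ∀ x, HasDerivAt (iteratedDeriv n f) (iteratedDeriv (n + 1) f x) x := by
    intro n hn x
    rw [iteratedDeriv_succ]
    exact (hf.differentiable_iteratedDeriv n (by exact_mod_cast hn) x).hasDerivAt
  have hf0 : ∀ x, HasDerivAt f (deriv f x) x := fun x => by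
    simpa using hd 0 (by norm_num) x
  have hf1 : ∀ x, HasDerivAt (deriv f) (iteratedDeriv 2 f x) x := fun x => by
    simpa using hd 1 (by norm_num) x
  have hf2 : ∀ x, HasDerivAt (iteratedDeriv 2 f) (iteratedDeriv 3 f x) x := fun x =>
    hd 2 (by norm_num) x
  have hω : 0 < √(C / 2) := by positivity
  have hω2 : 2 * √(C / 2) ^ 2 = C := by
    rw [Real.sq_sqrt (by positivity)]
    ring
  have hT : √(C / 2) * (t2 - t1) < Real.pi / 2 := by
    refine lt_of_pow_lt_pow_left₀ 2 (by positivity) ?_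
    rw [mul_pow, Real.sq_sqrt (by positivity)]
    linarith
  have hsign : (∀ x ∈ Icc t1 t2, 0 < deriv f x) ∨ ∀ x ∈ Icc t1 t2, deriv f x < 0 := by
    have hconn : IsPreconnected (deriv f '' Icc t1 t2) := isPreconnected_Icc.image _
      fun x _ => (hf1 x).continuousAt.continuousWithinAt
    by_contra! h
    obtain ⟨⟨x, hx, hx0⟩, y, hy, hy0⟩ := h
    obtain ⟨z, hz, hz0⟩ := hconn.ordConnected.out (mem_image_of_mem _ hx) (mem_image_of_mem _ hy)
      ⟨hx0, hy0⟩
    exact hdiff z hz hz0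
  rcases hsign with hpos | hneg
  · exact cos_sq_lt_crDist_of_deriv_pos hf0 hf1 hf2 hpos (by rwa [hω2])
      hω hT h1 h2 h3
  · have h := cos_sq_lt_crDist_of_deriv_pos (fun x => (hf0 x).neg) (fun x => (hf1 x).neg)
      (fun x => (hf2 x).neg) (fun x hx => neg_pos.2 (hneg x hx))
      (by simpa only [hω2, schwarzian, Pi.neg_apply, neg_div_neg_eq] using hS) hω hT h1 h2 h3
    have e : crDist (-f) t1 j1 j2 t2 = crDist f t1 j1 j2 t2 := by
      simp only [crDist, crossRatio, Pi.neg_apply]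
      congr 1
      congr 1 <;> ring
    rwa [e] at h
end
end

section
/- (Sturm-type comparison via the Picone identity) Let C > 0 with C < π²/2, let q: [0,1] → ℝ be continuous with q(x) < C for all x, and let 0 ≤ u₁ < u₂ ≤ 1. Suppose φ: [0,1] → ℝ is C² with φ''(x) = −(1/2) q(x) φ(x), φ(u₁) = φ(u₂) = 1, and φ(x) > 0 for all x ∈ [0,1]; and suppose ψ: [0,1] → ℝ satisfies ψ''(x) = −(1/2) C ψ(x) with ψ(u₁) = ψ(u₂) = 1. Then φ(x) ≤ ψ(x) for all x ∈ [u₁, u₂], and φ(x) ≥ ψ(x) for all x ∈ [u₂, 1]. -/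
open Set Filter Topology MeasureTheory

noncomputable section

/-- A solution of `f'' = -k² f` is a combination of `cos (k (x - m))` and `sin (k (x - m))`. -/
theorem exists_eq_cos_add_sin_of_hasDerivAt {a b k : ℝ} (hk : k ≠ 0) (m : ℝ) {f f' : ℝ → ℝ}
    (hf : ∀ x ∈ Icc a b, HasDerivAt f (f' x) x)
    (hf' : ∀ x ∈ Icc a b, HasDerivAt f' (-k ^ 2 * f x) x) :
    ∃ A B : ℝ, ∀ x ∈ Icc a b, f x = A * Real.cos (k * (x - m)) + B * Real.sin (k * (x - m)) := by
  have hlin (x : ℝ) : HasDerivAt (fun y => k * (y - m)) k x := by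
    simpa using ((hasDerivAt_id x).sub_const m).const_mul k
  have hF : ∀ x ∈ Icc a b, HasDerivAt
      (fun y => f y * Real.cos (k * (y - m)) - f' y / k * Real.sin (k * (y - m))) 0 x := by
    intro x hx
    refine (((hf x hx).mul (hlin x).cos).sub
      (((hf' x hx).div_const k).mul (hlin x).sin)).congr_deriv ?_
    field_simp
    ring
  have hG : ∀ x ∈ Icc a b, HasDerivAt
      (fun y => f y * Real.sin (k * (y - m)) + f' y / k * Real.cos (k * (y - m))) 0 x := by
    intro x hx
    refine (((hf x hx).mul (hlin x).sin).add
      (((hf' x hx).div_const k).mul (hlin x).cos)).congr_deriv ?_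
    field_simp
    ring
  have hFc := constant_of_has_deriv_right_zero
    (fun x hx => (hF x hx).continuousAt.continuousWithinAt)
    (fun x hx => (hF x (Ico_subset_Icc_self hx)).hasDerivWithinAt)
  have hGc := constant_of_has_deriv_right_zero
    (fun x hx => (hG x hx).continuousAt.continuousWithinAt)
    (fun x hx => (hG x (Ico_subset_Icc_self hx)).hasDerivWithinAt)
  refine ⟨f a * Real.cos (k * (a - m)) - f' a / k * Real.sin (k * (a - m)),
    f a * Real.sin (k * (a - m)) + f' a / k * Real.cos (k * (a - m)), fun x hx => ?_⟩
  rw [← hFc x hx, ← hGc x hx]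
  linear_combination -f x * Real.sin_sq_add_cos_sq (k * (x - m))

/-- A solution of `f'' = -k² f` with equal positive values at two points is positive on any
interval containing them of length less than `π / (2 k)`. -/
theorem pos_of_hasDerivAt_neg_sq_mul {a b k u v : ℝ} (hk : 0 < k)
    (hkab : k * (b - a) < Real.pi / 2) {f f' : ℝ → ℝ}
    (hf : ∀ x ∈ Icc a b, HasDerivAt f (f' x) x)
    (hf' : ∀ x ∈ Icc a b, HasDerivAt f' (-k ^ 2 * f x) x)
    (hu : a ≤ u) (huv : u < v) (hv : v ≤ b) (hfu : 0 < f u) (hfv : f u = f v) :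
    ∀ x ∈ Icc a b, 0 < f x := by
  obtain ⟨A, B, hAB⟩ := exists_eq_cos_add_sin_of_hasDerivAt hk.ne' ((u + v) / 2) hf hf'
  have hd : 0 < k * ((v - u) / 2) := mul_pos hk (by linarith)
  have hcos : ∀ x ∈ Icc a b, 0 < Real.cos (k * (x - (u + v) / 2)) := by
    intro x hx
    apply Real.cos_pos_of_mem_Ioo
    constructor <;> nlinarith [hx.1, hx.2]
  have hsin : 0 < Real.sin (k * ((v - u) / 2)) :=
    Real.sin_pos_of_pos_of_lt_pi hd (by nlinarith [Real.pi_pos])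
  have hmemu : u ∈ Icc a b := ⟨hu, by linarith⟩
  have hAu := hAB u hmemu
  have hAv := hAB v ⟨by linarith, hv⟩
  have hcu := hcos u hmemu
  rw [show k * (u - (u + v) / 2) = -(k * ((v - u) / 2)) by ring, Real.cos_neg] at hcu hAu
  rw [Real.sin_neg] at hAu
  rw [show k * (v - (u + v) / 2) = k * ((v - u) / 2) by ring] at hAv
  have hB : B = 0 := by
    have h : B * Real.sin (k * ((v - u) / 2)) = 0 := by linarith
    exact (mul_eq_zero.mp h).resolve_right hsin.ne'
  have hA : 0 < A := by
    refine pos_of_mul_pos_left ?_ hcu.le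
    rw [hB] at hAu
    linarith
  intro x hx
  rw [hAB x hx, hB, zero_mul, add_zero]
  exact mul_pos hA (hcos x hx)

/-- Sturm comparison: if `f g'' ≤ f'' g` on `[u, b]` with `g` positive, and `f`, `g` agree at `u`
and at `v`, then `f ≤ g` on `[u, v]` and `g ≤ f` on `[v, b]`. -/
theorem sturm_comparison_of_pos {u v b : ℝ} (huv : u < v) (hvb : v ≤ b)
    {f f' f'' g g' g'' : ℝ → ℝ}
    (hf : ∀ x ∈ Icc u b, HasDerivAt f (f' x) x) (hf' : ∀ x ∈ Icc u b, HasDerivAt f' (f'' x) x)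
    (hg : ∀ x ∈ Icc u b, HasDerivAt g (g' x) x) (hg' : ∀ x ∈ Icc u b, HasDerivAt g' (g'' x) x)
    (hgpos : ∀ x ∈ Icc u b, 0 < g x) (hfg : ∀ x ∈ Icc u b, f x * g'' x ≤ f'' x * g x)
    (hu : f u = g u) (hv : f v = g v) :
    (∀ x ∈ Icc u v, f x ≤ g x) ∧ ∀ x ∈ Icc v b, g x ≤ f x := by
  have hW : ∀ x ∈ Icc u b, HasDerivAt (fun y => f' y * g y - f y * g' y)
      (f'' x * g x - f x * g'' x) x := fun x hx =>
    (((hf' x hx).mul (hg x hx)).sub ((hf x hx).mul (hg' x hx))).congr_deriv (by ring)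
  have hR : ∀ x ∈ Icc u b, HasDerivAt (fun y => f y / g y)
      ((f' x * g x - f x * g' x) / g x ^ 2) x := fun x hx =>
    (hf x hx).div (hg x hx) (hgpos x hx).ne'
  have hWmono : MonotoneOn (fun y => f' y * g y - f y * g' y) (Icc u b) := by
    refine monotoneOn_of_hasDerivWithinAt_nonneg (convex_Icc u b)
      (fun x hx => (hW x hx).continuousAt.continuousWithinAt)
      (fun x hx => (hW x (interior_subset hx)).hasDerivWithinAt) fun x hx => ?_
    linarith [hfg x (interior_subset hx)]
  have hub : u ∈ Icc u b := ⟨le_rfl, huv.le.trans hvb⟩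
  have hvb' : v ∈ Icc u b := ⟨huv.le, hvb⟩
  have hRu : f u / g u = 1 := by rw [hu, div_self (hgpos u hub).ne']
  have hRv : f v / g v = 1 := by rw [hv, div_self (hgpos v hvb').ne']
  obtain ⟨c, hc, hc0⟩ := exists_hasDerivAt_eq_zero huv
    (f := fun y => f y / g y) (f' := fun x => (f' x * g x - f x * g' x) / g x ^ 2)
    (fun x hx => (hR x ⟨hx.1, hx.2.trans hvb⟩).continuousAt.continuousWithinAt)
    (hRu.trans hRv.symm) (fun x hx => hR x ⟨hx.1.le, hx.2.le.trans hvb⟩)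
  have hcb : c ∈ Icc u b := ⟨hc.1.le, hc.2.le.trans hvb⟩
  have hWc : f' c * g c - f c * g' c = 0 :=
    (div_eq_zero_iff.mp hc0).resolve_right (pow_pos (hgpos c hcb) 2).ne'
  have hanti : AntitoneOn (fun y => f y / g y) (Icc u c) := by
    have hsub : Icc u c ⊆ Icc u b := Icc_subset_Icc_right hcb.2
    refine antitoneOn_of_hasDerivWithinAt_nonpos (convex_Icc u c)
      (fun x hx => (hR x (hsub hx)).continuousAt.continuousWithinAt)
      (fun x hx => (hR x (hsub (interior_subset hx))).hasDerivWithinAt) fun x hx => ?_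
    have hx := interior_subset hx
    exact div_nonpos_of_nonpos_of_nonneg ((hWmono (hsub hx) hcb hx.2).trans_eq hWc) (sq_nonneg _)
  have hmono : MonotoneOn (fun y => f y / g y) (Icc c b) := by
    have hsub : Icc c b ⊆ Icc u b := Icc_subset_Icc_left hcb.1
    refine monotoneOn_of_hasDerivWithinAt_nonneg (convex_Icc c b)
      (fun x hx => (hR x (hsub hx)).continuousAt.continuousWithinAt)
      (fun x hx => (hR x (hsub (interior_subset hx))).hasDerivWithinAt) fun x hx => ?_
    have hx := interior_subset hx
    exact div_nonneg (hWc.symm.trans_le (hWmono hcb (hsub hx) hx.1)) (sq_nonneg _)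
  have hvc : v ∈ Icc c b := ⟨hc.2.le, hvb⟩
  refine ⟨fun x hx => (div_le_one (hgpos x ⟨hx.1, hx.2.trans hvb⟩)).mp ?_,
    fun x hx => (one_le_div (hgpos x ⟨huv.le.trans hx.1, hx.2⟩)).mp ?_⟩
  · rcases le_total x c with hxc | hcx
    · exact (hanti ⟨le_rfl, hc.1.le⟩ ⟨hx.1, hxc⟩ hx.1).trans_eq hRu
    · exact (hmono ⟨hcx, hx.2.trans hvb⟩ hvc hx.2).trans_eq hRv
  · exact hRv.symm.trans_le (hmono hvc ⟨hc.2.le.trans hx.1, hx.2⟩ hx.1)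

theorem ContDiff.hasDerivAt_deriv_iteratedDeriv_two {f : ℝ → ℝ} (hf : ContDiff ℝ 2 f) (x : ℝ) :
    HasDerivAt (deriv f) (iteratedDeriv 2 f x) x := by
  have h := (hf.differentiable_iteratedDeriv 1 (by norm_num) x).hasDerivAt
  rwa [← iteratedDeriv_succ, iteratedDeriv_one] at h

/-- **Sturm-type comparison via the Picone identity.** If
`φ'' = -(1/2) q φ` with `q < C < π²/2`, `φ > 0` on `[0,1]`, `φ(u₁) = φ(u₂) = 1`, and
`ψ'' = -(1/2) C ψ` with `ψ(u₁) = ψ(u₂) = 1`, then `φ ≤ ψ` on `[u₁,u₂]` and `φ ≥ ψ`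
on `[u₂,1]`. -/
theorem stmt_8 (C : ℝ) (hC : 0 < C) (hC2 : C < Real.pi ^ 2 / 2)
    (q : ℝ → ℝ) (hq : ContinuousOn q (Icc 0 1)) (hqC : ∀ x ∈ Icc (0 : ℝ) 1, q x < C)
    (u1 u2 : ℝ) (h0 : 0 ≤ u1) (h12 : u1 < u2) (h21 : u2 ≤ 1)
    (φ ψ : ℝ → ℝ) (hφ : ContDiff ℝ 2 φ)
    (hφode : ∀ x ∈ Icc (0 : ℝ) 1, iteratedDeriv 2 φ x = -(1 / 2) * q x * φ x)
    (hφ1 : φ u1 = 1) (hφ2 : φ u2 = 1) (hφpos : ∀ x ∈ Icc (0 : ℝ) 1, 0 < φ x)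
    (hψ : ContDiff ℝ 2 ψ)
    (hψode : ∀ x ∈ Icc (0 : ℝ) 1, iteratedDeriv 2 ψ x = -(1 / 2) * C * ψ x)
    (hψ1 : ψ u1 = 1) (hψ2 : ψ u2 = 1) :
    (∀ x ∈ Icc u1 u2, φ x ≤ ψ x) ∧ (∀ x ∈ Icc u2 1, ψ x ≤ φ x) := by
  have hφ' (x : ℝ) : HasDerivAt φ (deriv φ x) x := (hφ.differentiable (by norm_num) x).hasDerivAt
  have hψ' (x : ℝ) : HasDerivAt ψ (deriv ψ x) x := (hψ.differentiable (by norm_num) x).hasDerivAt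
  have hk : √(C / 2) < Real.pi / 2 :=
    (Real.sqrt_lt' (by positivity)).mpr (by linarith [div_pow Real.pi 2 2])
  have hk2 : √(C / 2) ^ 2 = C / 2 := Real.sq_sqrt (by positivity)
  have hψpos : ∀ x ∈ Icc (0 : ℝ) 1, 0 < ψ x :=
    pos_of_hasDerivAt_neg_sq_mul (k := √(C / 2)) (Real.sqrt_pos.mpr (by positivity))
      (by rwa [sub_zero, mul_one])
      (fun x _ => hψ' x)
      (fun x hx => (hψ.hasDerivAt_deriv_iteratedDeriv_two x).congr_deriv
        (by rw [hψode x hx, hk2]; ring))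
      h0 h12 h21 (by rw [hψ1]; exact one_pos) (hψ1.trans hψ2.symm)
  have hsub : Icc u1 1 ⊆ Icc 0 1 := Icc_subset_Icc_left h0
  refine sturm_comparison_of_pos h12 h21 (fun x _ => hφ' x)
    (fun x _ => hφ.hasDerivAt_deriv_iteratedDeriv_two x) (fun x _ => hψ' x)
    (fun x _ => hψ.hasDerivAt_deriv_iteratedDeriv_two x) (fun x hx => hψpos x (hsub hx))
    (fun x hx => ?_) (hφ1.trans hψ1.symm) (hφ2.trans hψ2.symm)
  have hx := hsub hx
  rw [hφode x hx, hψode x hx]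
  nlinarith [mul_pos (sub_pos.mpr (hqC x hx)) (mul_pos (hφpos x hx) (hψpos x hx))]
end
end
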